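/- Let K_* ⊂ U be the unique maximal full compact set with g⁻¹(K_*) = K_*, and let R_g be the closure in the Riemann sphere of the set of repelling periodic points of g : U' → U. If P_g ⊂ K_* and K_* is the filled Julia set of a polynomial-like restriction of g, then R_g = ∂K_*. In the remaining cases (K_* = ∅, or ∂K_* ⊂ P_g with C_g \ K_* ≠ ∅), the compact set R_g contains a nontrivial continuum which has common points with U as well as with ∂U. -/

import Mathlib

open Set Function Metric Topology Filter

noncomputable section

/-- A topological disk: a (nonempty, connected) simply connected planar domain. -/
def IsTopDisk (V : Set ℂ) : Prop :=
  IsOpen V ∧ IsConnected V ∧ SimplyConnectedSpace V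

/-- Critical points of `g` lying in `U'`. -/
def critPts (g : ℂ → ℂ) (U' : Set ℂ) : Set ℂ := {z | z ∈ U' ∧ deriv g z = 0}

/-- The postcritical set of `g : U' → U`. -/
def postCrit (g : ℂ → ℂ) (U' : Set ℂ) : Set ℂ :=
  closure (⋃ n : ℕ, g^[n] '' critPts g U')

/-- `g : U' → U` is a proper map: preimages of compact subsets of `U` are compact. -/
def ProperOn (g : ℂ → ℂ) (U' U : Set ℂ) : Prop :=
  ∀ K : Set ℂ, K ⊆ U → IsCompact K → IsCompact (U' ∩ g ⁻¹' K)

/-- `g : U' → U` has degree `d`: every point of `U` has a preimage, and every point of `U`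
which is not a critical value has exactly `d` preimages in `U'`. -/
def HasDeg (g : ℂ → ℂ) (U' U : Set ℂ) (d : ℕ) : Prop :=
  (∀ w ∈ U, (U' ∩ g ⁻¹' {w}).Nonempty) ∧
  ∀ w ∈ U, w ∉ g '' critPts g U' → (U' ∩ g ⁻¹' {w}).ncard = d

/-- Standing assumptions: `U' ⊆ U` are simply connected domains in `ℂ` with `U' ≠ U`,
`g : U' → U` is a proper holomorphic map of degree `d ≥ 2`, all forward iterates of the
critical points are defined, the postcritical set is a compact subset of `U'`, and if the
postcritical set is a singleton `{c}` then `g⁻¹(c) ≠ {c}`. -/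
structure PLSetting (g : ℂ → ℂ) (U' U : Set ℂ) (d : ℕ) : Prop where
  disk' : IsTopDisk U'
  disk : IsTopDisk U
  subset : U' ⊆ U
  ne : U' ≠ U
  two_le_d : 2 ≤ d
  holo : DifferentiableOn ℂ g U'
  mapsTo : MapsTo g U' U
  proper : ProperOn g U' U
  deg : HasDeg g U' U d
  crit_orbit : ∀ c ∈ critPts g U', ∀ n : ℕ, g^[n] c ∈ U'
  postCrit_compact : IsCompact (postCrit g U')
  postCrit_subset : postCrit g U' ⊆ U'
  postCrit_singleton : ∀ c : ℂ, postCrit g U' = {c} → U' ∩ g ⁻¹' {c} ≠ {c}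

/-- `g : V' → V` is a polynomial-like map of degree `d`. -/
def IsPolyLike (g : ℂ → ℂ) (V' V : Set ℂ) (d : ℕ) : Prop :=
  IsTopDisk V' ∧ IsTopDisk V ∧ closure V' ⊆ V ∧ DifferentiableOn ℂ g V' ∧
    MapsTo g V' V ∧ ProperOn g V' V ∧ HasDeg g V' V d

/-- The filled Julia set: points whose entire forward orbit stays in `V'`. -/
def filledJulia (g : ℂ → ℂ) (V' : Set ℂ) : Set ℂ := {z | ∀ n : ℕ, g^[n] z ∈ V'}

/-- Repelling periodic points of `g : U' → U`. -/
def repellingPts (g : ℂ → ℂ) (U' : Set ℂ) : Set ℂ :=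
  {a | ∃ p : ℕ, 1 ≤ p ∧ (∀ n : ℕ, g^[n] a ∈ U') ∧ g^[p] a = a ∧ 1 < ‖deriv (g^[p]) a‖}

/-- `R_g`: the closure in the Riemann sphere (one-point compactification of `ℂ`) of the set
of repelling periodic points of `g : U' → U`. -/
def sphereRepClosure (g : ℂ → ℂ) (U' : Set ℂ) : Set (OnePoint ℂ) :=
  closure ((fun z : ℂ => (z : OnePoint ℂ)) '' repellingPts g U')

namespace RC

/-- Quantitative open mapping. -/
lemma hit {f : ℂ → ℂ} {D : Set ℂ} (hD : IsOpen D) (hf : DifferentiableOn ℂ f D) {z₀ : ℂ} {r m : ℝ}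
    (hr : 0 < r) (hm : 0 < m) (hsub : closedBall z₀ r ⊆ D)
    (h : ∀ z ∈ sphere z₀ r, m ≤ ‖f z - f z₀‖) : ball (f z₀) (m / 2) ⊆ f '' closedBall z₀ r := by
  refine DiffContOnCl.ball_subset_image_closedBall ?_ hr h ?_
  · exact (hf.mono ((closure_ball_subset_closedBall).trans hsub)).diffContOnCl
  · by_contra hcon
    rw [not_frequently] at hcon
    have h1 : AnalyticOnNhd ℂ f (closedBall z₀ r) := fun z hz =>
      hf.analyticAt (hD.mem_nhds (hsub hz))
    have h2 : EqOn f (fun _ => f z₀) (closedBall z₀ r) :=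
      h1.eqOn_of_preconnected_of_eventuallyEq (fun _ _ => analyticAt_const)
        (convex_closedBall _ _).isPreconnected (mem_closedBall_self hr.le)
        (hcon.mono fun z hz => by simpa using hz)
    obtain ⟨z, hz⟩ : (sphere z₀ r).Nonempty := NormedSpace.sphere_nonempty.mpr hr.le
    have := h z hz
    rw [h2 (sphere_subset_closedBall hz)] at this
    simp at this
    linarith

lemma schwarz_bdd {f : ℂ → ℂ} {c : ℂ} {R M : ℝ} (hf : DifferentiableOn ℂ f (ball c R))
    (hb : ∀ z ∈ ball c R, ‖f z‖ ≤ M) {z : ℂ} (hz : z ∈ ball c R) :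
    dist (f z) (f c) ≤ 2 * M / R * dist z c := by
  have hR : 0 < R := nonempty_ball.1 ⟨z, hz⟩
  refine Complex.dist_le_div_mul_dist_of_mapsTo_ball hf (fun w hw => ?_) hz
  rw [mem_closedBall, dist_eq_norm]
  calc _ ≤ ‖f w‖ + ‖f c‖ := norm_sub_le _ _
    _ ≤ 2 * M := by linarith [hb w hw, hb c (mem_ball_self hR)]

/-- Montel along ultrafilters. -/
lemma montel {ι : Type*} (F : Ultrafilter ι) {D : Set ℂ} (hD : IsOpen D) {M : ℝ} (f : ι → ℂ → ℂ)
    (hf : ∀ i, DifferentiableOn ℂ (f i) D) (hb : ∀ i, ∀ z ∈ D, ‖f i z‖ ≤ M) :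
    ∃ f' : ℂ → ℂ, TendstoLocallyUniformlyOn f f' F D ∧ DifferentiableOn ℂ f' D ∧
      (∀ z ∈ D, ‖f' z‖ ≤ M) ∧ ∀ z ∈ D, Tendsto (fun i => f i z) F (𝓝 (f' z)) := by
  have h1 : ∀ z, ∃ w, z ∈ D → ‖w‖ ≤ M ∧ Tendsto (fun i => f i z) F (𝓝 w) := by
    intro z
    by_cases hz : z ∈ D
    · have := (isCompact_closedBall (0 : ℂ) M).ultrafilter_le_nhds' (F.map fun i => f i z)
        (by
          rw [Ultrafilter.mem_map]
          filter_upwards with i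
          simpa using hb i z hz)
      obtain ⟨w, hw, hw2⟩ := this
      exact ⟨w, fun _ => ⟨by simpa using hw, hw2⟩⟩
    · exact ⟨0, fun h => absurd h hz⟩
  choose f' hf' using h1
  have key : TendstoLocallyUniformlyOn f f' F D := by
    rw [Metric.tendstoLocallyUniformlyOn_iff]
    intro ε hε x hx
    obtain ⟨R, hR, hRD⟩ := Metric.isOpen_iff.1 hD x hx
    have hM : 0 ≤ M := (norm_nonneg _).trans (hf' x hx).1
    obtain ⟨s, hs, hs2⟩ : ∃ s > 0, 2 * M / R * s < ε / 3 := by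
      refine ⟨ε / 3 / (2 * M / R + 1), by positivity, ?_⟩
      rw [← mul_div_assoc, div_lt_iff₀ (by positivity)]
      nlinarith [show 0 ≤ 2 * M / R by positivity]
    have e1 : ∀ y ∈ ball x (min s R), ∀ i, dist (f i y) (f i x) < ε / 3 := by
      intro y hy i
      refine (schwarz_bdd ((hf i).mono hRD) (fun z hz => hb i z (hRD hz))
        (ball_subset_ball (min_le_right _ _) hy)).trans_lt ?_
      refine lt_of_le_of_lt ?_ hs2
      have : dist y x ≤ s := (ball_subset_ball (min_le_left _ _) hy : _ ∈ ball x s).le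
      gcongr
    refine ⟨ball x (min s R), mem_nhdsWithin_of_mem_nhds (ball_mem_nhds _ (lt_min hs hR)), ?_⟩
    have e2 := (Metric.tendsto_nhds.1 (hf' x hx).2) (ε / 3) (by positivity)
    filter_upwards [e2] with i hi y hy
    have hyD : y ∈ D := hRD (ball_subset_ball (min_le_right _ _) hy)
    have e3 : dist (f' y) (f' x) ≤ ε / 3 :=
      le_of_tendsto ((hf' y hyD).2.dist (hf' x hx).2) (Eventually.of_forall fun i => (e1 y hy i).le)
    have e4 := e1 y hy i
    have t1 := dist_triangle4 (f' y) (f' x) (f i x) (f i y)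
    rw [dist_comm (f' x)] at t1
    rw [dist_comm (f i x) (f i y)] at t1
    linarith
  exact ⟨f', key, key.differentiableOn (Eventually.of_forall hf) hD, fun z hz => (hf' z hz).1,
    fun z hz => (hf' z hz).2⟩

/-- Hurwitz: values persist. -/
lemma hurwitz {ι : Type*} {F : Filter ι} [F.NeBot] {D : Set ℂ} (hD : IsOpen D) {f : ι → ℂ → ℂ}
    {f' : ℂ → ℂ} (hf : ∀ i, DifferentiableOn ℂ (f i) D) (hlim : TendstoLocallyUniformlyOn f f' F D)
    {z₀ : ℂ} (hz₀ : z₀ ∈ D) (hnc : ¬ ∀ᶠ z in 𝓝 z₀, f' z = f' z₀) {N : Set ℂ} (hN : N ∈ 𝓝 z₀) :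
    ∀ᶠ i in F, ∃ z ∈ N, f i z = f' z₀ := by
  have hf' : DifferentiableOn ℂ f' D := hlim.differentiableOn (Eventually.of_forall hf) hD
  have han : AnalyticAt ℂ (fun z => f' z - f' z₀) z₀ :=
    (hf'.analyticAt (hD.mem_nhds hz₀)).sub analyticAt_const
  have hne : ∀ᶠ z in 𝓝[≠] z₀, f' z - f' z₀ ≠ 0 := by
    rcases han.eventually_eq_zero_or_eventually_ne_zero with h | h
    · exact absurd (h.mono fun z hz => sub_eq_zero.1 hz) hnc
    · exact h
  rw [eventually_nhdsWithin_iff] at hne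
  obtain ⟨r0, hr0, hsub⟩ := Metric.nhds_basis_closedBall.mem_iff.1
    (inter_mem (inter_mem hN (hD.mem_nhds hz₀)) hne)
  have hs0 : sphere z₀ r0 ⊆ closedBall z₀ r0 := sphere_subset_closedBall
  have hcD : closedBall z₀ r0 ⊆ D := fun z hz => (hsub hz).1.2
  have hcont : ContinuousOn (fun z => ‖f' z - f' z₀‖) (sphere z₀ r0) :=
    ((hf'.continuousOn.mono (hs0.trans hcD)).sub continuousOn_const).norm
  obtain ⟨w, hw, hmin⟩ := (isCompact_sphere z₀ r0).exists_isMinOn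
    (NormedSpace.sphere_nonempty.mpr hr0.le) hcont
  set m := ‖f' w - f' z₀‖ with hm
  have hmpos : 0 < m := by
    have : f' w - f' z₀ ≠ 0 := (hsub (hs0 hw)).2 (by
      rintro rfl
      simp at hw; exact hr0.ne hw)
    positivity
  have hu := (tendstoLocallyUniformlyOn_iff_forall_isCompact hD).1 hlim _ hcD
    (isCompact_closedBall z₀ r0)
  rw [Metric.tendstoUniformlyOn_iff] at hu
  filter_upwards [hu (m / 4) (by positivity)] with i hi
  have h1 : ∀ z ∈ sphere z₀ r0, m / 2 ≤ ‖f i z - f i z₀‖ := by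
    intro z hz
    have a1 := hi z (hs0 hz)
    have a2 := hi z₀ (mem_closedBall_self hr0.le)
    have a3 : m ≤ ‖f' z - f' z₀‖ := hmin hz
    rw [dist_eq_norm] at a1 a2
    have a4 : ‖f' z - f' z₀‖ ≤ ‖f' z - f i z‖ + ‖f i z - f i z₀‖ + ‖f' z₀ - f i z₀‖ := by
      have : f' z - f' z₀ = (f' z - f i z) + (f i z - f i z₀) - (f' z₀ - f i z₀) := by ring
      rw [this]
      exact (norm_sub_le _ _).trans (add_le_add_left (norm_add_le _ _) _)
    linarith
  have h2 := hit hD (hf i) hr0 (by positivity : 0 < m / 2) hcD h1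
  obtain ⟨z, hz, hz2⟩ := h2 (show f' z₀ ∈ _ by
    have := hi z₀ (mem_closedBall_self hr0.le)
    rw [mem_ball]; linarith)
  exact ⟨z, (hsub hz).1.1, hz2⟩

end RC

namespace RC

/-- A continuous lift of a holomorphic map through a locally biholomorphic map is holomorphic. -/
lemma lift_diff {g k q : ℂ → ℂ} {z : ℂ} (hq : ContinuousAt q z) (hg : AnalyticAt ℂ g (q z))
    (hg0 : deriv g (q z) ≠ 0) (hk : DifferentiableAt ℂ k z) (h : ∀ᶠ w in 𝓝 z, g (q w) = k w) :
    DifferentiableAt ℂ q z := by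
  have hs := hg.hasStrictDerivAt
  have h1 : ∀ᶠ w in 𝓝 z, HasStrictDerivAt.localInverse g _ (q z) hs hg0 (k w) = q w := by
    filter_upwards [h, hq.eventually (HasStrictDerivAt.eventually_left_inverse hs hg0)] with w h1 h2
    rw [← h1, h2]
  have h2 : DifferentiableAt ℂ (HasStrictDerivAt.localInverse g _ (q z) hs hg0) (k z) := by
    rw [← h.self_of_nhds]
    exact (HasStrictDerivAt.to_localInverse hs hg0).hasDerivAt.differentiableAt
  exact (h2.comp z hk).congr_of_eventuallyEq (h1.mono fun w hw => hw.symm)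

lemma holo_sqrt {U : Set ℂ} (hUo : IsOpen U) (hUc : IsSimplyConnected U) {h : ℂ → ℂ}
    (hh : DifferentiableOn ℂ h U) (h0 : ∀ z ∈ U, h z ≠ 0) :
    ∃ s : ℂ → ℂ, DifferentiableOn ℂ s U ∧ ∀ z ∈ U, s z ^ 2 = h z := by
  obtain ⟨θ, hθ, hθ2⟩ := Complex.exists_continuousOn_eqOn_exp_comp hUc hUo hh.continuousOn
    (by rintro ⟨z, hz, hz0⟩; exact h0 z hz hz0)
  have hsq : ∀ z ∈ U, (Complex.exp (θ z / 2)) ^ 2 = h z := by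
    intro z hz
    rw [← Complex.exp_nat_mul]
    have := hθ2 hz
    simp only [comp_apply] at this
    rw [← this]; congr 1; push_cast; ring
  refine ⟨fun z => Complex.exp (θ z / 2), fun z hz => ?_, hsq⟩
  have hz' := hUo.mem_nhds hz
  refine (lift_diff (g := fun w => w ^ 2) (k := h) ?_ (by fun_prop) (by
    simp) ((hh z hz).differentiableAt hz') ?_).differentiableWithinAt
  · exact Complex.continuous_exp.continuousAt.comp ((hθ.continuousAt hz').div_const 2)
  · filter_upwards [hz'] with w hw using hsq w hw

/-- Moebius maps of the disc. -/
def mob (a z : ℂ) : ℂ := (z - a) / (1 - (starRingEnd ℂ) a * z)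

lemma mob_den {a z : ℂ} (ha : ‖a‖ < 1) (hz : ‖z‖ < 1) : 1 - (starRingEnd ℂ) a * z ≠ 0 := by
  intro h
  have : ‖(starRingEnd ℂ) a * z‖ < 1 := by
    rw [norm_mul, RCLike.norm_conj]
    nlinarith [norm_nonneg a, norm_nonneg z]
  rw [sub_eq_zero] at h
  rw [← h] at this
  simp at this

lemma mob_lt {a z : ℂ} (ha : ‖a‖ < 1) (hz : ‖z‖ < 1) : ‖mob a z‖ < 1 := by
  rw [mob, norm_div, div_lt_one (norm_pos_iff.2 (mob_den ha hz))]
  rw [← sq_lt_sq₀ (norm_nonneg _) (norm_nonneg _)]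
  have e1 : ‖a‖ ^ 2 < 1 := by nlinarith [norm_nonneg a]
  have e2 : ‖z‖ ^ 2 < 1 := by nlinarith [norm_nonneg z]
  rw [Complex.sq_norm, Complex.normSq_apply] at e1 e2
  rw [Complex.sq_norm, Complex.sq_norm, Complex.normSq_apply, Complex.normSq_apply]
  simp
  nlinarith [mul_pos (sub_pos.2 e1) (sub_pos.2 e2)]

lemma mob_hasDeriv {a z : ℂ} (ha : ‖a‖ < 1) (hz : ‖z‖ < 1) :
    HasDerivAt (mob a) ((1 - (starRingEnd ℂ) a * a) / (1 - (starRingEnd ℂ) a * z) ^ 2) z := by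
  have h1 : HasDerivAt (fun z => z - a) 1 z := (hasDerivAt_id z).sub_const a
  have h2 : HasDerivAt (fun z => 1 - (starRingEnd ℂ) a * z) (-((starRingEnd ℂ) a * 1)) z :=
    ((hasDerivAt_id z).const_mul _).const_sub 1
  convert! h1.div h2 (mob_den ha hz) using 1
  congr 1; ring

lemma mob_inj {a z w : ℂ} (ha : ‖a‖ < 1) (hz : ‖z‖ < 1) (hw : ‖w‖ < 1) (h : mob a z = mob a w) :
    z = w := by
  rw [mob, mob, div_eq_div_iff (mob_den ha hz) (mob_den ha hw)] at h
  have h2 : (z - w) * (1 - (starRingEnd ℂ) a * a) = 0 := by linear_combination h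
  rcases mul_eq_zero.1 h2 with h3 | h3
  · exact sub_eq_zero.1 h3
  · exact absurd h3 (mob_den ha ha)

lemma mob_self (a : ℂ) : mob a a = 0 := by simp [mob]

/-- The normalised family of univalent maps into the disc. -/
def RFam (U : Set ℂ) (z₀ : ℂ) (f : ℂ → ℂ) : Prop :=
  DifferentiableOn ℂ f U ∧ (∀ z ∈ U, ‖f z‖ < 1) ∧ InjOn f U ∧ (∀ z ∈ U, deriv f z ≠ 0) ∧ f z₀ = 0

lemma rfam_mob {U : Set ℂ} (hUo : IsOpen U) {z₀ : ℂ} {s : ℂ → ℂ} (hz₀ : z₀ ∈ U)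
    (h1 : DifferentiableOn ℂ s U) (h2 : ∀ z ∈ U, ‖s z‖ < 1) (h3 : InjOn s U)
    (h4 : ∀ z ∈ U, deriv s z ≠ 0) : RFam U z₀ (fun z => mob (s z₀) (s z)) ∧
      deriv (fun z => mob (s z₀) (s z)) z₀ =
        deriv s z₀ / (1 - (starRingEnd ℂ) (s z₀) * s z₀) := by
  have hd : ∀ z ∈ U, HasDerivAt (fun z => mob (s z₀) (s z))
      ((1 - (starRingEnd ℂ) (s z₀) * s z₀) / (1 - (starRingEnd ℂ) (s z₀) * s z) ^ 2 * deriv s z) z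
      := fun z hz => (mob_hasDeriv (h2 z₀ hz₀) (h2 z hz)).comp z
        ((h1 z hz).differentiableAt (hUo.mem_nhds hz)).hasDerivAt
  have hne := fun z hz => mob_den (h2 z₀ hz₀) (h2 z hz)
  refine ⟨⟨fun z hz => (hd z hz).differentiableAt.differentiableWithinAt,
    fun z hz => mob_lt (h2 z₀ hz₀) (h2 z hz), fun z hz w hw h =>
      h3 hz hw (mob_inj (h2 z₀ hz₀) (h2 z hz) (h2 w hw) h), fun z hz => ?_, mob_self _⟩, ?_⟩
  · rw [(hd z hz).deriv]
    exact mul_ne_zero (div_ne_zero (hne z₀ hz₀) (pow_ne_zero _ (hne z hz))) (h4 z hz)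
  · rw [(hd z₀ hz₀).deriv]
    field_simp [hne z₀ hz₀]

lemma sq_lift_deriv {U : Set ℂ} (hUo : IsOpen U) {s h : ℂ → ℂ} (hs : DifferentiableOn ℂ s U)
    (hsq : ∀ z ∈ U, s z ^ 2 = h z) {z : ℂ} (hz : z ∈ U) : deriv h z = 2 * s z * deriv s z := by
  have h1 : HasDerivAt (fun z => s z ^ 2) (2 * s z * deriv s z) z := by
    have := ((hs z hz).differentiableAt (hUo.mem_nhds hz)).hasDerivAt.pow 2
    simpa using! this
  have h2 : h =ᶠ[𝓝 z] fun z => s z ^ 2 := by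
    filter_upwards [hUo.mem_nhds hz] with w hw using (hsq w hw).symm
  rw [h2.deriv_eq, h1.deriv]

lemma rfam_nonempty {U : Set ℂ} (hUo : IsOpen U) (hUc : IsSimplyConnected U) (hU : U ≠ univ)
    {z₀ : ℂ} (hz₀ : z₀ ∈ U) : ∃ f, RFam U z₀ f := by
  obtain ⟨a, ha⟩ := (ne_univ_iff_exists_notMem U).1 hU
  obtain ⟨s, hs, hsq⟩ := holo_sqrt hUo hUc (h := fun z => z - a) (by fun_prop)
    (fun z hz h => ha (by rw [sub_eq_zero] at h; rwa [← h]))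
  have hs0 : ∀ z ∈ U, s z ≠ 0 := fun z hz h => by
    have := hsq z hz
    rw [h] at this
    apply ha
    have h3 : z = a := by
      rw [← sub_eq_zero, ← this]; simp
    rwa [← h3]
  have hds : ∀ z ∈ U, deriv s z ≠ 0 := fun z hz h => by
    have := sq_lift_deriv hUo hs hsq hz
    rw [h] at this
    simp at this
  have hinj : ∀ z ∈ U, ∀ w ∈ U, (s z = s w ∨ s z = - s w) → z = w := by
    intro z hz w hw h
    have h2 : s z ^ 2 = s w ^ 2 := by rcases h with h | h <;> rw [h] <;> ring
    rw [hsq z hz, hsq w hw] at h2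
    simpa using h2
  have hopen : s '' U ∈ 𝓝 (s z₀) := by
    have hst := (hs.analyticAt (hUo.mem_nhds hz₀)).hasStrictDerivAt
    rw [← hst.map_nhds_eq (hds z₀ hz₀)]
    exact image_mem_map (hUo.mem_nhds hz₀)
  obtain ⟨ρ, hρ, hρs⟩ := Metric.mem_nhds_iff.1 hopen
  have hlow : ∀ z ∈ U, ρ ≤ ‖s z + s z₀‖ := by
    intro z hz
    by_contra hlt
    push Not at hlt
    have : - s z ∈ ball (s z₀) ρ := by
      rw [mem_ball, dist_eq_norm, ← norm_neg]
      rwa [show -(-s z - s z₀) = s z + s z₀ by ring]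
    obtain ⟨w, hw, hw2⟩ := hρs this
    have := hinj w hw z hz (Or.inr hw2)
    subst this
    exact hs0 w hw (self_eq_neg.1 hw2)
  have hne : ∀ z ∈ U, s z + s z₀ ≠ 0 := fun z hz h => by
    have := hlow z hz
    rw [h] at this; simp at this; linarith
  have hder : ∀ z ∈ U, HasDerivAt (fun z => (ρ / 2 : ℂ) * (s z + s z₀)⁻¹)
      ((ρ / 2 : ℂ) * (-deriv s z / (s z + s z₀) ^ 2)) z := fun z hz =>
    ((((hs z hz).differentiableAt (hUo.mem_nhds hz)).hasDerivAt.add_const _).inv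
      (hne z hz)).const_mul _
  have hρ' : (ρ / 2 : ℂ) ≠ 0 := by
    have : (ρ : ℂ) ≠ 0 := by exact_mod_cast hρ.ne'
    exact div_ne_zero this two_ne_zero
  refine ⟨_, (rfam_mob hUo (s := fun z => (ρ / 2 : ℂ) * (s z + s z₀)⁻¹) hz₀
    (fun z hz => (hder z hz).differentiableAt.differentiableWithinAt) ?_ ?_ ?_).1⟩
  · intro z hz
    have := hlow z hz
    rw [norm_mul, norm_inv, norm_div]
    have h5 : 0 < ‖s z + s z₀‖ := by linarith
    rw [← div_eq_mul_inv, div_lt_one h5]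
    simp [abs_of_pos hρ]
    linarith
  · intro z hz w hw h
    have h2 := mul_left_cancel₀ hρ' h
    have h3 := add_right_cancel (inv_injective h2)
    exact hinj z hz w hw (Or.inl h3)
  · intro z hz
    rw [(hder z hz).deriv]
    exact mul_ne_zero hρ' (div_ne_zero (neg_ne_zero.2 (hds z hz)) (pow_ne_zero _ (hne z hz)))

lemma koebe_step {U : Set ℂ} (hUo : IsOpen U) (hUc : IsSimplyConnected U)
    {z₀ : ℂ} (hz₀ : z₀ ∈ U) {f : ℂ → ℂ} (hf : RFam U z₀ f) {a : ℂ} (ha : ‖a‖ < 1)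
    (haf : ∀ z ∈ U, f z ≠ a) : ∃ F, RFam U z₀ F ∧ ‖deriv f z₀‖ < ‖deriv F z₀‖ := by
  obtain ⟨h1, h2, h3, h4, h5⟩ := hf
  have hd : ∀ z ∈ U, HasDerivAt (fun z => mob a (f z))
      ((1 - (starRingEnd ℂ) a * a) / (1 - (starRingEnd ℂ) a * f z) ^ 2 * deriv f z) z
      := fun z hz => (mob_hasDeriv ha (h2 z hz)).comp z
        ((h1 z hz).differentiableAt (hUo.mem_nhds hz)).hasDerivAt
  have ha0 : a ≠ 0 := fun h => haf z₀ hz₀ (by rw [h5, h])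
  obtain ⟨s, hs, hsq⟩ := holo_sqrt hUo hUc (h := fun z => mob a (f z))
    (fun z hz => (hd z hz).differentiableAt.differentiableWithinAt)
    (fun z hz h => haf z hz (mob_inj ha (h2 z hz) ha (by rw [h, mob_self])))
  have hder := fun z hz => sq_lift_deriv hUo hs hsq (z := z) hz
  have hs1 : ∀ z ∈ U, ‖s z‖ < 1 := by
    intro z hz
    have e1 := mob_lt ha (h2 z hz)
    rw [← hsq z hz, norm_pow] at e1
    nlinarith [norm_nonneg (s z)]
  have hds : ∀ z ∈ U, deriv s z ≠ 0 := by
    intro z hz h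
    have e1 := hder z hz
    rw [h, mul_zero, (hd z hz).deriv] at e1
    exact mul_ne_zero (div_ne_zero (mob_den ha ha) (pow_ne_zero _ (mob_den ha (h2 z hz))))
      (h4 z hz) e1
  obtain ⟨r1, r2⟩ := rfam_mob hUo hz₀ hs hs1 (fun z hz w hw h => h3 hz hw
    (mob_inj ha (h2 z hz) (h2 w hw) (by rw [← hsq z hz, ← hsq w hw, h]))) hds
  refine ⟨_, r1, ?_⟩
  rw [r2]
  have e1 := hder z₀ hz₀
  rw [(hd z₀ hz₀).deriv, h5] at e1
  have e2 : s z₀ ^ 2 = -a := by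
    rw [hsq z₀ hz₀, h5]; simp [mob]
  set b := s z₀ with hb
  set β := ‖b‖ with hβ
  have e3 : β ^ 2 = ‖a‖ := by rw [hβ, ← norm_pow, e2, norm_neg]
  have hβ0 : 0 < β := by
    have : 0 < ‖a‖ := norm_pos_iff.2 ha0
    rw [← e3] at this
    rcases (norm_nonneg b).lt_or_eq with h | h
    · exact h
    · rw [hβ, ← h] at this; simp at this
  have hβ1 : β < 1 := hs1 z₀ hz₀
  have conj_norm : ∀ c : ℂ, ‖c‖ < 1 → ‖1 - (starRingEnd ℂ) c * c‖ = 1 - ‖c‖ ^ 2 := by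
    intro c hc
    rw [Complex.conj_mul']
    have : (1 - (‖c‖ : ℂ) ^ 2) = ((1 - ‖c‖ ^ 2 : ℝ) : ℂ) := by push_cast; ring
    rw [this, Complex.norm_real, Real.norm_eq_abs, abs_of_nonneg]
    nlinarith [norm_nonneg c]
  have e4 := congrArg norm e1
  simp only [mul_zero, sub_zero, one_pow, div_one, norm_mul, conj_norm a ha] at e4
  rw [norm_div, conj_norm b hβ1, lt_div_iff₀ (by nlinarith)]
  simp only [Complex.norm_ofNat] at e4
  rw [← hβ] at e4 ⊢
  rw [← e3] at e4
  have hpos : 0 < ‖deriv f z₀‖ := norm_pos_iff.2 (h4 z₀ hz₀)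
  have hle : (1 - β ^ 2) * (2 * β) < 1 - (β ^ 2) ^ 2 := by
    nlinarith [mul_pos (mul_pos (sub_pos.2 hβ1) (sub_pos.2 hβ1)) (mul_pos (sub_pos.2 hβ1) (by linarith : 0 < 1 + β))]
  have : ‖deriv f z₀‖ * ((1 - β ^ 2) * (2 * β)) < ‖deriv f z₀‖ * (1 - (β ^ 2) ^ 2) :=
    mul_lt_mul_of_pos_left hle hpos
  have h2b : ‖deriv f z₀‖ * (1 - β ^ 2) * (2 * β) < ‖deriv s z₀‖ * (2 * β) := by nlinarith
  exact lt_of_mul_lt_mul_right h2b (by positivity)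

end RC

namespace RC

/-- A pair of mutually inverse biholomorphic maps between the unit disc and `U`. -/
structure Riem (U : Set ℂ) (φ ψ : ℂ → ℂ) : Prop where
  dφ : DifferentiableOn ℂ φ (ball 0 1)
  dψ : DifferentiableOn ℂ ψ U
  mφ : MapsTo φ (ball 0 1) U
  mψ : MapsTo ψ U (ball 0 1)
  l : ∀ z ∈ ball (0 : ℂ) 1, ψ (φ z) = z
  r : ∀ z ∈ U, φ (ψ z) = z

theorem riemann {U : Set ℂ} (hUo : IsOpen U) (hUc : IsSimplyConnected U) (hU : U ≠ univ)
    {z₀ : ℂ} (hz₀ : z₀ ∈ U) : ∃ φ ψ : ℂ → ℂ, Riem U φ ψ ∧ ψ z₀ = 0 := by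
  obtain ⟨R, hR, hRU⟩ := Metric.isOpen_iff.1 hUo z₀ hz₀
  set S : Set ℝ := {x | ∃ f, RFam U z₀ f ∧ x = ‖deriv f z₀‖} with hS
  have hSb : BddAbove S := by
    refine ⟨1 / R, ?_⟩
    rintro _ ⟨f, hf, rfl⟩
    refine Complex.norm_deriv_le_div_of_mapsTo_ball (hf.1.mono hRU) (fun z hz => ?_) hR
    rw [hf.2.2.2.2, mem_closedBall, dist_zero_right]
    exact (hf.2.1 z (hRU hz)).le
  obtain ⟨f₀, hf₀⟩ := rfam_nonempty hUo hUc hU hz₀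
  have hSn : S.Nonempty := ⟨_, f₀, hf₀, rfl⟩
  obtain ⟨u, -, hu, huS⟩ := exists_seq_tendsto_sSup hSn hSb
  choose f hf hfu using huS
  have hpos : 0 < sSup S := lt_of_lt_of_le (norm_pos_iff.2 (hf₀.2.2.2.1 z₀ hz₀))
    (le_csSup hSb ⟨f₀, hf₀, rfl⟩)
  let F : Ultrafilter ℕ := hyperfilter ℕ
  have hF : (F : Filter ℕ) ≤ atTop := by
    rw [← Nat.cofinite_eq_atTop]; exact hyperfilter_le_cofinite
  obtain ⟨k, hlim, hk, hkb, hpt⟩ := montel F hUo f (fun i => (hf i).1)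
    (fun i z hz => ((hf i).2.1 z hz).le)
  have hdlim := hlim.deriv (Eventually.of_forall fun i => (hf i).1) hUo
  have hd1 : ‖deriv k z₀‖ = sSup S := by
    have h1 : Tendsto (fun i => ‖deriv (f i) z₀‖) F (𝓝 ‖deriv k z₀‖) :=
      (hdlim.tendsto_at hz₀).norm
    have h2 : Tendsto (fun i => ‖deriv (f i) z₀‖) F (𝓝 (sSup S)) := by
      simp_rw [← hfu]; exact hu.mono_left hF
    exact tendsto_nhds_unique h1 h2
  have hpre : IsPreconnected U := hUc.isPathConnected.isConnected.isPreconnected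
  have hkan : AnalyticOnNhd ℂ k U := fun z hz => hk.analyticAt (hUo.mem_nhds hz)
  have hnc : ∀ z ∈ U, ¬ ∀ᶠ w in 𝓝 z, k w = k z := by
    intro z hz hcon
    have h1 := hkan.eqOn_of_preconnected_of_eventuallyEq (g := fun _ => k z)
      (fun _ _ => analyticAt_const) hpre hz hcon
    have h2 : k =ᶠ[𝓝 z₀] fun _ => k z := by
      filter_upwards [hUo.mem_nhds hz₀] with w hw using h1 hw
    rw [h2.deriv_eq] at hd1
    simp at hd1
    linarith
  have hinj : InjOn k U := by
    intro a ha b hb hab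
    by_contra hne
    obtain ⟨A, B, hA, hB, hAB⟩ := t2_separation_nhds hne
    have e1 := hurwitz hUo (fun i => (hf i).1) hlim ha (hnc a ha) (inter_mem hA (hUo.mem_nhds ha))
    have e2 := hurwitz hUo (fun i => (hf i).1) hlim hb (hnc b hb) (inter_mem hB (hUo.mem_nhds hb))
    obtain ⟨i, ⟨x, hx, hx2⟩, ⟨y, hy, hy2⟩⟩ := (e1.and e2).exists
    have := (hf i).2.2.1 hx.2 hy.2 (by rw [hx2, hy2, hab])
    subst this
    exact disjoint_left.1 hAB hx.1 hy.1
  have hdk : ∀ z ∈ U, deriv k z ≠ 0 := by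
    intro z hz h0
    have e0 : ¬ ∀ᶠ w in 𝓝 z, deriv k w = deriv k z := by
      intro hcon
      rw [h0] at hcon
      obtain ⟨ρ, hρ, hρs⟩ := Metric.mem_nhds_iff.1 (inter_mem hcon (hUo.mem_nhds hz))
      apply hnc z hz
      filter_upwards [ball_mem_nhds z hρ] with w hw
      exact isOpen_ball.is_const_of_deriv_eq_zero (convex_ball z ρ).isPreconnected
        (hk.mono fun w hw => (hρs hw).2) (fun w hw => (hρs hw).1) hw (mem_ball_self hρ)
    obtain ⟨i, x, hx, hx2⟩ := (hurwitz hUo (fun i => (hf i).1.deriv hUo) hdlim hz e0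
      (hUo.mem_nhds hz)).exists
    exact (hf i).2.2.2.1 x hx (by rw [h0] at hx2; exact hx2)
  have hlt : ∀ z ∈ U, ‖k z‖ < 1 := by
    intro z hz
    refine (hkb z hz).lt_of_ne fun h1 => ?_
    have hst := (hkan z hz).hasStrictDerivAt
    have h2 : k '' U ∈ 𝓝 (k z) := by
      rw [← hst.map_nhds_eq (hdk z hz)]
      exact image_mem_map (hUo.mem_nhds hz)
    have h3 : Tendsto (fun t : ℝ => (t : ℂ) * k z) (𝓝 1) (𝓝 (k z)) := by
      have : Continuous fun t : ℝ => (t : ℂ) * k z := by fun_prop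
      simpa using this.tendsto 1
    have h4 := (h3.eventually h2).filter_mono (nhdsWithin_le_nhds (s := Ioi 1))
    obtain ⟨t, ⟨w, hw, hw2⟩, ht⟩ := (h4.and self_mem_nhdsWithin).exists
    have h5 := hkb w hw
    rw [hw2, norm_mul, h1, Complex.norm_real, mul_one] at h5
    have ht : 1 < t := ht
    rw [Real.norm_eq_abs, abs_of_pos (by linarith)] at h5
    linarith
  have hk0 : k z₀ = 0 := by
    have := hpt z₀ hz₀
    simp_rw [fun i => (hf i).2.2.2.2] at this
    exact tendsto_nhds_unique this tendsto_const_nhds |>.symm ▸ rfl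
  have hkF : RFam U z₀ k := ⟨hk, hlt, hinj, hdk, hk0⟩
  have hsurj : ∀ w ∈ ball (0 : ℂ) 1, ∃ z ∈ U, k z = w := by
    intro w hw
    by_contra hcon
    push Not at hcon
    obtain ⟨G, hG, hG2⟩ := koebe_step hUo hUc hz₀ hkF (by simpa using hw) hcon
    have := le_csSup hSb ⟨G, hG, rfl⟩
    linarith
  have hmaps : MapsTo k U (ball 0 1) := fun z hz => by simpa using hlt z hz
  have hinvmem : ∀ w ∈ ball (0 : ℂ) 1, invFunOn k U w ∈ U := fun w hw => invFunOn_mem (hsurj w hw)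
  have hinveq : ∀ w ∈ ball (0 : ℂ) 1, k (invFunOn k U w) = w := fun w hw => invFunOn_eq (hsurj w hw)
  have hleft : ∀ z ∈ U, invFunOn k U (k z) = z := fun z hz =>
    hinj (hinvmem _ (hmaps hz)) hz (hinveq _ (hmaps hz))
  refine ⟨invFunOn k U, k, ⟨fun w hw => ?_, hk, hinvmem, hmaps, hinveq, hleft⟩, hk0⟩
  obtain ⟨z, hz, rfl⟩ := hsurj w hw
  have hst := (hkan z hz).hasStrictDerivAt
  exact (hst.to_local_left_inverse (hdk z hz) (by
    filter_upwards [hUo.mem_nhds hz] with w hw using hleft w hw)).hasDerivAt.differentiableAt.differentiableWithinAt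

end RC

namespace RC

lemma simplyConn_univ : IsSimplyConnected (univ : Set ℂ) := by
  have : ContractibleSpace (univ : Set ℂ) :=
    Convex.contractibleSpace convex_univ univ_nonempty
  exact SimplyConnectedSpace.ofContractible _

lemma log_univ {F : ℂ → ℂ} (hF : Continuous F) (h0 : ∀ z, F z ≠ 0) :
    ∃ l : ℂ → ℂ, Continuous l ∧ ∀ z, Complex.exp (l z) = F z := by
  obtain ⟨l, hl, hl2⟩ := Complex.exists_continuousOn_eqOn_exp_comp simplyConn_univ isOpen_univ
    hF.continuousOn (by rintro ⟨z, -, hz0⟩; exact h0 z hz0)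
  exact ⟨l, continuousOn_univ.1 hl, fun z => hl2 (mem_univ z)⟩

lemma exp_const {X : Type*} [TopologicalSpace X] {s : Set X} (hs : IsPreconnected s) {q : X → ℂ}
    (hq : ContinuousOn q s) {c : ℂ} (h : ∀ x ∈ s, Complex.exp (q x) = c) {x y : X} (hx : x ∈ s)
    (hy : y ∈ s) : q x = q y := by
  have hdisc : DiscreteTopology (AddSubgroup.zmultiples (2 * Real.pi * Complex.I) : Set ℂ) :=
    NormedSpace.discreteTopology_zmultiples _
  have hm : ∀ w ∈ s, q w - q y ∈ (AddSubgroup.zmultiples (2 * Real.pi * Complex.I) : Set ℂ) := by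
    intro w hw
    have h1 : Complex.exp (q w - q y) = 1 := by
      rw [Complex.exp_sub, h w hw, h y hy, div_self]
      rw [← h y hy]; exact Complex.exp_ne_zero _
    obtain ⟨n, hn⟩ := Complex.exp_eq_one_iff.1 h1
    exact ⟨n, by simp [hn]⟩
  have := hs.constant_of_mapsTo (T := (AddSubgroup.zmultiples (2 * Real.pi * Complex.I) : Set ℂ))
    (f := fun w => q w - q y) ⟨hdisc⟩ (hq.sub continuousOn_const) hm hx hy
  simpa [sub_eq_zero] using this

/-- There is no continuous logarithm of `z - a` on a circle around `a`. -/
lemma no_log {a : ℂ} {R : ℝ} (hR : 0 < R) {l : ℂ → ℂ} (hl : Continuous l)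
    (h : ∀ z ∈ sphere a R, Complex.exp (l z) = z - a) : False := by
  have h1 : Continuous fun t : ℝ => l (circleMap a R t) - t * Complex.I :=
    (hl.comp (continuous_circleMap a R)).sub (by fun_prop)
  have h2 : ∀ t ∈ (univ : Set ℝ), Complex.exp (l (circleMap a R t) - t * Complex.I) = R := by
    intro t _
    rw [Complex.exp_sub, h _ (circleMap_mem_sphere a hR.le t), circleMap]
    simp
  have h3 := exp_const isPreconnected_univ h1.continuousOn h2 (mem_univ (2 * Real.pi)) (mem_univ 0)
  have h4 : circleMap a R (2 * Real.pi) = circleMap a R 0 := by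
    simp [circleMap]
  rw [h4] at h3
  simp at h3

lemma holefree {U N : Set ℂ} (hUo : IsOpen U) (hUc : IsSimplyConnected U) (hN : IsOpen N)
    (hNb : Bornology.IsBounded N) (hfr : frontier N ⊆ U) : N ⊆ U := by
  intro a ha
  by_contra haU
  obtain ⟨θ, hθ, hθ2⟩ := Complex.exists_continuousOn_eqOn_exp_comp (g := fun z => z - a) hUc hUo
    (by fun_prop) (by rintro ⟨z, hz, hz0⟩; rw [sub_eq_zero] at hz0; exact haU (hz0 ▸ hz))
  obtain ⟨θ', hθ'⟩ := ContinuousMap.exists_restrict_eq (Y := ℂ) (s := frontier N) isClosed_frontier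
    ⟨_, continuousOn_iff_continuous_domRestrict.1 (hθ.mono hfr)⟩
  have hθ3 : ∀ z ∈ frontier N, θ' z = θ z := fun z hz => by
    have := DFunLike.congr_fun hθ' ⟨z, hz⟩
    simpa using this
  classical
  obtain ⟨l, hl, hl2⟩ := log_univ (F := fun z => if z ∈ N then Complex.exp (θ' z) else z - a)
    (by
      refine Continuous.if (fun z hz => ?_) (by fun_prop) (by fun_prop)
      have hz : z ∈ frontier N := hz
      rw [hθ3 z hz]; exact hθ2 (hfr hz))
    (by
      intro z
      by_cases hz : z ∈ N
      · simp [hz, Complex.exp_ne_zero]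
      · simp only [hz, if_false]
        exact sub_ne_zero.2 (fun h => hz (h ▸ ha)))
  obtain ⟨R, hR⟩ := hNb.subset_ball a
  have hR0 : 0 < R := nonempty_ball.1 ⟨a, hR ha⟩
  refine no_log (a := a) hR0 hl fun z hz => ?_
  rw [hl2, if_neg]
  intro h
  have := hR h
  rw [mem_ball] at this; rw [mem_sphere] at hz; linarith

lemma unicoherent {A B : Set ℂ} (hA : IsClosed A) (hB : IsClosed B) (hAc : IsPreconnected A)
    (hBc : IsPreconnected B) (hAB : A ∪ B = univ) : IsPreconnected (A ∩ B) := by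
  rw [isPreconnected_closed_iff]
  rintro t t' ht ht' hsub ⟨x, hx⟩ ⟨y, hy⟩
  by_contra hem
  rw [not_nonempty_iff_eq_empty] at hem
  have hd : Disjoint (A ∩ B ∩ t) (A ∩ B ∩ t') := by
    rw [disjoint_iff_inter_eq_empty, ← hem]; ext z; simp; tauto
  obtain ⟨u, hu0, hu1, -⟩ := exists_continuous_zero_one_of_isClosed ((hA.inter hB).inter ht)
    ((hA.inter hB).inter ht') hd
  classical
  have hend : Complex.exp (Real.pi * Complex.I) = Complex.exp (-(Real.pi * Complex.I)) := by
    rw [Complex.exp_neg, Complex.exp_pi_mul_I]; norm_num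
  set F : ℂ → ℂ := fun z => if z ∈ A then Complex.exp (Real.pi * Complex.I * u z) else
    Complex.exp (-(Real.pi * Complex.I * u z)) with hF
  have hFB : ∀ z ∈ B, F z = Complex.exp (-(Real.pi * Complex.I * u z)) := by
    intro z hz
    by_cases hzA : z ∈ A
    · simp only [hF, hzA, if_true]
      rcases hsub ⟨hzA, hz⟩ with h | h
      · rw [hu0 ⟨⟨hzA, hz⟩, h⟩]; simp
      · rw [hu1 ⟨⟨hzA, hz⟩, h⟩]; simpa using hend
    · simp only [hF, hzA, if_false]
  have hFA : ∀ z ∈ A, F z = Complex.exp (Real.pi * Complex.I * u z) := by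
    intro z hz; simp only [hF, hz, if_true]
  have hFc : Continuous F := by
    rw [← continuousOn_univ, ← hAB]
    refine ContinuousOn.union_of_isClosed ?_ ?_ hA hB
    · exact ContinuousOn.congr (by fun_prop) hFA
    · exact ContinuousOn.congr (by fun_prop) hFB
  obtain ⟨l, hl, hl2⟩ := log_univ hFc (by
    intro z
    simp only [hF]; split_ifs <;> exact Complex.exp_ne_zero _)
  have e1 := exp_const hAc (q := fun z => l z - Real.pi * Complex.I * u z) (c := 1)
    (by fun_prop) (fun z hz => by
      rw [Complex.exp_sub, hl2, hFA z hz, div_self (Complex.exp_ne_zero _)]) hx.1.1 hy.1.1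
  have e2 := exp_const hBc (q := fun z => l z + Real.pi * Complex.I * u z) (c := 1)
    (by fun_prop) (fun z hz => by
      rw [Complex.exp_add, hl2, hFB z hz, ← Complex.exp_add]; simp) hx.1.2 hy.1.2
  rw [hu0 hx, hu1 hy] at e1 e2
  simp at e1 e2
  have e3 : (Real.pi : ℂ) * Complex.I = 0 := by linear_combination (e1 - e2) / 2
  simp at e3

lemma norm_preconn {I : Set ℝ} (hI : IsPreconnected I) (hpos : ∀ r ∈ I, 0 < r) :
    IsPreconnected {z : ℂ | ‖z‖ ∈ I} := by
  have : {z : ℂ | ‖z‖ ∈ I} = (fun p : ℝ × ℝ => (p.1 : ℂ) * Complex.exp (p.2 * Complex.I)) ''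
      (I ×ˢ univ) := by
    ext z
    constructor
    · intro hz
      exact ⟨(‖z‖, Complex.arg z), ⟨hz, mem_univ _⟩, by simp⟩
    · rintro ⟨⟨r, t⟩, ⟨hr, -⟩, rfl⟩
      simp only [mem_ofPred_eq, norm_mul, Complex.norm_exp_ofReal_mul_I, mul_one,
        Complex.norm_real, Real.norm_eq_abs, abs_of_pos (hpos r hr)]
      exact hr
  rw [this]
  exact (hI.prod isPreconnected_univ).image _ (by fun_prop)

lemma preconn_subset_of_frontier {Γ N : Set ℂ} (hΓ : IsPreconnected Γ)
    (hfr : Disjoint Γ (frontier N)) (hmeet : (Γ ∩ N).Nonempty) : Γ ⊆ N := by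
  by_contra h
  rw [not_subset] at h
  obtain ⟨x, hx, hx2⟩ := h
  have hcov : ∀ z ∈ Γ, z ∈ interior N ∨ z ∈ (closure N)ᶜ := by
    intro z hz
    by_contra hc
    push Not at hc
    exact disjoint_left.1 hfr hz ⟨by simpa using hc.2, hc.1⟩
  obtain ⟨y, hy, hy2⟩ := hmeet
  obtain ⟨z, -, hz1, hz2⟩ := hΓ (interior N) (closure N)ᶜ isOpen_interior isClosed_closure.isOpen_compl
    hcov ⟨y, hy, (hcov y hy).resolve_right (fun h => h (subset_closure hy2))⟩
    ⟨x, hx, (hcov x hx).resolve_left (fun h => hx2 (interior_subset h))⟩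
  exact hz2 (subset_closure (interior_subset hz1))

/-- The hull of a compact set: add all bounded complementary pieces. -/
def hull (K : Set ℂ) : Set ℂ :=
  K ∪ {z | ∃ N, IsOpen N ∧ Bornology.IsBounded N ∧ z ∈ N ∧ frontier N ⊆ K}

lemma subset_hull (K : Set ℂ) : K ⊆ hull K := subset_union_left

lemma hull_subset_ball {K : Set ℂ} {R : ℝ} (hR : 0 ≤ R) (hK : K ⊆ closedBall 0 R) :
    hull K ⊆ closedBall 0 R := by
  rintro z (hz | ⟨N, hN, hNb, hzN, hfr⟩)
  · exact hK hz
  · by_contra hz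
    have hpre : IsPreconnected {z : ℂ | ‖z‖ ∈ Ioi R} :=
      norm_preconn isPreconnected_Ioi (fun r hr => hR.trans_lt hr)
    have hsub := preconn_subset_of_frontier (N := N) hpre (by
      rw [disjoint_left]
      intro x hx hx2
      have := hK (hfr hx2)
      simp at this hx; linarith) ⟨z, by simpa using hz, hzN⟩
    obtain ⟨M, hM⟩ := hNb.exists_norm_le
    have h0 : ((max R M + 1 : ℝ) : ℂ) ∈ {z : ℂ | ‖z‖ ∈ Ioi R} := by
      simp only [mem_ofPred_eq, Complex.norm_real, Real.norm_eq_abs, mem_Ioi]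
      exact lt_of_lt_of_le (by linarith [le_max_left R M]) (le_abs_self _)
    have := hM _ (hsub h0)
    rw [Complex.norm_real, Real.norm_eq_abs] at this
    linarith [le_max_right R M, le_abs_self (max R M + 1)]

lemma hull_compl_comp {K : Set ℂ} (hK : IsClosed K) {z : ℂ} (hz : z ∉ hull K) :
    connectedComponentIn Kᶜ z ⊆ (hull K)ᶜ ∧ ¬ Bornology.IsBounded (connectedComponentIn Kᶜ z) := by
  have hzK : z ∈ Kᶜ := fun h => hz (subset_hull K h)
  have hub : ¬ Bornology.IsBounded (connectedComponentIn Kᶜ z) := by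
    intro hb
    refine hz (Or.inr ⟨_, hK.isOpen_compl.connectedComponentIn, hb, mem_connectedComponentIn hzK,
      fun x hx => ?_⟩)
    by_contra hxK
    have ho := hK.isOpen_compl.connectedComponentIn (x := z)
    have ho' := hK.isOpen_compl.connectedComponentIn (x := x)
    rw [frontier, ho.interior_eq] at hx
    obtain ⟨y, hy1, hy2⟩ := mem_closure_iff.1 hx.1 _ ho' (mem_connectedComponentIn hxK)
    have e1 := connectedComponentIn_eq hy1
    have e2 := connectedComponentIn_eq hy2
    exact hx.2 (by rw [e2, ← e1]; exact mem_connectedComponentIn hxK)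
  refine ⟨fun y hy hyh => ?_, hub⟩
  rcases hyh with h | ⟨N, hN, hNb, hyN, hfr⟩
  · exact connectedComponentIn_subset _ _ hy h
  · refine hub (hNb.subset (preconn_subset_of_frontier isPreconnected_connectedComponentIn ?_
      ⟨y, hy, hyN⟩))
    exact disjoint_left.2 fun x hx hx2 => connectedComponentIn_subset _ _ hx (hfr hx2)

lemma hull_isClosed {K : Set ℂ} (hK : IsClosed K) : IsClosed (hull K) := by
  rw [← isOpen_compl_iff, isOpen_iff_mem_nhds]
  intro z hz
  have hzK : z ∈ Kᶜ := fun h => hz (subset_hull K h)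
  exact mem_of_superset (hK.isOpen_compl.connectedComponentIn.mem_nhds
    (mem_connectedComponentIn hzK)) (hull_compl_comp hK hz).1

lemma exists_ball_of_compact {K : Set ℂ} (hK : IsCompact K) : ∃ R > 0, K ⊆ closedBall 0 R := by
  obtain ⟨R, hR⟩ := hK.isBounded.subset_closedBall 0
  exact ⟨max R 1, by positivity, hR.trans (closedBall_subset_closedBall (le_max_left _ _))⟩

lemma hull_isCompact {K : Set ℂ} (hK : IsCompact K) : IsCompact (hull K) := by
  obtain ⟨R, hR0, hR⟩ := exists_ball_of_compact hK
  exact (isCompact_closedBall 0 R).of_isClosed_subset (hull_isClosed hK.isClosed)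
    (hull_subset_ball hR0.le hR)

lemma hull_compl_connected {K : Set ℂ} (hK : IsCompact K) : IsConnected (hull K)ᶜ := by
  obtain ⟨R, hR0, hR⟩ := exists_ball_of_compact hK
  have hE : IsPreconnected {z : ℂ | ‖z‖ ∈ Ioi R} :=
      norm_preconn isPreconnected_Ioi (fun r hr => hR0.trans hr)
  have hEsub : {z : ℂ | ‖z‖ ∈ Ioi R} ⊆ (hull K)ᶜ := by
    intro z hz hzh
    have := hull_subset_ball hR0.le hR hzh
    simp at this hz; linarith
  have h0 : ((R + 1 : ℝ) : ℂ) ∈ {z : ℂ | ‖z‖ ∈ Ioi R} := by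
    simp only [mem_ofPred_eq, Complex.norm_real, Real.norm_eq_abs, mem_Ioi]
    exact lt_of_lt_of_le (by linarith) (le_abs_self _)
  refine ⟨⟨_, hEsub h0⟩, ?_⟩
  refine isPreconnected_of_forall ((R + 1 : ℝ) : ℂ) fun y hy => ?_
  have hyK : y ∈ Kᶜ := fun h => hy (subset_hull K h)
  obtain ⟨h1, h2⟩ := hull_compl_comp hK.isClosed hy
  have hmeet : ∃ x, x ∈ connectedComponentIn Kᶜ y ∧ x ∈ {z : ℂ | ‖z‖ ∈ Ioi R} := by
    by_contra hcon
    push Not at hcon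
    refine h2 ((isBounded_closedBall (x := (0 : ℂ)) (r := R)).subset fun x hx => ?_)
    have := hcon x hx
    simpa using this
  obtain ⟨x, hx1, hx2⟩ := hmeet
  exact ⟨_, union_subset h1 hEsub, Or.inr h0, Or.inl (mem_connectedComponentIn hyK),
    isPreconnected_connectedComponentIn.union x hx1 hx2 hE⟩

lemma hull_subset {U K : Set ℂ} (hUo : IsOpen U) (hUc : IsSimplyConnected U) (hK : K ⊆ U) :
    hull K ⊆ U := by
  rintro z (hz | ⟨N, hN, hNb, hzN, hfr⟩)
  · exact hK hz
  · exact holefree hUo hUc hN hNb (hfr.trans hK) hzN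

end RC

namespace RC

lemma deriv_locInj {f : ℂ → ℂ} {X : Set ℂ} (hX : IsOpen X) (hf : DifferentiableOn ℂ f X) {x : ℂ}
    (hx : x ∈ X) (hd : deriv f x ≠ 0) :
    ∃ e : OpenPartialHomeomorph ℂ ℂ, x ∈ e.source ∧ ⇑e = f := by
  have hs := (hf.analyticAt (hX.mem_nhds hx)).hasStrictDerivAt
  exact ⟨_, HasStrictFDerivAt.mem_toOpenPartialHomeomorph_source
    (hs.hasStrictFDerivAt_equiv hd), rfl⟩

lemma lift_unique {α : Type*} [TopologicalSpace α] {D : Set α} (hD : IsPreconnected D)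
    {f : ℂ → ℂ} {X : Set ℂ} (hX : IsOpen X) (hf : DifferentiableOn ℂ f X) {q₁ q₂ : α → ℂ}
    (h₁ : ContinuousOn q₁ D) (h₂ : ContinuousOn q₂ D) (hm : MapsTo q₁ D X)
    (hd : ∀ z ∈ D, deriv f (q₁ z) ≠ 0) (he : ∀ z ∈ D, f (q₁ z) = f (q₂ z)) {c : α} (hc : c ∈ D)
    (hcc : q₁ c = q₂ c) : EqOn q₁ q₂ D := by
  have : PreconnectedSpace D := isPreconnected_iff_preconnectedSpace.1 hD
  rw [continuousOn_iff_continuous_domRestrict] at h₁ h₂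
  have hcl : IsClopen {z : D | q₁ z = q₂ z} := by
    refine ⟨isClosed_eq h₁ h₂, isOpen_iff_mem_nhds.2 fun z hz => ?_⟩
    obtain ⟨e, hes, hef⟩ := deriv_locInj hX hf (hm z.2) (hd z z.2)
    have t1 : ∀ᶠ w : D in 𝓝 z, q₁ w ∈ e.source :=
      h₁.continuousAt.eventually (e.open_source.mem_nhds hes)
    have hes' : q₂ z ∈ e.source := by
      have hz' : q₁ z = q₂ z := hz
      rwa [← hz']
    have t2 : ∀ᶠ w : D in 𝓝 z, q₂ w ∈ e.source :=
      h₂.continuousAt.eventually (e.open_source.mem_nhds hes')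
    filter_upwards [t1, t2] with w hw1 hw2
    exact e.injOn hw1 hw2 (by rw [hef]; exact he w w.2)
  have huniv := hcl.eq_univ ⟨⟨c, hc⟩, hcc⟩
  intro z hz
  have : (⟨z, hz⟩ : D) ∈ {z : D | q₁ z = q₂ z} := huniv ▸ mem_univ _
  exact this

lemma lift_exists {f : ℂ → ℂ} {X Y S : Set ℂ} (hX : IsOpen X) (hY : IsOpen Y)
    (hf : DifferentiableOn ℂ f X) (hm : MapsTo f X Y) (hp : ProperOn f X Y) (hS : S ⊆ Y)
    (hd : ∀ x ∈ X, f x ∈ S → deriv f x ≠ 0) {D : Set ℂ} (hDo : IsOpen D) (hDc : Convex ℝ D)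
    {k : ℂ → ℂ} (hk : ContinuousOn k D) (hkS : MapsTo k D S) {c : ℂ} (hc : c ∈ D) {x : ℂ}
    (hx : x ∈ X) (hfx : f x = k c) :
    ∃ q : ℂ → ℂ, ContinuousOn q D ∧ q c = x ∧ ∀ z ∈ D, q z ∈ X ∧ f (q z) = k z := by
  set f' : X → Y := hm.restrict f X Y with hf'
  have hf'c : Continuous f' := hf.continuousOn.mapsToRestrict hm
  have hprop : IsProperMap f' := by
    have : LocallyCompactSpace Y := hY.locallyCompactSpace
    rw [isProperMap_iff_isCompact_preimage]
    refine ⟨hf'c, fun K hK => ?_⟩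
    rw [Subtype.isCompact_iff]
    have h1 := hp (Subtype.val '' K) (by simp) (hK.image continuous_subtype_val)
    convert h1 using 1
    ext z
    constructor
    · rintro ⟨⟨y, hy⟩, h, rfl⟩
      exact ⟨hy, f' ⟨y, hy⟩, h, rfl⟩
    · rintro ⟨hz, w, hw, hwz⟩
      refine ⟨⟨z, hz⟩, ?_, rfl⟩
      have : f' ⟨z, hz⟩ = w := Subtype.ext hwz.symm
      rw [mem_preimage, this]; exact hw
  have hloc : IsLocalHomeomorphOn f' (f' ⁻¹' (Subtype.val ⁻¹' S)) := by
    have h1 : IsLocalHomeomorphOn f {x | x ∈ X ∧ f x ∈ S} := by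
      intro x hx
      obtain ⟨e, he, hef⟩ := deriv_locInj hX hf hx.1 (hd x hx.1 hx.2)
      exact ⟨e, he, hef.symm⟩
    have h2 : IsLocalHomeomorphOn (f ∘ (Subtype.val : X → ℂ)) (f' ⁻¹' (Subtype.val ⁻¹' S)) := by
      refine IsLocalHomeomorphOn.comp (t := {x | x ∈ X ∧ f x ∈ S}) h1
        (hX.isOpenEmbedding_subtypeVal.isLocalHomeomorph.isLocalHomeomorphOn) ?_
      intro x hx
      exact ⟨x.2, hx⟩
    have h3 : f ∘ (Subtype.val : X → ℂ) = (Subtype.val : Y → ℂ) ∘ f' := rfl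
    rw [h3] at h2
    refine IsLocalHomeomorphOn.of_comp_left h2
        (hY.isOpenEmbedding_subtypeVal.isLocalHomeomorph.isLocalHomeomorphOn)
        (fun z _ => hf'c.continuousAt)
  have hcov : IsCoveringMapOn f' (Subtype.val ⁻¹' S) := by
    refine hprop.isClosedMap.isCoveringMapOn_of_isLocalHomeomorphOn (fun y hy => ?_) hloc
    have hcomp : IsCompact (f' ⁻¹' {y}) := hprop.isCompact_preimage isCompact_singleton
    refine hcomp.finite (.of_openPartialHomeomorph f' subset_rfl fun e he => ?_)
    obtain ⟨φ, h1, h2⟩ := hloc e (by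
      have : f' e = y := he
      rw [mem_preimage, this]; exact hy)
    exact ⟨φ, h1, h2.symm⟩
  have : SimplyConnectedSpace D := by
    have : ContractibleSpace D := Convex.contractibleSpace hDc ⟨c, hc⟩
    exact SimplyConnectedSpace.ofContractible _
  have : LocallyPathConnectedSpace D := hDo.locallyPathConnectedSpace
  have hkY : MapsTo k D Y := hkS.mono_right hS
  obtain ⟨F, ⟨hF1, hF2⟩, -⟩ := hcov.existsUnique_continuousMap_lifts
    (A := D) ⟨hkY.restrict k D Y, hk.mapsToRestrict hkY⟩ (a₀ := ⟨c, hc⟩) (e₀ := ⟨x, hx⟩)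
    (Subtype.ext hfx) (fun a => hkS a.2)
  classical
  refine ⟨fun z => if h : z ∈ D then (F ⟨z, h⟩ : ℂ) else 0, ?_, ?_, ?_⟩
  · rw [continuousOn_iff_continuous_domRestrict]
    have : D.domRestrict (fun z => if h : z ∈ D then (F ⟨z, h⟩ : ℂ) else 0) =
        fun z => (F z : ℂ) := by
      ext z; simp [Set.domRestrict]
    rw [this]
    exact continuous_subtype_val.comp F.continuous
  · simp [hc, hF1]
  · intro z hz
    simp only [hz, dite_true]
    refine ⟨(F ⟨z, hz⟩).2, ?_⟩
    have := congr_fun hF2 ⟨z, hz⟩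
    exact congrArg Subtype.val this

lemma lift_holo {f : ℂ → ℂ} {X D : Set ℂ} (hX : IsOpen X) (hf : DifferentiableOn ℂ f X)
    (hD : IsOpen D) {k q : ℂ → ℂ} (hk : DifferentiableOn ℂ k D) (hq : ContinuousOn q D)
    (h : ∀ z ∈ D, q z ∈ X ∧ f (q z) = k z) (hd : ∀ z ∈ D, deriv f (q z) ≠ 0) :
    DifferentiableOn ℂ q D := by
  intro z hz
  refine (lift_diff (hq.continuousAt (hD.mem_nhds hz))
    (hf.analyticAt (hX.mem_nhds (h z hz).1)) (hd z hz)
    (hk.differentiableAt (hD.mem_nhds hz)) ?_).differentiableWithinAt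
  filter_upwards [hD.mem_nhds hz] with w hw using (h w hw).2

end RC

namespace RC

/-- Points of the unit disc whose first `n` iterates stay in `U`. -/
def Un (g : ℂ → ℂ) (U : Set ℂ) (n : ℕ) : Set ℂ := {x | x ∈ ball (0 : ℂ) 1 ∧ ∀ i < n, g^[i] x ∈ U}

/-- The fibre of `g^n` over `w`. -/
def Fib (g : ℂ → ℂ) (U : Set ℂ) (n : ℕ) (w : ℂ) : Set ℂ := {x | x ∈ Un g U n ∧ g^[n] x = w}

/-- `k` is a holomorphic branch of `g^{-n}` on `D`. -/
def Br (g : ℂ → ℂ) (U : Set ℂ) (n : ℕ) (D : Set ℂ) (k : ℂ → ℂ) : Prop :=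
  DifferentiableOn ℂ k D ∧ ∀ z ∈ D, k z ∈ Un g U n ∧ g^[n] (k z) = z

structure Mdl (g : ℂ → ℂ) (U P : Set ℂ) (φ ψ : ℂ → ℂ) : Prop where
  o : IsOpen U
  sub : U ⊆ ball 0 1
  a : ∃ a ∈ ball (0 : ℂ) 1, a ∉ U
  rm : Riem U φ ψ
  φ0 : φ 0 = 0
  holo : DifferentiableOn ℂ g U
  maps : MapsTo g U (ball 0 1)
  prop : ProperOn g U (ball 0 1)
  Pc : IsCompact P
  PU : P ⊆ U
  Pne : P.Nonempty
  crit : critPts g U ⊆ P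
  inv : ∀ x ∈ P, g x ∈ P
  Wc : IsPreconnected (ball 0 1 \ P)

section iter
variable {g : ℂ → ℂ} {U P : Set ℂ} {φ ψ : ℂ → ℂ}

lemma Un_zero : Un g U 0 = ball 0 1 := by ext; simp [Un]

lemma Un_sub_ball {n : ℕ} : Un g U n ⊆ ball 0 1 := fun _ h => h.1

lemma Un_mono {m n : ℕ} (h : m ≤ n) : Un g U n ⊆ Un g U m :=
  fun _ hx => ⟨hx.1, fun i hi => hx.2 i (hi.trans_le h)⟩

lemma Un_succ_last {n : ℕ} {x : ℂ} : x ∈ Un g U (n + 1) ↔ x ∈ Un g U n ∧ g^[n] x ∈ U := by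
  constructor
  · intro h
    exact ⟨Un_mono (Nat.le_succ n) h, h.2 n (Nat.lt_succ_self n)⟩
  · rintro ⟨h, h2⟩
    refine ⟨h.1, fun i hi => ?_⟩
    rcases Nat.lt_succ_iff_lt_or_eq.1 hi with h3 | rfl
    · exact h.2 i h3
    · exact h2

lemma Br.mono {n : ℕ} {D D' : Set ℂ} {k : ℂ → ℂ} (h : Br g U n D k) (hD : D' ⊆ D) :
    Br g U n D' k := 
  ⟨h.1.mono hD, fun z hz => h.2 z (hD hz)⟩

variable (M : Mdl g U P φ ψ)
include M

lemma Mdl.Un_succ {n : ℕ} {x : ℂ} : x ∈ Un g U (n + 1) ↔ x ∈ U ∧ g x ∈ Un g U n := by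
  constructor
  · intro h
    have hx : x ∈ U := h.2 0 (Nat.succ_pos n)
    exact ⟨hx, M.maps hx, fun i hi => h.2 (i + 1) (by omega)⟩
  · rintro ⟨h, h2⟩
    refine ⟨M.sub h, fun i hi => ?_⟩
    rcases i with _ | i
    · exact h
    · exact h2.2 i (by omega)

lemma Mdl.Un_add {m n : ℕ} {x : ℂ} : x ∈ Un g U (m + n) ↔ x ∈ Un g U m ∧ g^[m] x ∈ Un g U n := by
  induction m generalizing x with
  | zero => simp [Un_zero]; intro h; simpa using h.1
  | succ m ih => 
    rw [show m + 1 + n = (m + n) + 1 by ring, M.Un_succ, M.Un_succ, ih, iterate_succ_apply]; tauto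

lemma Mdl.Un_iter {n : ℕ} {x : ℂ} (h : x ∈ Un g U n) : g^[n] x ∈ ball (0 : ℂ) 1 := by
  have := (M.Un_add (m := n) (n := 0) (x := x)).1 h
  rw [Un_zero] at this; exact this.2

lemma Mdl.Un_open_diff (n : ℕ) : IsOpen (Un g U n) ∧ DifferentiableOn ℂ g^[n] (Un g U n) := by
  induction n with
  | zero => rw [Un_zero]; exact ⟨isOpen_ball, differentiableOn_id⟩
  | succ n ih =>
    have h1 : Un g U (n + 1) = U ∩ g ⁻¹' Un g U n := by ext x; exact M.Un_succ
    rw [h1]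
    refine ⟨M.holo.continuousOn.isOpen_inter_preimage M.o ih.1, ?_⟩
    rw [iterate_succ]
    exact ih.2.comp (M.holo.mono inter_subset_left) (fun x hx => hx.2)

lemma Mdl.Un_open (n : ℕ) : IsOpen (Un g U n) := (M.Un_open_diff n).1
lemma Mdl.iter_diff (n : ℕ) : DifferentiableOn ℂ g^[n] (Un g U n) := (M.Un_open_diff n).2

lemma Mdl.iter_proper (n : ℕ) : ProperOn g^[n] (Un g U n) (ball 0 1) := by
  induction n with
  | zero =>
    intro K hK hKc
    rw [Un_zero]
    have : ball 0 1 ∩ g^[0] ⁻¹' K = K := by ext x; simp; intro h; simpa using hK h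
    rwa [this]
  | succ n ih =>
    intro K hK hKc
    have : Un g U (n + 1) ∩ g^[n + 1] ⁻¹' K = U ∩ g ⁻¹' (Un g U n ∩ g^[n] ⁻¹' K) := by
      ext x
      simp only [mem_inter_iff, M.Un_succ, mem_preimage, iterate_succ_apply]; tauto
    rw [this]
    exact M.prop _ (fun x hx => hx.1.1) (ih K hK hKc)

lemma Mdl.iter_P {n : ℕ} {x : ℂ} (h : x ∈ P) : g^[n] x ∈ P := by
  induction n generalizing x with
  | zero => exact h
  | succ n ih => rw [iterate_succ_apply]; exact ih (M.inv x h)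

lemma Mdl.P_Un {n : ℕ} : P ⊆ Un g U n := fun _ hx =>
  ⟨M.sub (M.PU hx), fun _ _ => M.PU (M.iter_P hx)⟩

lemma Mdl.deriv_iter_succ {n : ℕ} {x : ℂ} (h : x ∈ Un g U (n + 1)) :
    deriv g^[n + 1] x = deriv g^[n] (g x) * deriv g x := by
  rw [M.Un_succ] at h
  rw [iterate_succ]
  exact deriv_comp x ((M.iter_diff n).differentiableAt ((M.Un_open n).mem_nhds h.2))
    (M.holo.differentiableAt (M.o.mem_nhds h.1))

lemma Mdl.deriv_ne {n : ℕ} {x : ℂ} (h : x ∈ Un g U n) (hP : g^[n] x ∉ P) : deriv g^[n] x ≠ 0 := by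
  induction n generalizing x with
  | zero => simp
  | succ n ih =>
    rw [M.deriv_iter_succ h]
    have h' := M.Un_succ.1 h
    refine mul_ne_zero (ih h'.2 hP) fun h0 => hP ?_
    exact M.iter_P (M.crit ⟨h'.1, h0⟩)

lemma Mdl.branch_exists {n : ℕ} {D : Set ℂ} (hDo : IsOpen D) (hDc : Convex ℝ D)
    (hD : D ⊆ ball 0 1 \ P) {c x : ℂ} (hc : c ∈ D) (hx : x ∈ Fib g U n c) :
    ∃ k, Br g U n D k ∧ k c = x := by
  have hd : ∀ x ∈ Un g U n, g^[n] x ∈ ball 0 1 \ P → deriv g^[n] x ≠ 0 :=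
    fun x hx h => M.deriv_ne hx h.2
  obtain ⟨q, h1, h2, h3⟩ := lift_exists (M.Un_open n) isOpen_ball (M.iter_diff n)
    (fun x hx => M.Un_iter hx) (M.iter_proper n) (sdiff_subset (t := P)) hd hDo hDc
    (k := id) continuousOn_id hD hc hx.1 hx.2
  refine ⟨q, ⟨?_, h3⟩, h2⟩
  exact lift_holo (M.Un_open n) (M.iter_diff n) hDo differentiableOn_id h1 h3
    (fun z hz => hd _ (h3 z hz).1 (by rw [(h3 z hz).2]; exact hD hz))

lemma Mdl.branch_unique {n : ℕ} {D : Set ℂ} (hDp : IsPreconnected D) (hD : D ⊆ ball 0 1 \ P)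
    {k₁ k₂ : ℂ → ℂ} (h₁ : Br g U n D k₁) (h₂ : Br g U n D k₂) {c : ℂ} (hc : c ∈ D)
    (h : k₁ c = k₂ c) : EqOn k₁ k₂ D := by
  refine lift_unique hDp (M.Un_open n) (M.iter_diff n) h₁.1.continuousOn h₂.1.continuousOn
    (fun z hz => (h₁.2 z hz).1) (fun z hz => ?_) (fun z hz => ?_) hc h
  · exact M.deriv_ne (h₁.2 z hz).1 (by rw [(h₁.2 z hz).2]; exact (hD hz).2)
  · rw [(h₁.2 z hz).2, (h₂.2 z hz).2]

/-- Postcomposing a branch of `g^{-(m+n)}` with `g^m`. -/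
lemma Mdl.branch_push {m n : ℕ} {D : Set ℂ} {k : ℂ → ℂ} (h : Br g U (m + n) D k) :
    Br g U n D (fun z => g^[m] (k z)) := by
  refine ⟨(M.iter_diff m).comp h.1 fun z hz => (M.Un_add.1 (h.2 z hz).1).1, fun z hz => ?_⟩
  refine ⟨(M.Un_add.1 (h.2 z hz).1).2, ?_⟩
  rw [← iterate_add_apply, add_comm]; exact (h.2 z hz).2

lemma Mdl.Wo : IsOpen (ball 0 1 \ P) := isOpen_ball.sdiff M.Pc.isClosed

lemma Mdl.Un_W {n : ℕ} {x : ℂ} (h : x ∈ Un g U n) (hx : g^[n] x ∉ P) : x ∈ ball 0 1 \ P :=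
  ⟨h.1, fun hP => hx (M.iter_P hP)⟩

end iter

end RC

namespace RC

lemma unif_compact {ι : Type*} {F : Filter ι} {D : Set ℂ} {f : ι → ℂ → ℂ} {f' : ℂ → ℂ}
    (h : TendstoLocallyUniformlyOn f f' F D) {K : Set ℂ} (hK : IsCompact K) (hKD : K ⊆ D) {δ : ℝ}
    (hδ : 0 < δ) : ∀ᶠ i in F, ∀ z ∈ K, ‖f i z - f' z‖ < δ := by
  have h1 := (tendstoLocallyUniformlyOn_iff_tendstoUniformlyOn_of_compact hK).1 (h.mono hKD)
  filter_upwards [Metric.tendstoUniformlyOn_iff.1 h1 δ hδ] with i hi z hz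
  rw [← dist_eq_norm, dist_comm]; exact hi z hz

lemma unif_of_pointwise {ι : Type*} (F : Ultrafilter ι) {D : Set ℂ} (hD : IsOpen D) {M : ℝ}
    {f : ι → ℂ → ℂ} (hf : ∀ i, DifferentiableOn ℂ (f i) D) (hb : ∀ i, ∀ z ∈ D, ‖f i z‖ ≤ M)
    {h : ℂ → ℂ} (hp : ∀ z ∈ D, Tendsto (fun i => f i z) F (𝓝 (h z))) {K : Set ℂ}
    (hK : IsCompact K) (hKD : K ⊆ D) {δ : ℝ} (hδ : 0 < δ) :
    ∀ᶠ i in (F : Filter ι), ∀ z ∈ K, ‖f i z - h z‖ < δ := by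
  obtain ⟨f', h1, -, -, h2⟩ := montel F hD f hf hb
  filter_upwards [unif_compact h1 hK hKD hδ] with i hi z hz
  rw [tendsto_nhds_unique (hp z (hKD hz)) (h2 z (hKD hz))]
  exact hi z hz

lemma eqOn_of_ev {D : Set ℂ} (hD : IsOpen D) (hDp : IsPreconnected D) {f h : ℂ → ℂ}
    (hf : DifferentiableOn ℂ f D) (hh : DifferentiableOn ℂ h D) {x : ℂ} (hx : x ∈ D)
    (he : ∀ᶠ z in 𝓝 x, f z = h z) : EqOn f h D :=
  AnalyticOnNhd.eqOn_of_preconnected_of_eventuallyEq (hf.analyticOnNhd hD) (hh.analyticOnNhd hD)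
    hDp hx he

lemma ball_precon (c : ℂ) (r : ℝ) : IsPreconnected (ball c r) := (convex_ball c r).isPreconnected

lemma bad_limit {c : ℂ} {r ε : ℝ} (hr : 0 < r) (hε : 0 < ε) {k : ℕ → ℂ → ℂ}
    (hk : ∀ j, DifferentiableOn ℂ (k j) (ball c r)) (hb : ∀ j, ∀ z ∈ ball c r, ‖k j z‖ ≤ 1)
    {z : ℕ → ℂ} (hz : ∀ j, z j ∈ ball c (r / 2)) (h : ∀ j, ε ≤ dist (k j (z j)) (k j c)) :
    ∃ k' : ℂ → ℂ, TendstoLocallyUniformlyOn k k' (hyperfilter ℕ : Filter ℕ) (ball c r) ∧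
      DifferentiableOn ℂ k' (ball c r) ∧
      (∀ x ∈ ball c r, Tendsto (fun i => k i x) (hyperfilter ℕ : Filter ℕ) (𝓝 (k' x))) ∧
      ∀ x ∈ ball c r, ¬ ∀ᶠ w in 𝓝 x, k' w = k' x := by
  obtain ⟨k', h1, h2, -, h3⟩ := montel (hyperfilter ℕ) isOpen_ball k hk hb
  refine ⟨k', h1, h2, h3, fun x hx hev => ?_⟩
  have hcon := eqOn_of_ev isOpen_ball (ball_precon c r) h2 (differentiableOn_const _) hx hev
  have hsub : closedBall c (r / 2) ⊆ ball c r := closedBall_subset_ball (by linarith)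
  obtain ⟨j, hj⟩ := (unif_compact h1 (isCompact_closedBall c (r / 2)) hsub
    (δ := ε / 3) (by positivity)).exists
  have e1 := hj (z j) (ball_subset_closedBall (hz j))
  have e2 := hj c (mem_closedBall_self (by linarith))
  rw [hcon (hsub (ball_subset_closedBall (hz j)))] at e1
  rw [hcon (mem_ball_self hr)] at e2
  have e3 := h j
  rw [dist_eq_norm] at e3
  have e4 : k j (z j) - k j c = (k j (z j) - k' x) - (k j c - k' x) := by ring
  have e5 := norm_sub_le (k j (z j) - k' x) (k j c - k' x)
  rw [e4] at e3
  linarith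

variable {g : ℂ → ℂ} {U P : Set ℂ} {φ ψ : ℂ → ℂ}

/-- The set of points where the identity is a limit of branches of inverse iterates. -/
def Rot (g : ℂ → ℂ) (U W : Set ℂ) : Set ℂ :=
  {x | ∃ s > 0, ball x s ⊆ W ∧ ∀ δ > 0, ∃ m ≥ 1, ∃ h, Br g U m (ball x s) h ∧
    ∀ z ∈ ball x (s / 2), ‖h z - z‖ < δ}

lemma Br.bdd {n : ℕ} {D : Set ℂ} {k : ℂ → ℂ} (h : Br g U n D k) {z : ℂ} (hz : z ∈ D) :
    ‖k z‖ ≤ 1 := by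
  have := (h.2 z hz).1.1
  rw [mem_ball_zero_iff] at this; exact this.le

section
variable (M : Mdl g U P φ ψ)
include M

lemma Mdl.rot_open : IsOpen (Rot g U (ball 0 1 \ P)) := by
  rw [isOpen_iff_mem_nhds]
  rintro x ⟨s, hs, hsW, hx⟩
  filter_upwards [ball_mem_nhds x (show 0 < s / 4 by positivity)] with y hy
  rw [mem_ball] at hy
  have hsub : ball y (s / 4) ⊆ ball x (s / 2) := ball_subset_ball' (by linarith)
  have hsub2 : ball x (s / 2) ⊆ ball x s := ball_subset_ball (by linarith)
  refine ⟨s / 4, by positivity, (hsub.trans hsub2).trans hsW, fun δ hδ => ?_⟩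
  obtain ⟨m, hm, h, hh, hh2⟩ := hx δ hδ
  exact ⟨m, hm, h, hh.mono (hsub.trans hsub2), fun z hz =>
    hh2 z (hsub (ball_subset_ball (by linarith) hz))⟩

lemma Mdl.rot_closed {x : ℂ} (hxW : x ∈ ball 0 1 \ P) (hx : x ∈ closure (Rot g U (ball 0 1 \ P))) :
    x ∈ Rot g U (ball 0 1 \ P) := by
  obtain ⟨s, hs, hsW⟩ := Metric.isOpen_iff.1 M.Wo x hxW
  refine ⟨s, hs, hsW, fun δ hδ => ?_⟩
  obtain ⟨y, ⟨t, ht, htW, hy⟩, hyx⟩ := Metric.mem_closure_iff.1 hx s hs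
  have hyB : y ∈ ball x s := by rw [mem_ball, dist_comm]; exact hyx
  obtain ⟨u, hu, huB⟩ := Metric.isOpen_iff.1 isOpen_ball y hyB
  have key : ∀ j : ℕ, ∃ m ≥ 1, ∃ h, Br g U m (ball x s) h ∧
      ∀ z ∈ ball y (min u (t / 2)), ‖h z - z‖ < 1 / ((j : ℝ) + 1) := by
    intro j
    obtain ⟨m, hm, h, hh, hh2⟩ := hy (1 / ((j : ℝ) + 1)) (by positivity)
    have hyt : y ∈ ball y t := mem_ball_self ht
    obtain ⟨H, hH, hHy⟩ := M.branch_exists isOpen_ball (convex_ball x s) hsW hyB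
      (x := h y) (hh.2 y hyt)
    have hs1 : ball y (min u (t / 2)) ⊆ ball x s :=
      (ball_subset_ball (min_le_left _ _)).trans huB
    have hs2 : ball y (min u (t / 2)) ⊆ ball y t :=
      ball_subset_ball ((min_le_right _ _).trans (by linarith))
    have heq := M.branch_unique (ball_precon y (min u (t / 2))) (hs1.trans hsW)
      (hH.mono hs1) (hh.mono hs2) (mem_ball_self (by positivity)) hHy
    refine ⟨m, hm, H, hH, fun z hz => ?_⟩
    rw [heq hz]
    exact hh2 z (ball_subset_ball (min_le_right _ _) hz)
  choose m hm h hh hh2 using key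
  obtain ⟨f', -, h2, -, h4⟩ := montel (hyperfilter ℕ) isOpen_ball h (fun j => (hh j).1)
    (fun j z hz => (hh j).bdd hz)
  have hid : EqOn f' id (ball x s) := by
    refine eqOn_of_ev isOpen_ball (ball_precon x s) h2 differentiableOn_id hyB ?_
    filter_upwards [ball_mem_nhds y (show 0 < min u (t / 2) by positivity), 
      isOpen_ball.mem_nhds hyB] with z hz hzB
    have t1 : Tendsto (fun i => h i z) (hyperfilter ℕ : Filter ℕ) (𝓝 z) := by
      rw [tendsto_iff_norm_sub_tendsto_zero]
      refine squeeze_zero (fun _ => norm_nonneg _) (fun j => (hh2 j z hz).le) ?_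
      have := tendsto_one_div_add_atTop_nhds_zero_nat (𝕜 := ℝ)
      exact this.mono_left Nat.hyperfilter_le_atTop
    exact tendsto_nhds_unique (h4 z hzB) t1
  obtain ⟨j, hj⟩ := (unif_of_pointwise (hyperfilter ℕ) isOpen_ball (fun j => (hh j).1)
    (fun j z hz => (hh j).bdd hz) (h := id) (fun z hz => by rw [← hid hz]; exact h4 z hz)
    (isCompact_closedBall x (s / 2)) (closedBall_subset_ball (by linarith)) hδ).exists
  exact ⟨m j, hm j, h j, hh j, fun z hz => hj z (ball_subset_closedBall hz)⟩

lemma Mdl.rot_empty : Rot g U (ball 0 1 \ P) = ∅ := by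
  by_contra hne
  obtain ⟨x, hx⟩ := nonempty_iff_ne_empty.2 hne
  obtain ⟨a, ha, haU⟩ := M.a
  have hxW : x ∈ ball 0 1 \ P := by
    obtain ⟨s, hs, hsW, -⟩ := hx
    exact hsW (mem_ball_self hs)
  have haW : a ∈ ball 0 1 \ P := ⟨ha, fun h => haU (M.PU h)⟩
  have haR : a ∈ Rot g U (ball 0 1 \ P) := by
    by_contra haR
    obtain ⟨y, hyW, hy1, hy2⟩ := M.Wc _ (closure (Rot g U (ball 0 1 \ P)))ᶜ M.rot_open
      isClosed_closure.isOpen_compl (fun y hy => by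
        by_cases h : y ∈ Rot g U (ball 0 1 \ P)
        · exact Or.inl h
        · exact Or.inr fun h2 => h (M.rot_closed hy h2)) ⟨x, hxW, hx⟩
      ⟨a, haW, fun h2 => haR (M.rot_closed haW h2)⟩
    exact hy2 (subset_closure hy1)
  obtain ⟨s, hs, hsW, h⟩ := haR
  obtain ⟨m, hm, h, hh, hh2⟩ := h (s / 32) (by positivity)
  have e0 := hh2 a (mem_ball_self (by positivity))
  have hit' := hit isOpen_ball hh.1 (z₀ := a) (r := s / 4) (m := s / 8) (by positivity)
    (by positivity) (closedBall_subset_ball (by linarith)) (fun z hz => by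
      rw [mem_sphere, dist_eq_norm] at hz
      have e1 := hh2 z (by rw [mem_ball, dist_eq_norm, hz]; linarith)
      have e2 : z - a = (h z - h a) - (h z - z) + (h a - a) := by ring
      have e3 := norm_add_le ((h z - h a) - (h z - z)) (h a - a)
      have e4 := norm_sub_le (h z - h a) (h z - z)
      rw [← e2, hz] at e3
      linarith)
  obtain ⟨z, hz, hza⟩ := hit' (show a ∈ ball (h a) (s / 8 / 2) by
    rw [mem_ball, dist_comm, dist_eq_norm]; linarith)
  have h5 := (hh.2 z (closedBall_subset_ball (by linarith) hz)).1
  rw [hza] at h5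
  exact haU (h5.2 0 hm)

theorem Mdl.contraction {c : ℂ} {r ε : ℝ} (hr : 0 < r) (hε : 0 < ε)
    (hD : ball c r ⊆ ball 0 1 \ P) : ∃ N, ∀ n ≥ N, ∀ k, Br g U n (ball c r) k →
      ∀ z ∈ ball c (r / 2), dist (k z) (k c) < ε := by
  by_contra hcon
  push Not at hcon
  choose n hn k hk z hz hd using hcon
  obtain ⟨k', h1, h2, h3, h4⟩ := bad_limit hr hε (fun j => (hk j).1)
    (fun j z hz => (hk j).bdd hz) hz hd
  have hF : ∀ N, ∀ᶠ j in (hyperfilter ℕ : Filter ℕ), N < n j := fun N => by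
    filter_upwards [Nat.hyperfilter_le_atTop (eventually_gt_atTop N)] with j hj
    exact hj.trans_le (hn j)
  have hbU : ∀ x ∈ ball c r, ∀ N ∈ 𝓝 x, ∀ᶠ j in (hyperfilter ℕ : Filter ℕ),
      k' x ∈ Un g U (n j) ∧ g^[n j] (k' x) ∈ N := by
    intro x hx N hN
    filter_upwards [hurwitz isOpen_ball (fun j => (hk j).1) h1 hx (h4 x hx)
      (inter_mem hN (isOpen_ball.mem_nhds hx))] with j hj
    obtain ⟨w, ⟨hwN, hwB⟩, hw⟩ := hj
    rw [← hw, ((hk j).2 w hwB).2]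
    exact ⟨((hk j).2 w hwB).1, hwN⟩
  have hUn : ∀ x ∈ ball c r, ∀ N, k' x ∈ Un g U N := by
    intro x hx N
    obtain ⟨j, hj1, hj2⟩ := ((hF N).and (hbU x hx univ univ_mem)).exists
    exact Un_mono hj1.le hj2.1
  have hsub : closedBall c (r / 2) ⊆ ball c r := closedBall_subset_ball (by linarith)
  have hc : c ∈ Rot g U (ball 0 1 \ P) := by
    refine ⟨r, hr, hD, fun δ hδ => ?_⟩
    obtain ⟨j, hj⟩ := (unif_of_pointwise (hyperfilter ℕ) isOpen_ball
      (f := fun j z => g^[n j] (k' z)) (M := 1) (h := id)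
      (fun j => (M.iter_diff (n j)).comp h2 fun x hx => hUn x hx _)
      (fun j x hx => (mem_ball_zero_iff.1 (M.Un_iter (hUn x hx (n j)))).le)
      (fun x hx => tendsto_def.2 fun N hN => (hbU x hx N hN).mono fun j hj => hj.2)
      (isCompact_closedBall c (r / 2)) hsub (half_pos hδ)).exists
    -- the branches `g^{n j} ∘ k i`
    classical
    set f : ℕ → ℂ → ℂ := fun i => if n j < n i then fun z => g^[n j] (k i z) else fun _ => 0 with hf
    have hfi : ∀ i, n j < n i → Br g U (n i - n j) (ball c r) (f i) := by
      intro i hi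
      simp only [hf, hi, if_true]
      refine M.branch_push ?_
      rw [show n j + (n i - n j) = n i by omega]
      exact hk i
    obtain ⟨i, hi, hi2⟩ := ((unif_of_pointwise (hyperfilter ℕ) isOpen_ball
      (f := f) (M := 1) (h := fun z => g^[n j] (k' z))
      (fun i => by
        by_cases hi : n j < n i
        · exact (hfi i hi).1
        · simp only [hf, hi, if_false]; exact differentiableOn_const _)
      (fun i x hx => by
        by_cases hi : n j < n i
        · exact (hfi i hi).bdd hx
        · simp [hf, hi])
      (fun x hx => by
        have hc : ContinuousAt g^[n j] (k' x) := ((M.iter_diff (n j)).differentiableAt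
          ((M.Un_open _).mem_nhds (hUn x hx _))).continuousAt
        refine (hc.tendsto.comp (h3 x hx)).congr' ?_
        filter_upwards [hF (n j)] with i hi
        simp only [hf, hi, if_true, comp_apply])
      (isCompact_closedBall c (r / 2)) hsub (half_pos hδ)).and (hF (n j))).exists
    refine ⟨n i - n j, by omega, f i, hfi i hi2, fun z hz => ?_⟩
    have e1 := hj z (ball_subset_closedBall hz)
    have e2 := hi z (ball_subset_closedBall hz)
    calc ‖f i z - z‖ = ‖(f i z - g^[n j] (k' z)) + (g^[n j] (k' z) - z)‖ := by ring_nf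
      _ ≤ _ := norm_add_le _ _
      _ < δ := by simp only [id] at e1; linarith
  rw [M.rot_empty] at hc
  exact hc

end

end RC

namespace RC

/-- Accumulation points of the backward orbits of `w`. -/
def Acc (g : ℂ → ℂ) (U : Set ℂ) (w : ℂ) : Set ℂ :=
  {y | y ∈ ball (0 : ℂ) 1 ∧ ∀ ε > 0, ∀ N : ℕ, ∃ n ≥ N, ∃ x ∈ Fib g U n w, dist x y < ε}

lemma fix_lemma {c : ℂ} {ρ : ℝ} (hρ : 0 < ρ) {k : ℂ → ℂ} (hk : DifferentiableOn ℂ k (ball c (2 * ρ)))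
    (h : ∀ z ∈ ball c (2 * ρ), dist (k z) c ≤ ρ / 2) :
    ∃ z ∈ closedBall c ρ, k z = z ∧ ‖deriv k z‖ ≤ 2 / 3 := by
  have hd : ∀ z ∈ closedBall c ρ, ‖deriv k z‖ ≤ 2 / 3 := by
    intro z hz
    rw [mem_closedBall] at hz
    have hsub : closedBall z (3 * ρ / 4) ⊆ ball c (2 * ρ) := by
      apply closedBall_subset_ball'; linarith
    have h1 : DiffContOnCl ℂ (fun w => k w - c) (ball z (3 * ρ / 4)) := by
      refine DifferentiableOn.diffContOnCl ?_
      rw [closure_ball _ (by positivity)]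
      exact (hk.mono hsub).sub_const c
    have h2 := Complex.norm_deriv_le_of_forall_mem_sphere_norm_le (C := ρ / 2) (by positivity) h1
      (fun w hw => by
        rw [← dist_eq_norm]; exact h w (hsub (sphere_subset_closedBall hw)))
    rw [deriv_sub_const] at h2
    refine h2.trans (le_of_eq ?_)
    field_simp; norm_num
  have hsub : closedBall c ρ ⊆ ball c (2 * ρ) := closedBall_subset_ball (by linarith)
  have hmaps : MapsTo k (closedBall c ρ) (closedBall c ρ) := fun z hz => by
    rw [mem_closedBall]; have := h z (hsub hz); linarith
  have hlip : LipschitzOnWith (2/3) k (closedBall c ρ) := by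
    refine (convex_closedBall c ρ).lipschitzOnWith_of_nnnorm_deriv_le (𝕜 := ℂ) (fun z hz => ?_) (fun z hz => ?_)
    · exact hk.differentiableAt (isOpen_ball.mem_nhds (hsub hz))
    · have := hd z hz
      rw [← NNReal.coe_le_coe]; push_cast; simpa using this
  have hc : ContractingWith (2/3) (hmaps.restrict k _ _) := by
    refine ⟨?_, ?_⟩
    · rw [div_lt_one (by norm_num)]; norm_num
    · exact hlip.mapsToRestrict hmaps
  obtain ⟨z, hz1, hz2, -⟩ := hc.exists_fixedPoint' (isClosed_closedBall.isComplete) hmaps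
    (mem_closedBall_self hρ.le) (edist_ne_top _ _)
  exact ⟨z, hz1, hz2, hd z hz1⟩

section
variable {g : ℂ → ℂ} {U P : Set ℂ} {φ ψ : ℂ → ℂ} (M : Mdl g U P φ ψ)
include M

lemma Mdl.per_orbit {n : ℕ} (hn : 1 ≤ n) {z : ℂ} (hz : z ∈ Un g U n) (hf : g^[n] z = z) (i : ℕ) :
    g^[i] z ∈ U := by
  have h : g^[i % n] z = g^[i] z := IsPeriodicPt.iterate_mod_apply hf i
  rw [← h]; exact hz.2 _ (Nat.mod_lt _ (by omega))

lemma Mdl.rep_of_branch {n : ℕ} (hn : 1 ≤ n) {c : ℂ} {ρ : ℝ} (hρ : 0 < ρ) {k : ℂ → ℂ}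
    (hk : Br g U n (ball c (2 * ρ)) k) (h : ∀ z ∈ ball c (2 * ρ), dist (k z) c ≤ ρ / 2) :
    ∃ z ∈ closedBall c ρ, z ∈ repellingPts g U := by
  obtain ⟨z, hz, hkz, hd⟩ := fix_lemma hρ hk.1 h
  have hzb : z ∈ ball c (2 * ρ) := closedBall_subset_ball (by linarith) hz
  have h1 := hk.2 z hzb
  rw [hkz] at h1
  refine ⟨z, hz, n, hn, M.per_orbit hn h1.1 h1.2, h1.2, ?_⟩
  have e1 : DifferentiableAt ℂ g^[n] (k z) := by
    rw [hkz]; exact (M.iter_diff n).differentiableAt ((M.Un_open n).mem_nhds h1.1)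
  have e2 : DifferentiableAt ℂ k z := hk.1.differentiableAt (isOpen_ball.mem_nhds hzb)
  have e3 : deriv (g^[n] ∘ k) z = 1 := by
    have : (g^[n] ∘ k) =ᶠ[𝓝 z] id := by
      filter_upwards [isOpen_ball.mem_nhds hzb] with w hw
      exact (hk.2 w hw).2
    rw [this.deriv_eq]; simp
  rw [deriv_comp z e1 e2, hkz] at e3
  have e4 : ‖deriv g^[n] z‖ * ‖deriv k z‖ = 1 := by rw [← norm_mul, e3]; simp
  by_contra hle
  push Not at hle
  nlinarith [norm_nonneg (deriv k z), norm_nonneg (deriv g^[n] z)]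

lemma Mdl.acc_loc {w w' : ℂ} {r : ℝ} (hr : 0 < r) (hD : ball w r ⊆ ball 0 1 \ P)
    (hw' : w' ∈ ball w (r / 2)) : Acc g U w ⊆ Acc g U w' := by
  rintro y ⟨hy, h⟩
  refine ⟨hy, fun ε hε N => ?_⟩
  obtain ⟨N1, hN1⟩ := M.contraction hr (half_pos hε) hD
  obtain ⟨n, hn, x, hx, hxy⟩ := h (ε / 2) (half_pos hε) (max N N1)
  obtain ⟨k, hk, hkx⟩ := M.branch_exists isOpen_ball (convex_ball w r) hD (mem_ball_self hr) hx
  have h1 := hN1 n ((le_max_right _ _).trans hn) k hk w' hw'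
  refine ⟨n, (le_max_left _ _).trans hn, k w', hk.2 w' (ball_subset_ball (by linarith) hw'), ?_⟩
  rw [hkx] at h1
  linarith [dist_triangle (k w') x y]

lemma Mdl.acc_const {w w' : ℂ} (hw : w ∈ ball 0 1 \ P) (hw' : w' ∈ ball 0 1 \ P) :
    Acc g U w = Acc g U w' := by
  refine IsPreconnected.induction₂ M.Wc (fun a b => Acc g U a = Acc g U b) (fun x hx => ?_)
    (fun _ _ _ _ _ _ h1 h2 => h1.trans h2) (fun _ _ _ _ h => h.symm) hw hw'
  obtain ⟨r, hr, hrW⟩ := Metric.isOpen_iff.1 M.Wo x hx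
  filter_upwards [mem_nhdsWithin_of_mem_nhds (ball_mem_nhds x (show 0 < r / 4 by positivity))]
    with y hy
  have hy' := hy
  rw [mem_ball] at hy
  refine (M.acc_loc hr hrW (ball_subset_ball (by linarith) hy')).antisymm
    (M.acc_loc (r := r / 2) (by positivity) ((ball_subset_ball' (by linarith)).trans hrW) ?_)
  rw [mem_ball, dist_comm]; linarith

lemma Mdl.compact_avoid {w₀ : ℂ} (hw₀ : w₀ ∈ ball 0 1 \ P) {X Y : Set ℂ} (hX : IsCompact X)
    (hXW : X ⊆ ball 0 1 \ P) (hY : IsCompact Y) (hYb : Y ⊆ ball 0 1)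
    (hYA : Disjoint Y (Acc g U w₀)) :
    ∃ N, ∀ n ≥ N, ∀ x ∈ Y, x ∈ Un g U n → g^[n] x ∉ X := by
  by_contra hcon
  push Not at hcon
  choose n hn x hxY hxU hxX using hcon
  set F : Ultrafilter ℕ := hyperfilter ℕ
  obtain ⟨y, hy, hlim⟩ := hY.ultrafilter_le_nhds (F.map x) (by
    simp only [le_principal_iff]; exact Filter.mem_map.2 (Filter.univ_mem' hxY))
  obtain ⟨w, hw, hlimw⟩ := hX.ultrafilter_le_nhds (F.map (fun j => g^[n j] (x j))) (by
    simp only [le_principal_iff]; exact Filter.mem_map.2 (Filter.univ_mem' hxX))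
  have t1 : Tendsto x (F : Filter ℕ) (𝓝 y) := hlim
  have t2 : Tendsto (fun j => g^[n j] (x j)) (F : Filter ℕ) (𝓝 w) := hlimw
  refine disjoint_left.1 hYA hy ?_
  rw [M.acc_const hw₀ (hXW hw)]
  refine ⟨hYb hy, fun ε hε N => ?_⟩
  obtain ⟨r, hr, hrW⟩ := Metric.isOpen_iff.1 M.Wo w (hXW hw)
  obtain ⟨N1, hN1⟩ := M.contraction hr (half_pos hε) hrW
  have e1 : ∀ᶠ j in (F : Filter ℕ), x j ∈ ball y (ε / 2) := t1 (ball_mem_nhds y (half_pos hε))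
  have e2 : ∀ᶠ j in (F : Filter ℕ), g^[n j] (x j) ∈ ball w (r / 2) := t2 (ball_mem_nhds w (half_pos hr))
  have e3 : ∀ᶠ j in (F : Filter ℕ), max N N1 ≤ j :=
    Nat.hyperfilter_le_atTop (eventually_ge_atTop (max N N1))
  obtain ⟨j, ⟨h1, h2⟩, h3⟩ := ((e1.and e2).and e3).exists
  obtain ⟨k, hk, hkx⟩ := M.branch_exists isOpen_ball (convex_ball w r) hrW
    (ball_subset_ball (by linarith) h2) (x := x j) ⟨hxU j, rfl⟩
  have h4 := hN1 (n j) (((le_max_right _ _).trans h3).trans (hn j)) k hk _ h2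
  refine ⟨n j, ((le_max_left _ _).trans h3).trans (hn j), k w, hk.2 w (mem_ball_self hr), ?_⟩
  rw [hkx] at h4
  have h1' : dist (x j) y < ε / 2 := h1
  rw [dist_comm] at h4
  linarith [dist_triangle (k w) (x j) y]

lemma Mdl.per_acc {q w₀ : ℂ} (hw₀ : w₀ ∈ ball 0 1 \ P) (hq : q ∈ ball 0 1 \ P) {p : ℕ} (hp : 1 ≤ p)
    (hU : ∀ n, g^[n] q ∈ U) (hper : g^[p] q = q) : q ∈ Acc g U w₀ := by
  rw [M.acc_const hw₀ hq]
  refine ⟨hq.1, fun ε hε N => ⟨p * N, Nat.le_mul_of_pos_left _ hp, q, ⟨⟨hq.1, fun i _ => hU i⟩, ?_⟩, by simpa⟩⟩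
  exact IsPeriodicPt.mul_const hper N

lemma Mdl.acc_back {w₀ a x : ℂ} (ha : a ∈ Acc g U w₀) (haP : a ∉ P) {m : ℕ} (hx : x ∈ Fib g U m a) :
    x ∈ Acc g U w₀ := by
  refine ⟨hx.1.1, fun ε hε N => ?_⟩
  have hd : DifferentiableOn ℂ g^[m] (Un g U m) := M.iter_diff m
  have hs : HasStrictDerivAt g^[m] (deriv g^[m] x) x :=
    (hd.analyticAt ((M.Un_open m).mem_nhds hx.1)).hasStrictDerivAt
  have hmap := hs.map_nhds_eq (M.deriv_ne hx.1 (by rw [hx.2]; exact haP))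
  have h1 : g^[m] '' (ball x ε ∩ Un g U m) ∈ 𝓝 (g^[m] x) := by
    rw [← hmap]
    exact image_mem_map (inter_mem (ball_mem_nhds x hε) ((M.Un_open m).mem_nhds hx.1))
  rw [hx.2] at h1
  obtain ⟨δ, hδ, hsub⟩ := Metric.mem_nhds_iff.1 h1
  obtain ⟨n, hn, u, hu, hua⟩ := ha.2 δ hδ N
  obtain ⟨v, hv, hvu⟩ := hsub hua
  refine ⟨m + n, by omega, v, ⟨M.Un_add.2 ⟨hv.2, by rw [hvu]; exact hu.1⟩, ?_⟩, hv.1⟩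
  rw [add_comm, iterate_add_apply, hvu, hu.2]

lemma Mdl.acc_rep_W {w₀ y : ℂ} (hw₀ : w₀ ∈ ball 0 1 \ P) (hy : y ∈ Acc g U w₀)
    (hyP : y ∉ P) : y ∈ closure (repellingPts g U) := by
  have hyW : y ∈ ball 0 1 \ P := ⟨hy.1, hyP⟩
  rw [M.acc_const hw₀ hyW] at hy
  rw [Metric.mem_closure_iff]
  intro ε hε
  obtain ⟨r', hr', hrW'⟩ := Metric.isOpen_iff.1 M.Wo y hyW
  set r := min r' ε with hr_def
  have hr : 0 < r := lt_min hr' hε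
  have hrW : ball y r ⊆ ball 0 1 \ P := (ball_subset_ball (min_le_left _ _)).trans hrW'
  obtain ⟨N, hN⟩ := M.contraction hr (show 0 < r / 16 by positivity) hrW
  obtain ⟨n, hn, x, hx, hxy⟩ := hy.2 (r / 16) (by positivity) (max N 1)
  obtain ⟨k, hk, hkx⟩ := M.branch_exists isOpen_ball (convex_ball y r) hrW (mem_ball_self hr) hx
  obtain ⟨z, hz, hzR⟩ := M.rep_of_branch ((le_max_right _ _).trans hn) (c := y) (ρ := r / 4)
    (by positivity) (hk.mono (ball_subset_ball (by linarith))) (fun z hz => by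
      have := hN n ((le_max_left _ _).trans hn) k hk z (by convert hz using 2; ring)
      rw [hkx] at this
      linarith [dist_triangle (k z) x y])
  refine ⟨z, hzR, ?_⟩
  rw [mem_closedBall, dist_comm] at hz
  have : r ≤ ε := min_le_right _ _
  linarith

lemma Mdl.acc_rep {w₀ a : ℂ} (hw₀ : w₀ ∈ ball 0 1 \ P) (ha : a ∈ Acc g U w₀)
    (haP : a ∉ P) : Acc g U w₀ ⊆ closure (repellingPts g U) := by
  intro y hy
  rw [← closure_closure, Metric.mem_closure_iff]
  intro ε hε
  have hy' := hy
  rw [M.acc_const hw₀ ⟨ha.1, haP⟩] at hy'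
  obtain ⟨n, -, x, hx, hxy⟩ := hy'.2 ε hε 0
  refine ⟨x, M.acc_rep_W hw₀ (M.acc_back ha haP hx) (M.Un_W hx.1 (by rw [hx.2]; exact haP)).2, ?_⟩
  rw [dist_comm]; exact hxy

lemma Mdl.acc_closed {w y : ℂ} (hy : y ∈ closure (Acc g U w)) (hyb : y ∈ ball (0:ℂ) 1) : y ∈ Acc g U w := by
  refine ⟨hyb, fun ε hε N => ?_⟩
  obtain ⟨z, hz, hzy⟩ := Metric.mem_closure_iff.1 hy (ε / 2) (half_pos hε)
  obtain ⟨n, hn, x, hx, hxz⟩ := hz.2 (ε / 2) (half_pos hε) N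
  refine ⟨n, hn, x, hx, ?_⟩
  rw [dist_comm] at hzy
  linarith [dist_triangle x z y]

end
end RC

namespace RC

section
variable {U : Set ℂ} {φ ψ : ℂ → ℂ} 

lemma Riem.isOpen_image (h : Riem U φ ψ) (hU : IsOpen U) (r : ℝ) (hr : r ≤ 1) : IsOpen (φ '' ball 0 r) := by
  have : φ '' ball 0 r = U ∩ ψ ⁻¹' ball 0 r := by
    ext z
    constructor
    · rintro ⟨v, hv, rfl⟩
      have hv1 := ball_subset_ball hr hv
      exact ⟨h.mφ hv1, by rw [mem_preimage, h.l v hv1]; exact hv⟩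
    · rintro ⟨hz, hv⟩
      exact ⟨ψ z, hv, h.r z hz⟩
  rw [this]
  exact h.dψ.continuousOn.isOpen_inter_preimage hU isOpen_ball

lemma Riem.compact_image (h : Riem U φ ψ) {r : ℝ} (hr : r < 1) : IsCompact (φ '' closedBall 0 r) :=
  (isCompact_closedBall 0 r).image_of_continuousOn
    (h.dφ.continuousOn.mono (closedBall_subset_ball hr))

lemma Riem.mem_image (h : Riem U φ ψ) {r : ℝ} (hr : r ≤ 1) {z : ℂ} (hz : z ∈ U) :
    z ∈ φ '' ball 0 r ↔ ‖ψ z‖ < r := by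
  constructor
  · rintro ⟨v, hv, rfl⟩
    rw [h.l v (ball_subset_ball hr hv)]; simpa using hv
  · intro h1
    exact ⟨ψ z, by simpa using h1, h.r z hz⟩

lemma Riem.mem_image' (h : Riem U φ ψ) {r : ℝ} (hr : r < 1) {z : ℂ} (hz : z ∈ U) :
    z ∈ φ '' closedBall 0 r ↔ ‖ψ z‖ ≤ r := by
  constructor
  · rintro ⟨v, hv, rfl⟩
    rw [h.l v (closedBall_subset_ball hr hv)]; simpa using hv
  · intro h1
    exact ⟨ψ z, by simpa using h1, h.r z hz⟩

lemma Riem.nonzero (h : Riem U φ ψ) (h0 : φ 0 = 0) {v : ℂ} (hv : v ∈ ball (0:ℂ) 1) (hv0 : v ≠ 0) : φ v ≠ 0 := by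
  intro h1
  apply hv0
  have h2 := h.l 0 (by simp)
  rw [h0] at h2
  rw [← h.l v hv, h1, h2]

/-- the preimage of `Z \ 0` under exp is connected -/
lemma Riem.M_conn (h : Riem U φ ψ) (hUo : IsOpen U) (hU : U ⊆ ball 0 1) (h0 : φ 0 = 0) {r : ℝ}
    (hr : 0 < r) (hr1 : r < 1) : 
    IsPreconnected {ζ : ℂ | ζ.re < 0 ∧ Complex.exp ζ ∈ φ '' closedBall 0 r} := by
  set E : ℂ → ℂ := fun η => r * Complex.exp (-((|η.re| : ℝ) : ℂ) + η.im * Complex.I) with hE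
  have hEc : Continuous E := by fun_prop
  have hEn : ∀ η, ‖E η‖ = r * Real.exp (-|η.re|) := fun η => by
    simp [hE, Complex.norm_exp, abs_of_pos hr]
  have hEr : ∀ η, ‖E η‖ ≤ r := fun η => by
    rw [hEn]
    have : Real.exp (-|η.re|) ≤ 1 := by rw [Real.exp_le_one_iff]; simp
    nlinarith
  have hEb : ∀ η, E η ∈ ball (0:ℂ) 1 := fun η => by
    rw [mem_ball_zero_iff]; exact (hEr η).trans_lt hr1
  have hE0 : ∀ η, E η ≠ 0 := fun η => by
    rw [← norm_ne_zero_iff, hEn]; positivity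
  have hEs : ∀ v : ℂ, v ≠ 0 → ‖v‖ ≤ r → ∃ η, E η = v := by
    intro v hv hvr
    have hvp : 0 < ‖v‖ := norm_pos_iff.2 hv
    have hl : Real.log (‖v‖ / r) ≤ 0 := Real.log_nonpos (by positivity) (by rw [div_le_one hr]; exact hvr)
    refine ⟨⟨Real.log (‖v‖ / r), v.arg⟩, ?_⟩
    simp only [hE]
    rw [abs_of_nonpos hl, Complex.exp_add]
    push_cast
    rw [neg_neg, ← Complex.ofReal_exp, Real.exp_log (by positivity)]
    push_cast
    have := Complex.norm_mul_exp_arg_mul_I v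
    have hrc : (r : ℂ) ≠ 0 := by exact_mod_cast hr.ne'
    field_simp
    exact this
  obtain ⟨L, hL, hL2⟩ := log_univ (F := fun η => φ (E η))
    (h.dφ.continuousOn.comp_continuous hEc hEb) (fun η => h.nonzero h0 (hEb η) (hE0 η))
  -- half plane
  have hnb : φ '' ball 0 r ∈ 𝓝 (0 : ℂ) := (h.isOpen_image hUo r hr1.le).mem_nhds ⟨0, by simpa, h0⟩
  obtain ⟨δ, hδ, hδs⟩ := Metric.mem_nhds_iff.1 hnb
  set c := min (Real.log δ) 0
  set H : Set ℂ := {ζ | ζ.re < c} with hH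
  have hHc : IsPreconnected H := (convex_halfSpace_re_lt c).isPreconnected
  have hHM : H ⊆ {ζ : ℂ | ζ.re < 0 ∧ Complex.exp ζ ∈ φ '' closedBall 0 r} := by
    intro ζ hζ
    have hζ' : ζ.re < c := hζ
    refine ⟨hζ'.trans_le (min_le_right _ _), image_mono ball_subset_closedBall (hδs ?_)⟩
    rw [mem_ball_zero_iff, Complex.norm_exp, ← Real.lt_log_iff_exp_lt hδ]
    exact hζ'.trans_le (min_le_left _ _)
  have hmeet : ∃ η, (L η).re < c := by
    have hcont : Tendsto φ (𝓝 0) (𝓝 0) := by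
      have := (h.dφ.continuousOn.continuousAt (isOpen_ball.mem_nhds (mem_ball_self one_pos)))
      rw [ContinuousAt, h0] at this; exact this
    have hexp : ball (0:ℂ) (Real.exp c) ∈ 𝓝 (0:ℂ) := ball_mem_nhds _ (Real.exp_pos c)
    obtain ⟨s, hs, hsφ⟩ := Metric.mem_nhds_iff.1 (hcont hexp)
    have : min r (s / 2) > 0 := by positivity
    obtain ⟨η, hη⟩ := hEs ((min r (s/2) : ℝ)) (by exact_mod_cast this.ne') (by
      rw [Complex.norm_real, Real.norm_of_nonneg this.le]; exact min_le_left _ _)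
    refine ⟨η, ?_⟩
    have h1 : φ (E η) ∈ ball (0:ℂ) (Real.exp c) := by
      apply hsφ
      rw [hη, mem_ball_zero_iff, Complex.norm_real, Real.norm_of_nonneg this.le]
      have := min_le_right r (s/2)
      linarith
    rw [← hL2, mem_ball_zero_iff, Complex.norm_exp, Real.exp_lt_exp] at h1
    exact h1
  obtain ⟨η₀, hη₀⟩ := hmeet
  have hEq : {ζ : ℂ | ζ.re < 0 ∧ Complex.exp ζ ∈ φ '' closedBall 0 r} =
      ⋃ m : ℤ, (H ∪ range fun η => L η + m * (2 * Real.pi * Complex.I)) := by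
    ext ζ
    simp only [mem_iUnion, mem_union]
    constructor
    · rintro ⟨h1, v, hv, hvζ⟩
      have hv0 : v ≠ 0 := by
        rintro rfl; rw [h0] at hvζ; exact Complex.exp_ne_zero _ hvζ.symm
      obtain ⟨η, hη⟩ := hEs v hv0 (by simpa using hv)
      have : Complex.exp ζ = Complex.exp (L η) := by rw [hL2, hη, hvζ]
      obtain ⟨m, hm⟩ := Complex.exp_eq_exp_iff_exists_int.1 this
      exact ⟨m, Or.inr ⟨η, hm.symm⟩⟩
    · rintro ⟨m, h1 | ⟨η, rfl⟩⟩
      · exact hHM h1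
      · have h2 : Complex.exp (L η + m * (2 * Real.pi * Complex.I)) = φ (E η) := by
          rw [← hL2]; exact Complex.exp_eq_exp_iff_exists_int.2 ⟨m, rfl⟩
        have h3 : φ (E η) ∈ ball (0:ℂ) 1 := hU (h.mφ (hEb η))
        refine ⟨?_, ?_⟩
        · rw [← h2, mem_ball_zero_iff, Complex.norm_exp] at h3
          rwa [Real.exp_lt_one_iff] at h3
        · rw [h2]; exact ⟨E η, by simpa using hEr η, rfl⟩
  rw [hEq]
  have hηm : ∀ m : ℤ, L η₀ + m * (2 * Real.pi * Complex.I) ∈ H := fun m => by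
    simp [hH]; exact hη₀
  refine isPreconnected_iUnion ⟨L η₀, mem_iInter.2 fun m => Or.inl hη₀⟩ fun m => ?_
  exact IsPreconnected.union _ (hηm m) ⟨η₀, rfl⟩ hHc
    (isPreconnected_range (by fun_prop))

lemma Riem.rho (h : Riem U φ ψ) (hUo : IsOpen U) (hU : U ⊆ ball 0 1) (h0 : φ 0 = 0) {r : ℝ}
    (hr : 0 < r) (hr1 : r < 1) : ∃ ρ : ℂ → ℂ, ContinuousOn ρ (ball 0 1 \ {0}) ∧
      MapsTo ρ (ball 0 1 \ {0}) (ball 0 1 \ φ '' ball 0 r) ∧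
      (∀ z ∈ ball 0 1 \ φ '' ball 0 r, ρ z = z) ∧
      ∀ z ∈ φ '' closedBall 0 r \ {0}, ρ z ∈ φ '' closedBall 0 r := by
  classical
  set F : ℂ → ℂ := fun z => φ ((max r ‖ψ z‖ / ‖ψ z‖ : ℝ) * ψ z) with hF
  have hψ0 : ∀ z ∈ U, z ≠ 0 → 0 < ‖ψ z‖ := by
    intro z hz hz0
    rw [norm_pos_iff]
    intro h1
    apply hz0
    rw [← h.r z hz, h1, h0]
  have hn : ∀ z ∈ U, z ≠ 0 → ‖((max r ‖ψ z‖ / ‖ψ z‖ : ℝ) * ψ z : ℂ)‖ = max r ‖ψ z‖ := by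
    intro z hz hz0
    have hp := hψ0 z hz hz0
    rw [norm_mul, Complex.norm_real, Real.norm_of_nonneg (by positivity)]
    field_simp
  have hlt : ∀ z ∈ U, max r ‖ψ z‖ < 1 := fun z hz => max_lt hr1 (by simpa using h.mψ hz)
  have hFid : ∀ z ∈ U, z ≠ 0 → r ≤ ‖ψ z‖ → F z = z := by
    intro z hz hz0 hle
    have hp := hψ0 z hz hz0
    simp only [hF, max_eq_right hle]
    rw [div_self hp.ne', Complex.ofReal_one, one_mul, h.r z hz]
  have hFb : ∀ z ∈ U, z ≠ 0 → ((max r ‖ψ z‖ / ‖ψ z‖ : ℝ) * ψ z : ℂ) ∈ ball (0:ℂ) 1 := by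
    intro z hz hz0
    rw [mem_ball_zero_iff, hn z hz hz0]; exact hlt z hz
  have hUno : IsOpen (U \ {0}) := hUo.sdiff isClosed_singleton
  have hFc : ContinuousOn F (U \ {0}) := by
    have hψc : ContinuousOn ψ (U \ {0}) := h.dψ.continuousOn.mono sdiff_subset
    refine h.dφ.continuousOn.comp ?_ (fun z hz => hFb z hz.1 hz.2)
    refine ContinuousOn.mul ?_ hψc
    refine Complex.continuous_ofReal.comp_continuousOn ?_
    refine ContinuousOn.div (continuousOn_const.sup hψc.norm) hψc.norm ?_
    intro z hz
    exact (hψ0 z hz.1 hz.2).ne'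
  have hNz : (0 : ℂ) ∈ φ '' ball 0 r := ⟨0, by simpa, h0⟩
  set ρ : ℂ → ℂ := fun z => if z ∈ U then F z else z with hρ
  have hid : ∀ z ∈ ball 0 1 \ φ '' ball 0 r, ρ z = z := by
    intro z hz
    have hz0 : z ≠ 0 := fun h1 => hz.2 (h1 ▸ hNz)
    by_cases hzU : z ∈ U
    · simp only [hρ, if_pos hzU]
      refine hFid z hzU hz0 ?_
      by_contra hlt
      exact hz.2 ((h.mem_image hr1.le hzU).2 (not_le.1 hlt))
    · simp only [hρ, if_neg hzU]
  refine ⟨ρ, fun z hz => ?_, fun z hz => ?_, hid, ?_⟩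
  · refine ContinuousAt.continuousWithinAt ?_
    by_cases hzU : z ∈ U
    · have : ρ =ᶠ[𝓝 z] F := by
        filter_upwards [hUo.mem_nhds hzU] with w hw
        simp only [hρ, if_pos hw]
      exact (hFc.continuousAt (hUno.mem_nhds ⟨hzU, hz.2⟩)).congr this.symm
    · have hzZ : z ∉ φ '' closedBall 0 r := by
        rintro ⟨v, hv, rfl⟩
        exact hzU (h.mφ (closedBall_subset_ball hr1 hv))
      have : ρ =ᶠ[𝓝 z] id := by
        filter_upwards [isOpen_ball.mem_nhds hz.1,
          (h.compact_image hr1).isClosed.isOpen_compl.mem_nhds hzZ] with w hw hw2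
        exact hid w ⟨hw, fun h1 => hw2 (image_mono ball_subset_closedBall h1)⟩
      exact continuousAt_id.congr this.symm
  · by_cases hzU : z ∈ U
    · simp only [hρ, if_pos hzU]
      have hb := hFb z hzU hz.2
      refine ⟨hU (h.mφ hb), fun h1 => ?_⟩
      rw [h.mem_image hr1.le (h.mφ hb), h.l _ hb, hn z hzU hz.2] at h1
      exact absurd h1 (not_lt.2 (le_max_left _ _))
    · simp only [hρ, if_neg hzU]
      refine ⟨hz.1, ?_⟩
      rintro ⟨v, hv, rfl⟩
      exact hzU (h.mφ (ball_subset_ball hr1.le hv))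
  · rintro z ⟨hz, hz0⟩
    have hzU : z ∈ U := by
      obtain ⟨v, hv, rfl⟩ := hz
      exact h.mφ (closedBall_subset_ball hr1 hv)
    have h1 := (h.mem_image' hr1 hzU).1 hz
    simp only [hρ, if_pos hzU]
    refine ⟨_, ?_, rfl⟩
    rw [mem_closedBall_zero_iff, hn z hzU hz0, max_eq_left h1]

theorem conn_pre (h : Riem U φ ψ) (hUo : IsOpen U) (hU : U ⊆ ball 0 1) (h0 : φ 0 = 0) {r : ℝ}
    (hr : 0 < r) (hr1 : r < 1) {f : ℂ → ℂ} {X : Set ℂ} (hX : IsOpen X) (hXc : IsPreconnected X)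
    (hf : DifferentiableOn ℂ f X) (hm : MapsTo f X (ball 0 1)) (hp : ProperOn f X (ball 0 1))
    (hd : ∀ x ∈ X, f x ∈ ball 0 1 \ φ '' ball 0 r → deriv f x ≠ 0) :
    IsPreconnected (X ∩ f ⁻¹' (φ '' closedBall 0 r)) := by
  set Z := φ '' closedBall 0 r with hZ
  set N := φ '' ball 0 r with hN
  have hZc : IsClosed Z := (h.compact_image hr1).isClosed
  have hNo : IsOpen N := h.isOpen_image hUo r hr1.le
  have hNZ : N ⊆ Z := image_mono ball_subset_closedBall
  rw [isPreconnected_closed_iff]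
  rintro t t' ht ht' hsub ⟨x, hxF, hxt⟩ ⟨y, hyF, hyt⟩
  by_contra hem
  have hXpc : IsPathConnected X := hX.isConnected_iff_isPathConnected.1 ⟨⟨x, hxF.1⟩, hXc⟩
  obtain ⟨p, hpX⟩ := hXpc.joinedIn x hxF.1 y hyF.1
  obtain ⟨γ, hγ⟩ : ∃ γ : ℝ → ℂ, γ = p.extend := ⟨_, rfl⟩
  have hγc : Continuous γ := by rw [hγ]; exact p.continuous_extend
  have hγX : ∀ s, γ s ∈ X := by
    intro s
    have : γ s ∈ range γ := ⟨s, rfl⟩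
    rw [hγ, Path.extend_range] at this
    obtain ⟨u, hu⟩ := this
    rw [hγ, ← hu]; exact hpX u
  have hfγ : Continuous fun s => f (γ s) := hf.continuousOn.comp_continuous hγc hγX
  have hS2c : IsCompact (Icc (0:ℝ) 1 ∩ {s | f (γ s) ∈ Z ∧ γ s ∈ t'}) :=
    isCompact_Icc.inter_right ((hZc.preimage hfγ).inter (ht'.preimage hγc))
  obtain ⟨t₂, ⟨ht₂I, ht₂⟩, hleast⟩ := hS2c.exists_isLeast ⟨1, by simp, by
    simp [hγ]; exact ⟨hyF.2, hyt⟩⟩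
  have hS1c : IsCompact (Icc (0:ℝ) t₂ ∩ {s | f (γ s) ∈ Z ∧ γ s ∈ t}) :=
    isCompact_Icc.inter_right ((hZc.preimage hfγ).inter (ht.preimage hγc))
  obtain ⟨t₁, ⟨ht₁I, ht₁⟩, hgreat⟩ := hS1c.exists_isGreatest ⟨0, by simpa using ht₂I.1, by
    simp [hγ]; exact ⟨hxF.2, hxt⟩⟩
  have hlt : t₁ < t₂ := by
    refine lt_of_le_of_ne ht₁I.2 fun he => hem ⟨γ t₁, ⟨hγX _, ht₁.1⟩, ht₁.2, ?_⟩
    rw [he]; exact ht₂.2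
  have hoo : ∀ s ∈ Ioo t₁ t₂, f (γ s) ∉ Z := by
    intro s hs hsZ
    rcases hsub ⟨hγX s, hsZ⟩ with h1 | h1
    · have := hgreat ⟨⟨ht₁I.1.trans hs.1.le, hs.2.le⟩, hsZ, h1⟩
      exact absurd hs.1 (not_lt.2 this)
    · have := hleast ⟨⟨ht₁I.1.trans hs.1.le, hs.2.le.trans ht₂I.2⟩, hsZ, h1⟩
      exact absurd hs.2 (not_lt.2 this)
  have hcc : ∀ s ∈ Icc t₁ t₂, f (γ s) ∉ N := by
    have hcl : IsClosed {s | f (γ s) ∉ N} := hNo.isClosed_compl.preimage hfγ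
    rw [← closure_Ioo hlt.ne]
    intro s hs
    exact hcl.closure_subset_iff.2 (fun u hu h1 => hoo u hu (hNZ h1)) hs
  have h0N : (0:ℂ) ∈ N := ⟨0, by simpa, h0⟩
  -- logarithm
  set pr : ℝ → ℝ := fun s => max t₁ (min s t₂) with hpr
  have hprI : ∀ s, pr s ∈ Icc t₁ t₂ := fun s =>
    ⟨le_max_left _ _, max_le hlt.le (min_le_right _ _)⟩
  have hprid : ∀ s ∈ Icc t₁ t₂, pr s = s := fun s hs => by
    simp only [hpr]; rw [min_eq_left hs.2, max_eq_right hs.1]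
  obtain ⟨l, hl, hl2⟩ := log_univ (F := fun z => f (γ (pr z.re)))
    (hfγ.comp (by fun_prop)) (fun z h1 => by
      have h1' : f (γ (pr z.re)) = 0 := h1
      exact hcc _ (hprI z.re) (h1' ▸ h0N))
  set β : ℝ → ℂ := fun s => l s with hβ
  have hβc : Continuous β := hl.comp Complex.continuous_ofReal
  have hβe : ∀ s ∈ Icc t₁ t₂, Complex.exp (β s) = f (γ s) := fun s hs => by
    simp only [hβ]; rw [hl2]; simp [hprid s hs]
  set H : Set ℂ := {ζ | ζ.re < 0} with hH
  have hHo : IsOpen H := isOpen_lt Complex.continuous_re continuous_const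
  have hexpH : MapsTo Complex.exp H (ball 0 1 \ {0}) := fun ζ hζ =>
    ⟨by rw [mem_ball_zero_iff, Complex.norm_exp, Real.exp_lt_one_iff]; exact hζ, Complex.exp_ne_zero ζ⟩
  have hβH : ∀ s ∈ Icc t₁ t₂, β s ∈ H := fun s hs => by
    have h1 := hm (hγX s)
    rw [← hβe s hs, mem_ball_zero_iff, Complex.norm_exp, Real.exp_lt_one_iff] at h1
    exact h1
  obtain ⟨ρ, ρ1, ρ2, ρ3, ρ4⟩ := h.rho hUo hU h0 hr hr1
  have hmem : ∀ s ∈ Icc t₁ t₂, f (γ s) ∈ ball 0 1 \ N := fun s hs => ⟨hm (hγX s), hcc s hs⟩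
  have hk : ∀ s ∈ Icc t₁ t₂, ρ (Complex.exp (β s)) = f (γ s) := fun s hs => by
    rw [hβe s hs]; exact ρ3 _ (hmem s hs)
  have hs₁ : t₁ ∈ Icc t₁ t₂ := ⟨le_rfl, hlt.le⟩
  have hs₂ : t₂ ∈ Icc t₁ t₂ := ⟨hlt.le, le_rfl⟩
  obtain ⟨q, hq1, hq2, hq3⟩ := lift_exists hX isOpen_ball hf hm hp (S := ball 0 1 \ N)
    sdiff_subset hd hHo (convex_halfSpace_re_lt 0) (k := fun ζ => ρ (Complex.exp ζ))
    (ρ1.comp Complex.continuous_exp.continuousOn hexpH) (fun ζ hζ => ρ2 (hexpH hζ))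
    (hβH t₁ hs₁) (hγX t₁) (hk t₁ hs₁).symm
  have heq : EqOn γ (fun s => q (β s)) (Icc t₁ t₂) := by
    refine lift_unique isPreconnected_Icc hX hf hγc.continuousOn
      (hq1.comp hβc.continuousOn hβH) (fun s _ => hγX s) (fun s hs => hd _ (hγX s) (hmem s hs))
      (fun s hs => ?_) hs₁ hq2.symm
    have h1 := (hq3 (β s) (hβH s hs)).2
    rw [h1, hk s hs]
  have hMc := h.M_conn hUo hU h0 hr hr1
  set MM : Set ℂ := {ζ : ℂ | ζ.re < 0 ∧ Complex.exp ζ ∈ φ '' closedBall 0 r} with hMM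
  have hMH : MM ⊆ H := fun ζ hζ => hζ.1
  have hqM := hMc.image q (hq1.mono hMH)
  have hqF : q '' MM ⊆ X ∩ f ⁻¹' Z := by
    rintro _ ⟨ζ, hζ, rfl⟩
    refine ⟨(hq3 ζ (hMH hζ)).1, ?_⟩
    rw [mem_preimage, (hq3 ζ (hMH hζ)).2]
    exact ρ4 _ ⟨hζ.2, Complex.exp_ne_zero ζ⟩
  have hin : ∀ s ∈ Icc t₁ t₂, f (γ s) ∈ Z → γ s ∈ q '' MM := fun s hs hsZ => by
    refine ⟨β s, ⟨hβH s hs, ?_⟩, (heq hs).symm⟩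
    rw [hβe s hs]; exact hsZ
  obtain ⟨z, hz, hzt⟩ := isPreconnected_closed_iff.1 hqM t t' ht ht' (hqF.trans hsub)
    ⟨γ t₁, hin t₁ hs₁ ht₁.1, ht₁.2⟩ ⟨γ t₂, hin t₂ hs₂ ht₂.1, ht₂.2⟩
  exact hem ⟨z, hqF hz, hzt⟩

end
end RC

namespace RC

/-- preimages of the round (in the uniformization) discs -/
def BB (g : ℂ → ℂ) (U : Set ℂ) (φ : ℂ → ℂ) (r : ℝ) (n : ℕ) : Set ℂ :=
  Un g U n ∩ g^[n] ⁻¹' (φ '' closedBall 0 r)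

section
variable {g : ℂ → ℂ} {U P : Set ℂ} {φ ψ : ℂ → ℂ} (M : Mdl g U P φ ψ)
include M

lemma Mdl.exists_r : ∃ r, 0 < r ∧ r < 1 ∧ P ⊆ φ '' ball 0 r := by
  have h1 : IsCompact (ψ '' P) := M.Pc.image_of_continuousOn (M.rm.dψ.continuousOn.mono M.PU)
  obtain ⟨x, hx, hmax⟩ := h1.exists_isMaxOn (M.Pne.image ψ) continuous_norm.continuousOn
  have hx1 : ‖x‖ < 1 := by
    obtain ⟨y, hy, rfl⟩ := hx
    simpa using M.rm.mψ (M.PU hy)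
  refine ⟨(‖x‖ + 1) / 2, by positivity, by linarith, fun p hp => ?_⟩
  rw [M.rm.mem_image (by linarith) (M.PU hp)]
  have : ‖ψ p‖ ≤ ‖x‖ := hmax (mem_image_of_mem ψ hp)
  linarith

lemma Mdl.BB_conn' {n : ℕ} (hc : IsPreconnected (Un g U n)) {r : ℝ} (hr : 0 < r) (hr1 : r < 1)
    (hP : P ⊆ φ '' ball 0 r) : IsPreconnected (BB g U φ r n) :=
  conn_pre M.rm M.o M.sub M.φ0 hr hr1 (M.Un_open n) hc (M.iter_diff n) (fun x hx => M.Un_iter hx)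
    (M.iter_proper n) (fun x hx h => M.deriv_ne hx (fun h1 => h.2 (hP h1)))

lemma Mdl.P_BB {n : ℕ} {r : ℝ} (hP : P ⊆ φ '' ball 0 r) : P ⊆ BB g U φ r n := fun x hx =>
  ⟨M.P_Un hx, image_mono ball_subset_closedBall (hP (M.iter_P hx))⟩

lemma Mdl.BB_sub {n : ℕ} {r : ℝ} (hr : r < 1) : BB g U φ r n ⊆ Un g U (n + 1) := by
  rintro x ⟨hx, v, hv, hvx⟩
  rw [Un_succ_last]
  exact ⟨hx, hvx ▸ M.rm.mφ (closedBall_subset_ball hr hv)⟩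

lemma Mdl.Un_conn (n : ℕ) : IsPreconnected (Un g U n) := by
  induction n with
  | zero => rw [Un_zero]; exact ball_precon 0 1
  | succ n ih =>
    obtain ⟨r, hr, hr1, hP⟩ := M.exists_r
    obtain ⟨p, hp⟩ := M.Pne
    refine isPreconnected_of_forall p fun y hy => ?_
    rw [Un_succ_last] at hy
    have hy1 : ‖ψ (g^[n] y)‖ < 1 := by simpa using M.rm.mψ hy.2
    set s := max r ‖ψ (g^[n] y)‖ with hs
    have hs1 : s < 1 := max_lt hr1 hy1
    have hPs : P ⊆ φ '' ball 0 s := hP.trans (image_mono (ball_subset_ball (le_max_left _ _)))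
    refine ⟨BB g U φ s n, M.BB_sub hs1, M.P_BB hPs hp, ⟨hy.1, ?_⟩,
      M.BB_conn' ih (hr.trans_le (le_max_left _ _)) hs1 hPs⟩
    rw [mem_preimage, M.rm.mem_image' hs1 hy.2]; exact le_max_right _ _

lemma Mdl.BB_conn (n : ℕ) {r : ℝ} (hr : 0 < r) (hr1 : r < 1)
    (hP : P ⊆ φ '' ball 0 r) : IsPreconnected (BB g U φ r n) := M.BB_conn' (M.Un_conn n) hr hr1 hP

lemma Mdl.BB_compact (n : ℕ) {r : ℝ} (hr1 : r < 1) : IsCompact (BB g U φ r n) :=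
  M.iter_proper n _ (by
    rintro _ ⟨v, hv, rfl⟩
    exact M.sub (M.rm.mφ (closedBall_subset_ball hr1 hv))) (M.rm.compact_image hr1)

/-- Any compact in the preconnected open set is contained in a compact connected subset. -/
lemma Mdl.claim {w₀ : ℂ} (hw₀ : w₀ ∈ ball 0 1 \ P) {r : ℝ} (hr1 : r < 1)
    (hP : P ⊆ φ '' ball 0 r) {Φ X : Set ℂ} (hΦo : IsOpen Φ) (hΦb : Φ ⊆ ball 0 1)
    (hΦc : IsPreconnected Φ) (hΦA : Disjoint Φ (Acc g U w₀)) (hX : IsCompact X) (hXΦ : X ⊆ Φ)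
    (hinf : ∀ N : ℕ, ∃ n ≥ N, (BB g U φ r n ∩ X).Nonempty) : Φ ⊆ U := by
  intro y hy
  -- compact connected set
  obtain ⟨Y, hYc, hYp, hYΦ, hXY, hyY⟩ : ∃ Y, IsCompact Y ∧ IsPreconnected Y ∧ Y ⊆ Φ ∧ X ⊆ Y ∧ y ∈ Y := by
    have hΦpc : IsPathConnected Φ := hΦo.isConnected_iff_isPathConnected.1 ⟨⟨y, hy⟩, hΦc⟩
    have hloc : ∀ x ∈ X, ∃ Y, IsCompact Y ∧ IsPreconnected Y ∧ Y ⊆ Φ ∧ y ∈ Y ∧ Y ∈ 𝓝[X] x := by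
      intro x hx
      obtain ⟨s, hs, hsΦ⟩ := Metric.nhds_basis_closedBall.mem_iff.1 (hΦo.mem_nhds (hXΦ hx))
      obtain ⟨p, hp⟩ := hΦpc.joinedIn y hy x (hXΦ hx)
      refine ⟨range p ∪ closedBall x s, (isCompact_range p.continuous).union (isCompact_closedBall x s),
        IsPreconnected.union x ⟨1, by simp⟩ (mem_closedBall_self hs.le) (isPreconnected_range p.continuous)
          (convex_closedBall x s).isPreconnected, ?_, Or.inl ⟨0, by simp⟩, ?_⟩
      · rintro z (⟨u, rfl⟩ | hz)
        · exact hp u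
        · exact hsΦ hz
      · exact mem_nhdsWithin_of_mem_nhds (mem_of_superset (closedBall_mem_nhds x hs) subset_union_right)
    have := hX.induction_on (p := fun S => ∃ Y, IsCompact Y ∧ IsPreconnected Y ∧ Y ⊆ Φ ∧ S ⊆ Y ∧ y ∈ Y)
      ⟨{y}, isCompact_singleton, isPreconnected_singleton, singleton_subset_iff.2 hy, empty_subset _, rfl⟩
      (fun s t hst ⟨Y, h1, h2, h3, h4, h5⟩ => ⟨Y, h1, h2, h3, hst.trans h4, h5⟩)
      (fun s t ⟨Y, h1, h2, h3, h4, h5⟩ ⟨Y', h1', h2', h3', h4', h5'⟩ =>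
        ⟨Y ∪ Y', h1.union h1', IsPreconnected.union y h5 h5' h2 h2', union_subset h3 h3',
          union_subset_union h4 h4', Or.inl h5⟩)
      (fun x hx => by
        obtain ⟨Y, h1, h2, h3, h4, h5⟩ := hloc x hx
        exact ⟨Y, h5, Y, h1, h2, h3, Subset.rfl, h4⟩)
    obtain ⟨Y, h⟩ := this
    exact ⟨Y, h⟩
  set Z := φ '' closedBall 0 r
  set N := φ '' ball 0 r
  have hZb : Z ⊆ ball 0 1 := by
    rintro _ ⟨v, hv, rfl⟩
    exact M.sub (M.rm.mφ (closedBall_subset_ball hr1 hv))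
  have hNo : IsOpen N := M.rm.isOpen_image M.o r hr1.le
  have hZc : IsCompact Z := M.rm.compact_image hr1
  obtain ⟨N1, hN1⟩ := M.compact_avoid hw₀ (X := Z \ N) (hZc.diff hNo)
    (fun z hz => ⟨hZb hz.1, fun h => hz.2 (hP h)⟩) hYc (hYΦ.trans hΦb) (hΦA.mono_left hYΦ)
  obtain ⟨n, hn, b, hb, hbX⟩ := hinf N1
  have hsub : Y ⊆ BB g U φ r n := by
    refine preconn_subset_of_frontier hYp ?_ ⟨b, hXY hbX, hb⟩
    rw [Set.disjoint_left]
    intro z hzY hzf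
    have hzB : z ∈ BB g U φ r n := (M.BB_compact n hr1).isClosed.frontier_subset hzf
    have hzN : g^[n] z ∈ N := by
      by_contra h
      exact hN1 n hn z hzY hzB.1 ⟨hzB.2, h⟩
    have hop : IsOpen (Un g U n ∩ g^[n] ⁻¹' N) :=
      (M.iter_diff n).continuousOn.isOpen_inter_preimage (M.Un_open n) hNo
    refine hzf.2 (mem_interior.2 ⟨_, ?_, hop, hzB.1, hzN⟩)
    exact fun x hx => ⟨hx.1, image_mono ball_subset_closedBall hx.2⟩
  have h1 := M.BB_sub hr1 (hsub hyY)
  exact h1.2 0 (Nat.succ_pos n)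

end
end RC

namespace RC

lemma ball_sc {c : ℂ} {r : ℝ} (hr : 0 < r) : IsSimplyConnected (ball c r) := by
  have : ContractibleSpace (ball c r) :=
    Convex.contractibleSpace (convex_ball c r) ⟨c, mem_ball_self hr⟩
  exact SimplyConnectedSpace.ofContractible _

lemma Riem.sc {U : Set ℂ} {φ ψ : ℂ → ℂ} (h : Riem U φ ψ) : IsSimplyConnected U := by
  have : ContractibleSpace (ball (0:ℂ) 1) :=
    Convex.contractibleSpace (convex_ball 0 1) ⟨0, mem_ball_self one_pos⟩
  let e : U ≃ₜ ball (0:ℂ) 1 :=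
    { toFun := h.mψ.restrict ψ _ _
      invFun := h.mφ.restrict φ _ _
      left_inv := fun x => Subtype.ext (h.r x x.2)
      right_inv := fun x => Subtype.ext (h.l x x.2)
      continuous_toFun := h.dψ.continuousOn.mapsToRestrict h.mψ
      continuous_invFun := h.dφ.continuousOn.mapsToRestrict h.mφ }
  have := e.contractibleSpace
  exact SimplyConnectedSpace.ofContractible _

lemma hull_diff_open {K : Set ℂ} (hK : IsClosed K) : IsOpen (hull K \ K) := by
  rw [isOpen_iff_mem_nhds]
  rintro z ⟨hz | ⟨N, hN, hNb, hzN, hfr⟩, hzK⟩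
  · exact absurd hz hzK
  · filter_upwards [hN.mem_nhds hzN, hK.isOpen_compl.mem_nhds hzK] with w hw hw2
    exact ⟨Or.inr ⟨N, hN, hNb, hw, hfr⟩, hw2⟩

lemma hull_preconn {K : Set ℂ} (hK : IsCompact K) (hKp : IsConnected K) : IsPreconnected (hull K) := by
  have key : ∀ t t' : Set ℂ, IsClosed t → IsClosed t' → hull K ⊆ t ∪ t' → (K ∩ t).Nonempty →
      (hull K ∩ t').Nonempty → (hull K ∩ (t ∩ t')).Nonempty := by
    intro t t' ht ht' hsub hKt hyt
    by_contra hem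
    have hdis : ∀ z ∈ hull K, z ∈ t → z ∈ t' → False := fun z h1 h2 h3 => hem ⟨z, h1, h2, h3⟩
    have hKt' : ∀ z ∈ K, z ∉ t' := by
      intro z hz hzt
      obtain ⟨w, hw, hw2⟩ := isPreconnected_closed_iff.1 hKp.isPreconnected t t' ht ht'
        ((subset_hull K).trans hsub) hKt ⟨z, hz, hzt⟩
      exact hdis w (subset_hull K hw) hw2.1 hw2.2
    have hDeq : hull K ∩ t' = (hull K \ K) \ t := by
      ext z; constructor
      · rintro ⟨h1, h2⟩
        exact ⟨⟨h1, fun h => hKt' z h h2⟩, fun h => hdis z h1 h h2⟩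
      · rintro ⟨⟨h1, h2⟩, h3⟩
        exact ⟨h1, (hsub h1).resolve_left h3⟩
    have hDo : IsOpen (hull K ∩ t') := by rw [hDeq]; exact (hull_diff_open hK.isClosed).sdiff ht
    have hDc : IsCompact (hull K ∩ t') := (hull_isCompact hK).inter_right ht'
    have huniv := IsClopen.eq_univ ⟨hDc.isClosed, hDo⟩ hyt
    exact noncompact_univ ℂ (huniv ▸ hDc)
  rw [isPreconnected_closed_iff]
  rintro t t' ht ht' hsub ⟨x, hx⟩ ⟨y, hy⟩
  obtain ⟨k, hk⟩ := hKp.nonempty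
  rcases hsub (subset_hull K hk) with h | h
  · exact key t t' ht ht' hsub ⟨k, hk, h⟩ ⟨y, hy⟩
  · have := key t' t ht' ht (by rw [union_comm]; exact hsub) ⟨k, hk, h⟩ ⟨x, hx⟩
    rwa [inter_comm t t']

lemma hull_frontier_preconn {K : Set ℂ} (hK : IsCompact K) (hKp : IsConnected K) :
    IsPreconnected (frontier (hull K)) := by
  rw [frontier_eq_closure_inter_closure, (hull_isClosed hK.isClosed).closure_eq]
  refine unicoherent (hull_isClosed hK.isClosed) isClosed_closure (hull_preconn hK hKp)
    (hull_compl_connected hK).isPreconnected.closure ?_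
  rw [eq_univ_iff_forall]
  intro z
  by_cases h : z ∈ hull K
  · exact Or.inl h
  · exact Or.inr (subset_closure h)

lemma hull_frontier_sub {K : Set ℂ} (hK : IsCompact K) : frontier (hull K) ⊆ K := by
  intro z hz
  by_contra h
  have h1 := (hull_isClosed hK.isClosed).frontier_subset hz
  exact hz.2 (mem_interior.2 ⟨_, sdiff_subset, hull_diff_open hK.isClosed, h1, h⟩)

lemma comp_frontier {O : Set ℂ} (hO : IsOpen O) (x : ℂ) :
    frontier (connectedComponentIn O x) ⊆ frontier O := by
  intro z hz
  have ho := hO.connectedComponentIn (x := x)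
  rw [frontier, ho.interior_eq] at hz
  rw [frontier, hO.interior_eq]
  refine ⟨closure_mono (connectedComponentIn_subset _ _) hz.1, fun hzO => hz.2 ?_⟩
  have ho' := hO.connectedComponentIn (x := z)
  obtain ⟨y, hy1, hy2⟩ := mem_closure_iff.1 hz.1 _ ho' (mem_connectedComponentIn hzO)
  have e1 := connectedComponentIn_eq hy1
  have e2 := connectedComponentIn_eq hy2
  rw [e2, ← e1]; exact mem_connectedComponentIn hzO

section
variable {g : ℂ → ℂ} {U P : Set ℂ} {φ ψ : ℂ → ℂ} (M : Mdl g U P φ ψ)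
include M

/-- Case 2 in the disc model. -/
theorem Mdl.case2 {r : ℝ} (hr : 0 < r) (hr1 : r < 1) (hP : P ⊆ φ '' ball 0 r)
    (hesc : ∀ N : Set ℂ, IsCompact N → N ⊆ ball 0 1 → ∀ m : ℕ, ∃ n ≥ m, ¬ BB g U φ r n ⊆ N) :
    ∃ t, 0 < t ∧ t < 1 ∧ ∀ S O : Set ℂ, IsCompact S → S ⊆ ball 0 1 → IsOpen O → S ⊆ O →
      O ∩ closure (repellingPts g U) ⊆ S → closure (repellingPts g U) ∩ closedBall 0 t ⊆ S → False := by
  obtain ⟨a, ha, haU⟩ := M.a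
  obtain ⟨p, hp⟩ := M.Pne
  have haW : a ∈ ball 0 1 \ P := ⟨ha, fun h => haU (M.PU h)⟩
  obtain ⟨s₀, hs₀, hs₀1, hPs₀⟩ : ∃ s, 0 < s ∧ s < 1 ∧ P ⊆ ball 0 s := by
    obtain ⟨x, hx, hmax⟩ := M.Pc.exists_isMaxOn M.Pne continuous_norm.continuousOn
    have hx1 : ‖x‖ < 1 := by simpa using M.sub (M.PU hx)
    refine ⟨(‖x‖ + 1) / 2, by positivity, by linarith, fun q hq => ?_⟩
    have : ‖q‖ ≤ ‖x‖ := hmax hq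
    rw [mem_ball_zero_iff]; linarith
  have ha1 : ‖a‖ < 1 := by simpa using ha
  set t := max s₀ ((‖a‖ + 1) / 2) with ht
  have ht0 : 0 < t := hs₀.trans_le (le_max_left _ _)
  have ht1 : t < 1 := max_lt hs₀1 (by linarith)
  have hat : a ∈ ball (0:ℂ) t := by
    rw [mem_ball_zero_iff]; exact lt_of_lt_of_le (by linarith) (le_max_right _ _)
  have hPt : P ⊆ ball 0 t := hPs₀.trans (ball_subset_ball (le_max_left _ _))
  have hmeet : ∀ Q : Set ℂ, IsCompact Q → Q ⊆ ball 0 1 → p ∈ Q → ∀ m : ℕ, ∃ n ≥ m,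
      (BB g U φ r n ∩ frontier Q).Nonempty := by
    intro Q hQ hQb hpQ m
    obtain ⟨n, hn, hnQ⟩ := hesc Q hQ hQb m
    refine ⟨n, hn, ?_⟩
    by_contra hem
    exact hnQ (preconn_subset_of_frontier (M.BB_conn n hr hr1 hP)
      (disjoint_iff_inter_eq_empty.2 (not_nonempty_iff_eq_empty.1 hem)) ⟨p, M.P_BB hP hp, hpQ⟩)
  -- A meets W
  have hAW : ∃ b ∈ Acc g U a, b ∉ P := by
    by_contra hcon
    push Not at hcon
    have hfr : frontier (closedBall (0:ℂ) t) = sphere 0 t := frontier_closedBall _ ht0.ne'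
    refine haU (M.claim haW hr1 hP M.Wo sdiff_subset M.Wc ?_ (isCompact_sphere 0 t) ?_ ?_ haW)
    · exact disjoint_left.2 fun x hx hx2 => hx.2 (hcon x hx2)
    · intro z hz
      refine ⟨closedBall_subset_ball ht1 (sphere_subset_closedBall hz), fun h => ?_⟩
      have h1 := hPt h
      rw [mem_ball] at h1; rw [mem_sphere] at hz; linarith
    · intro N
      rw [← hfr]
      exact hmeet _ (isCompact_closedBall 0 t) (closedBall_subset_ball ht1)
        (ball_subset_closedBall (hPt hp)) N
  obtain ⟨b, hb, hbP⟩ := hAW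
  have hAR := M.acc_rep haW hb hbP
  set R := closure (repellingPts g U) with hR
  have hRc : IsClosed R := isClosed_closure
  refine ⟨t, ht0, ht1, fun S O hS hSb hO hSO hOR hRS => ?_⟩
  set L := closedBall (0:ℂ) t with hL
  have hLb : L ⊆ ball 0 1 := closedBall_subset_ball ht1
  have hTo : IsOpen (ball (0:ℂ) 1 ∩ (R \ O)ᶜ) :=
    isOpen_ball.inter (hRc.sdiff hO).isOpen_compl
  have hsub : S ∪ L ⊆ ball (0:ℂ) 1 ∩ (R \ O)ᶜ := by
    rintro z (hz | hz)
    · exact ⟨hSb hz, fun h => h.2 (hSO hz)⟩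
    · exact ⟨hLb hz, fun h => h.2 (hSO (hRS ⟨h.1, hz⟩))⟩
  have hSLc : IsCompact (S ∪ L) := hS.union (isCompact_closedBall 0 t)
  obtain ⟨δ, hδ, hδs⟩ := hSLc.exists_cthickening_subset_open hTo hsub
  set O₂ := thickening δ (S ∪ L) with hO₂
  have hO₂o : IsOpen O₂ := isOpen_thickening
  have hO₂sub : S ∪ L ⊆ O₂ := self_subset_thickening hδ _
  have hfrR : ∀ z ∈ frontier O₂, z ∉ R := by
    intro z hz hzR
    have hzc : z ∈ cthickening δ (S ∪ L) := closure_thickening_subset_cthickening δ _ hz.1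
    have hz1 := hδs hzc
    have hzO : z ∈ O := by by_contra h; exact hz1.2 ⟨hzR, h⟩
    have hzS : z ∈ S := hOR ⟨hzO, hzR⟩
    rw [frontier, hO₂o.interior_eq] at hz
    exact hz.2 (hO₂sub (Or.inl hzS))
  have h0L : (0:ℂ) ∈ L := mem_closedBall_self ht0.le
  set O₁ := connectedComponentIn O₂ 0 with hO₁
  have h0O₂ : (0:ℂ) ∈ O₂ := hO₂sub (Or.inr h0L)
  have hLO₁ : L ⊆ O₁ := (convex_closedBall 0 t).isPreconnected.subset_connectedComponentIn h0L
    (subset_union_right.trans hO₂sub)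
  have hO₁o : IsOpen O₁ := hO₂o.connectedComponentIn
  have hO₁c : IsConnected O₁ := isConnected_connectedComponentIn_iff.2 h0O₂
  set C := closure O₁ with hC
  have hCsub : C ⊆ cthickening δ (S ∪ L) :=
    (closure_mono (connectedComponentIn_subset _ _)).trans (closure_thickening_subset_cthickening δ _)
  have hCb : C ⊆ ball 0 1 := fun z hz => (hδs (hCsub hz)).1
  have hCc : IsCompact C := hSLc.cthickening.of_isClosed_subset isClosed_closure hCsub
  have hCp : IsConnected C := hO₁c.closure
  set Q := hull C with hQ
  have hQc : IsCompact Q := hull_isCompact hCc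
  have hQb : Q ⊆ ball 0 1 := hull_subset isOpen_ball (ball_sc one_pos) hCb
  have hO₁Q : O₁ ⊆ interior Q :=
    hO₁o.subset_interior_iff.2 (subset_closure.trans (subset_hull C))
  have hfrQ : frontier Q ⊆ frontier O₂ := by
    intro z hz
    refine comp_frontier hO₂o 0 ?_
    refine ⟨hull_frontier_sub hCc hz, ?_⟩
    rw [hO₁o.interior_eq]
    exact fun h => hz.2 (hO₁Q h)
  have hpQ : p ∈ Q := interior_subset (hO₁Q (hLO₁ (ball_subset_closedBall (hPt hp))))
  have hBo : IsOpen (ball (0:ℂ) 1 \ R) := isOpen_ball.sdiff hRc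
  have hfrB : frontier Q ⊆ ball (0:ℂ) 1 \ R := fun z hz =>
    ⟨hQb (hQc.isClosed.frontier_subset hz), hfrR z (hfrQ hz)⟩
  obtain ⟨-, -, x₀, -, hx₀⟩ := hmeet Q hQc hQb hpQ 0
  have hfrΦ : frontier Q ⊆ connectedComponentIn (ball (0:ℂ) 1 \ R) x₀ :=
    (hull_frontier_preconn hCc hCp).subset_connectedComponentIn hx₀ hfrB
  have hΦU := M.claim haW hr1 hP hBo.connectedComponentIn
    ((connectedComponentIn_subset _ x₀).trans sdiff_subset) isPreconnected_connectedComponentIn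
    (disjoint_left.2 fun x hx hx2 => (connectedComponentIn_subset _ _ hx).2 (hAR hx2))
    (hQc.of_isClosed_subset isClosed_frontier hQc.isClosed.frontier_subset) hfrΦ
    (hmeet Q hQc hQb hpQ)
  have hintU : interior Q ⊆ U := by
    refine holefree M.o M.rm.sc isOpen_interior (hQc.isBounded.subset interior_subset) ?_
    exact (frontier_interior_subset).trans (hfrΦ.trans hΦU)
  exact haU (hintU (hO₁Q (hLO₁ (ball_subset_closedBall hat))))

end
end RC

namespace RC

lemma compact_in_ball {K : Set ℂ} (hK : IsCompact K) (hKb : K ⊆ ball 0 1) :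
    ∃ s, 0 < s ∧ s < 1 ∧ K ⊆ ball 0 s := by
  rcases K.eq_empty_or_nonempty with rfl | hne
  · exact ⟨1/2, by norm_num, by norm_num, empty_subset _⟩
  · obtain ⟨x, hx, hmax⟩ := hK.exists_isMaxOn hne continuous_norm.continuousOn
    have hx1 : ‖x‖ < 1 := by simpa using hKb hx
    refine ⟨(‖x‖ + 1) / 2, by positivity, by linarith, fun q hq => ?_⟩
    have : ‖q‖ ≤ ‖x‖ := hmax hq
    rw [mem_ball_zero_iff]; linarith

lemma no_proper_to_C {f : ℂ → ℂ} (hf : DifferentiableOn ℂ f (ball 0 1))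
    (hp : ProperOn f (ball 0 1) univ) : False := by
  have hK : ∀ R : ℝ, ∃ s, 0 < s ∧ s < 1 ∧ ∀ z ∈ ball (0:ℂ) 1, s ≤ ‖z‖ → R < ‖f z‖ := by
    intro R
    obtain ⟨s, hs, hs1, hsub⟩ := compact_in_ball (hp (closedBall 0 R) (subset_univ _)
      (isCompact_closedBall 0 R)) inter_subset_left
    refine ⟨s, hs, hs1, fun z hz hzs => ?_⟩
    by_contra h
    have := hsub ⟨hz, by simpa using h⟩
    rw [mem_ball_zero_iff] at this; linarith
  obtain ⟨s, hs, hs1, hsf⟩ := hK 1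
  set z₀ : ℂ := (((s + 1) / 2 : ℝ) : ℂ) with hz₀
  have hz₀n : ‖z₀‖ = (s + 1) / 2 := by
    rw [hz₀, Complex.norm_real, Real.norm_of_nonneg (by positivity)]
  have hz₀b : z₀ ∈ ball (0:ℂ) 1 := by rw [mem_ball_zero_iff, hz₀n]; linarith
  have key : ∀ m : ℕ, ‖z₀‖ ^ m * ‖f z₀‖⁻¹ ≤ s ^ m := by
    intro m
    obtain ⟨t, ht, ht1, htf⟩ := hK ((s ^ m)⁻¹)
    set t' := max t ((‖z₀‖ + 1) / 2) with ht'
    have ht'1 : t' < 1 := max_lt ht1 (by rw [hz₀n]; linarith)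
    have hz₀t' : ‖z₀‖ < t' := lt_of_lt_of_le (by rw [hz₀n]; linarith) (le_max_right _ _)
    set A : Set ℂ := {z | ‖z‖ ∈ Ioo s t'} with hA
    have hAo : IsOpen A := isOpen_Ioo.preimage continuous_norm
    have hAcl : closure A ⊆ {z | ‖z‖ ∈ Icc s t'} :=
      closure_minimal (fun z hz => ⟨hz.1.le, hz.2.le⟩) (isClosed_Icc.preimage continuous_norm)
    have hclb : ∀ z ∈ closure A, z ∈ ball (0:ℂ) 1 ∧ f z ≠ 0 := fun z hz => by
      have h1 := hAcl hz
      have h2 : z ∈ ball (0:ℂ) 1 := by rw [mem_ball_zero_iff]; exact h1.2.trans_lt ht'1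
      have h3 := hsf z h2 h1.1
      exact ⟨h2, norm_pos_iff.1 (by linarith)⟩
    have hd : DiffContOnCl ℂ (fun z => z ^ m * (f z)⁻¹) A := by
      refine DifferentiableOn.diffContOnCl ?_
      refine DifferentiableOn.mul (by fun_prop) (DifferentiableOn.inv (hf.mono fun z hz => (hclb z hz).1)
        (fun z hz => (hclb z hz).2))
    have hbd : Bornology.IsBounded A := (isBounded_ball (x := (0:ℂ)) (r := 1)).subset
      (fun z hz => by rw [mem_ball_zero_iff]; exact hz.2.trans ht'1)
    have := Complex.norm_le_of_forall_mem_frontier_norm_le hbd hd (C := s ^ m) (z := z₀)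
      (fun z hz => by
        have h1 := hAcl hz.1
        have h2 := hclb z hz.1
        rw [hAo.frontier_eq] at hz
        have h3 : ‖z‖ = s ∨ ‖z‖ = t' := by
          by_contra hcon
          push Not at hcon
          exact hz.2 ⟨lt_of_le_of_ne h1.1 hcon.1.symm, lt_of_le_of_ne h1.2 hcon.2⟩
        rw [norm_mul, norm_pow, norm_inv]
        rcases h3 with h3 | h3
        · have := hsf z h2.1 h3.ge
          rw [h3]
          have h4 : ‖f z‖⁻¹ ≤ 1 := inv_le_one_of_one_le₀ this.le
          have : 0 < s ^ m := by positivity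
          nlinarith
        · have h5 := htf z h2.1 (by rw [h3]; exact le_max_left _ _)
          have h6 : ‖f z‖⁻¹ ≤ s ^ m := by
            have h7 := inv_anti₀ (by positivity) h5.le
            rwa [inv_inv] at h7
          have h8 : ‖z‖ ^ m ≤ 1 := pow_le_one₀ (norm_nonneg _) (by linarith [h1.2])
          have h9 : 0 ≤ ‖f z‖⁻¹ := by positivity
          nlinarith)
      (subset_closure ⟨by rw [hz₀n]; linarith, hz₀t'⟩)
    simpa [norm_mul, norm_pow, norm_inv] using this
  have hfz : 1 < ‖f z₀‖ := hsf z₀ hz₀b (by rw [hz₀n]; linarith)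
  have hq : s / ‖z₀‖ < 1 := by rw [div_lt_one (by rw [hz₀n]; positivity), hz₀n]; linarith
  have hq0 : 0 ≤ s / ‖z₀‖ := by positivity
  obtain ⟨m, hm⟩ := exists_pow_lt_of_lt_one (show 0 < ‖f z₀‖⁻¹ by positivity) hq
  have h1 := key m
  rw [div_pow, div_lt_iff₀ (by rw [hz₀n]; positivity)] at hm
  linarith

lemma ne_univ_of_proper {g : ℂ → ℂ} {U' U : Set ℂ} (hU'o : IsOpen U') (hU'c : IsSimplyConnected U')
    (hne : U' ≠ U) (hsub : U' ⊆ U) (hU'n : U'.Nonempty) (hg : DifferentiableOn ℂ g U')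
    (hp : ProperOn g U' U) : U ≠ univ := by
  rintro rfl
  obtain ⟨z₀, hz₀⟩ := hU'n
  obtain ⟨φ, ψ, h, -⟩ := riemann hU'o hU'c hne hz₀
  refine no_proper_to_C (f := fun z => g (φ z)) (hg.comp h.dφ h.mφ) fun K hK hKc => ?_
  have h1 := hp K hK hKc
  have h2 : ball 0 1 ∩ (fun z => g (φ z)) ⁻¹' K = ψ '' (U' ∩ g ⁻¹' K) := by
    ext z; constructor
    · rintro ⟨hz, hz2⟩
      exact ⟨φ z, ⟨h.mφ hz, hz2⟩, h.l z hz⟩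
    · rintro ⟨w, ⟨hw, hw2⟩, rfl⟩
      refine ⟨h.mψ hw, ?_⟩
      rw [mem_preimage, h.r w hw]; exact hw2
  rw [h2]
  exact h1.image_of_continuousOn (h.dψ.continuousOn.mono inter_subset_left)

lemma crit_nonempty {g : ℂ → ℂ} {U' U : Set ℂ} {d : ℕ} (H : PLSetting g U' U d) :
    (critPts g U').Nonempty := by
  by_contra hem
  have hem' : critPts g U' = ∅ := not_nonempty_iff_eq_empty.1 hem
  have hUne := ne_univ_of_proper H.disk'.1 H.disk'.2.2 H.ne H.subset H.disk'.2.1.nonempty H.holo H.proper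
  obtain ⟨x₀, hx₀⟩ := H.disk'.2.1.nonempty
  obtain ⟨φ, ψ, h, -⟩ := riemann H.disk.1 H.disk.2.2 hUne (H.subset hx₀)
  set f : ℂ → ℂ := fun z => ψ (g z) with hf
  have hfd : DifferentiableOn ℂ f U' := h.dψ.comp H.holo H.mapsTo
  have hfm : MapsTo f U' (ball 0 1) := fun x hx => h.mψ (H.mapsTo hx)
  have hfder : ∀ x ∈ U', deriv f x ≠ 0 := by
    intro x hx h0
    refine hem ⟨x, hx, ?_⟩
    have e1 : DifferentiableAt ℂ φ (f x) := h.dφ.differentiableAt (isOpen_ball.mem_nhds (hfm hx))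
    have e2 : DifferentiableAt ℂ f x := hfd.differentiableAt (H.disk'.1.mem_nhds hx)
    have e3 : g =ᶠ[𝓝 x] φ ∘ f := by
      filter_upwards [H.disk'.1.mem_nhds hx] with w hw
      simp [hf, h.r _ (H.mapsTo hw)]
    rw [e3.deriv_eq, deriv_comp x e1 e2, h0, mul_zero]
  have hfp : ProperOn f U' (ball 0 1) := by
    intro K hK hKc
    have : U' ∩ f ⁻¹' K = U' ∩ g ⁻¹' (φ '' K) := by
      ext z; constructor
      · rintro ⟨hz, hz2⟩
        exact ⟨hz, f z, hz2, h.r _ (H.mapsTo hz)⟩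
      · rintro ⟨hz, k, hk, hkz⟩
        refine ⟨hz, ?_⟩
        simp only [mem_preimage, hf]
        rw [← hkz, h.l k (hK hk)]; exact hk
    rw [this]
    refine H.proper _ ?_ (hKc.image_of_continuousOn (h.dφ.continuousOn.mono hK))
    rintro _ ⟨k, hk, rfl⟩
    exact h.mφ (hK hk)
  obtain ⟨q, hq1, hq2, hq3⟩ := lift_exists H.disk'.1 isOpen_ball hfd hfm hfp (S := ball 0 1) Subset.rfl
    (fun x hx _ => hfder x hx) isOpen_ball (convex_ball 0 1) (k := id) continuousOn_id (fun z hz => hz)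
    (hfm hx₀) hx₀ rfl
  have heq : EqOn id (fun x => q (f x)) U' :=
    lift_unique H.disk'.2.1.isPreconnected H.disk'.1 hfd continuousOn_id
      (hq1.comp hfd.continuousOn hfm) (fun x hx => hx) (fun x hx => hfder x hx)
      (fun x hx => ((hq3 _ (hfm hx)).2).symm) hx₀ hq2.symm
  have h2 := H.deg.2 (g x₀) (H.mapsTo hx₀) (by rw [hem']; simp)
  have h3 : (U' ∩ g ⁻¹' {g x₀}).Subsingleton := by
    intro x hx y hy
    have e1 : f x = f y := by
      simp only [hf]; rw [show g x = g x₀ from hx.2, show g y = g x₀ from hy.2]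
    have e2 := heq hx.1
    have e3 := heq hy.1
    simp only [id] at e2 e3
    rw [e2, e3, e1]
  have h4 : (U' ∩ g ⁻¹' {g x₀}).ncard ≤ 1 := by
    have : Finite (U' ∩ g ⁻¹' {g x₀} : Set ℂ) := h3.finite
    rw [ncard_le_one_iff_subsingleton]; exact h3
  have := H.two_le_d
  omega

lemma full_hull {K : Set ℂ} (hKb : Bornology.IsBounded K) (hKf : IsConnected Kᶜ) : hull K = K := by
  refine Subset.antisymm ?_ (subset_hull K)
  rintro z (hz | ⟨N, hN, hNb, hzN, hfr⟩)
  · exact hz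
  · by_contra hzK
    have h1 := preconn_subset_of_frontier (N := N) hKf.isPreconnected
      (disjoint_left.2 fun x hx hx2 => hx (hfr hx2)) ⟨z, hzK, hzN⟩
    have h2 : (univ : Set ℂ) ⊆ K ∪ N := fun x _ => by
      by_cases h : x ∈ K
      · exact Or.inl h
      · exact Or.inr (h1 h)
    exact NormedSpace.unbounded_univ ℂ ℂ ((hKb.union hNb).subset h2)

lemma hull_closure_sub {K N : Set ℂ} (hN : IsOpen N) (hNb : Bornology.IsBounded N)
    (hfr : frontier N ⊆ K) : closure N ⊆ hull K := by
  rw [closure_eq_self_union_frontier]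
  rintro z (hz | hz)
  · exact Or.inr ⟨N, hN, hNb, hz, hfr⟩
  · exact Or.inl (hfr hz)

/-- images of open pieces -/
lemma frontier_image_sub {f : ℂ → ℂ} {N : Set ℂ} (hNb : Bornology.IsBounded N)
    (hf : ContinuousOn f (closure N)) (ho : IsOpen (f '' N)) :
    Bornology.IsBounded (f '' N) ∧ frontier (f '' N) ⊆ f '' frontier N := by
  have hc : IsCompact (closure N) := hNb.isCompact_closure
  have hic := hc.image_of_continuousOn hf
  have hcl : closure (f '' N) ⊆ f '' closure N :=
    closure_minimal (image_mono subset_closure) hic.isClosed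
  refine ⟨hic.isBounded.subset (image_mono subset_closure), fun z hz => ?_⟩
  rw [ho.frontier_eq] at hz
  obtain ⟨w, hw, rfl⟩ := hcl hz.1
  refine ⟨w, ⟨hw, fun h => hz.2 ⟨w, interior_subset h, rfl⟩⟩, rfl⟩

lemma diff_full_conn {U P : Set ℂ} {φ ψ : ℂ → ℂ} (h : Riem U φ ψ) (hUo : IsOpen U) (hP : IsCompact P)
    (hPf : IsConnected Pᶜ) (hPU : P ⊆ U) : IsPreconnected (ball 0 1 \ (ψ '' P)) := by
  have hKc : IsCompact (ψ '' P) := hP.image_of_continuousOn (h.dψ.continuousOn.mono hPU)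
  have hKb : ψ '' P ⊆ ball 0 1 := by rintro _ ⟨p, hp, rfl⟩; exact h.mψ (hPU hp)
  have hhull : hull (ψ '' P) = ψ '' P := by
    refine Subset.antisymm ?_ (subset_hull _)
    rintro z (hz | ⟨N, hN, hNb, hzN, hfr⟩)
    · exact hz
    · have hclb : closure N ⊆ ball 0 1 := (hull_closure_sub hN hNb hfr).trans
        (hull_subset isOpen_ball (ball_sc one_pos) hKb)
      have hNball : N ⊆ ball 0 1 := subset_closure.trans hclb
      have ho : IsOpen (φ '' N) := by
        have : φ '' N = U ∩ ψ ⁻¹' N := by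
          ext w; constructor
          · rintro ⟨v, hv, rfl⟩
            exact ⟨h.mφ (hNball hv), by rw [mem_preimage, h.l v (hNball hv)]; exact hv⟩
          · rintro ⟨hw, hv⟩
            exact ⟨ψ w, hv, h.r w hw⟩
        rw [this]; exact h.dψ.continuousOn.isOpen_inter_preimage hUo hN
      obtain ⟨h1, h2⟩ := frontier_image_sub hNb (h.dφ.continuousOn.mono hclb) ho
      have h3 : φ z ∈ hull P := Or.inr ⟨_, ho, h1, ⟨z, hzN, rfl⟩, by
        intro w hw
        obtain ⟨v, hv, rfl⟩ := h2 hw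
        obtain ⟨p, hp, rfl⟩ := hfr hv
        rw [h.r p (hPU hp)]; exact hp⟩
      rw [full_hull hP.isBounded hPf] at h3
      exact ⟨φ z, h3, h.l z (hNball hzN)⟩
  have hconn := hull_compl_connected hKc
  rw [hhull] at hconn
  obtain ⟨s, hs, hs1, hsK⟩ := compact_in_ball hKc hKb
  have hann : IsPreconnected {z : ℂ | ‖z‖ ∈ Ioo s 1} :=
    norm_preconn isPreconnected_Ioo (fun r hr => hs.trans hr.1)
  set K := ψ '' P
  have hannW : {z : ℂ | ‖z‖ ∈ Ioo s 1} ⊆ ball 0 1 \ K := fun z hz =>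
    ⟨by rw [mem_ball_zero_iff]; exact hz.2, fun h1 => by
      have := hsK h1
      rw [mem_ball_zero_iff] at this
      exact absurd hz.1 (not_lt.2 this.le)⟩
  have hz₀ : (((s + 1) / 2 : ℝ) : ℂ) ∈ {z : ℂ | ‖z‖ ∈ Ioo s 1} := by
    simp only [mem_ofPred_eq]
    rw [Complex.norm_real, Real.norm_of_nonneg (by positivity)]
    exact ⟨by linarith, by linarith⟩
  set z₀ : ℂ := (((s + 1) / 2 : ℝ) : ℂ)
  set T := connectedComponentIn (ball 0 1 \ K) z₀ with hT
  have hWo : IsOpen (ball 0 1 \ K) := isOpen_ball.sdiff hKc.isClosed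
  have hTo : IsOpen T := hWo.connectedComponentIn
  have hannT : {z : ℂ | ‖z‖ ∈ Ioo s 1} ⊆ T := hann.subset_connectedComponentIn hz₀ hannW
  -- T ∪ outside is clopen in the complement
  have hE : IsOpen {z : ℂ | ‖z‖ ∈ Ioi s} := isOpen_Ioi.preimage continuous_norm
  have hsubT : ball 0 1 \ K ⊆ T := by
    intro y hy
    by_contra hyT
    have hyo := hWo.connectedComponentIn (x := y)
    have hdisj : ∀ x, x ∈ T → x ∈ connectedComponentIn (ball 0 1 \ K) y → False := fun x h1 h2 => by
      have e1 := connectedComponentIn_eq h1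
      have e2 := connectedComponentIn_eq h2
      exact hyT (by rw [hT, e1, ← e2]; exact mem_connectedComponentIn hy)
    have hs2 : ∀ x ∈ ball (0:ℂ) 1, s < ‖x‖ → x ∈ T := fun x hx hx2 => hannT ⟨hx2, by simpa using hx⟩
    -- O2 = ball \ K \ T is open
    have hO2 : IsOpen ((ball 0 1 \ K) \ T) := by
      rw [isOpen_iff_mem_nhds]
      rintro w ⟨hw, hwT⟩
      filter_upwards [(hWo.connectedComponentIn (x := w)).mem_nhds (mem_connectedComponentIn hw)] with v hv
      refine ⟨connectedComponentIn_subset _ _ hv, fun hvT => hwT ?_⟩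
      have e1 := connectedComponentIn_eq hvT
      have e2 := connectedComponentIn_eq hv
      rw [hT, e1, ← e2]; exact mem_connectedComponentIn hw
    obtain ⟨x, hx, hx1, hx2⟩ := hconn.isPreconnected (T ∪ {z : ℂ | ‖z‖ ∈ Ioi s}) ((ball 0 1 \ K) \ T)
      (hTo.union hE) hO2
      (fun x hx => by
        by_cases hxb : x ∈ ball (0:ℂ) 1
        · by_cases hxT : x ∈ T
          · exact Or.inl (Or.inl hxT)
          · exact Or.inr ⟨⟨hxb, hx⟩, hxT⟩
        · refine Or.inl (Or.inr ?_)
          simp at hxb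
          simp; linarith)
      ⟨z₀, (hannW hz₀).2, Or.inl (hannT hz₀)⟩ ⟨y, hy.2, hy, hyT⟩
    rcases hx1 with h1 | h1
    · exact hx2.2 h1
    · exact hx2.2 (hs2 x hx2.1.1 h1)
  have : ball 0 1 \ K = T := Subset.antisymm hsubT (connectedComponentIn_subset _ _)
  rw [this]; exact isPreconnected_connectedComponentIn

end RC

namespace RC

section conj
variable {g : ℂ → ℂ} {U' U : Set ℂ} {φ ψ : ℂ → ℂ}

/-- conjugated map -/
def cg (g φ ψ : ℂ → ℂ) : ℂ → ℂ := fun z => ψ (g (φ z))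

/-- conjugated domain -/
def cU (U' : Set ℂ) (φ : ℂ → ℂ) : Set ℂ := ball 0 1 ∩ φ ⁻¹' U'

lemma conj_fwd (h : Riem U φ ψ) (hm : MapsTo g U' U) {n : ℕ} {x : ℂ}
    (hx : x ∈ Un (cg g φ ψ) (cU U' φ) n) :
    (∀ i < n, g^[i] (φ x) ∈ U') ∧ φ ((cg g φ ψ)^[n] x) = g^[n] (φ x) ∧ (cg g φ ψ)^[n] x ∈ ball (0:ℂ) 1 := by
  induction n with
  | zero => exact ⟨by simp, rfl, hx.1⟩
  | succ n ih =>
    rw [Un_succ_last] at hx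
    obtain ⟨h1, h2, h3⟩ := ih hx.1
    have h4 : g^[n] (φ x) ∈ U' := by rw [← h2]; exact hx.2.2
    have h5 : (cg g φ ψ)^[n + 1] x = ψ (g^[n + 1] (φ x)) := by
      rw [iterate_succ_apply', iterate_succ_apply', ← h2]; rfl
    have h6 : g^[n + 1] (φ x) ∈ U := by rw [iterate_succ_apply']; exact hm h4
    refine ⟨fun i hi => ?_, ?_, ?_⟩
    · rcases Nat.lt_succ_iff_lt_or_eq.1 hi with h7 | rfl
      · exact h1 i h7
      · exact h4
    · rw [h5, h.r _ h6]
    · rw [h5]; exact h.mψ h6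

lemma conj_bwd (h : Riem U φ ψ) (hm : MapsTo g U' U) {n : ℕ} {x : ℂ} (hx : x ∈ ball (0:ℂ) 1)
    (hi : ∀ i < n, g^[i] (φ x) ∈ U') : x ∈ Un (cg g φ ψ) (cU U' φ) n := by
  induction n with
  | zero => rw [Un_zero]; exact hx
  | succ n ih =>
    rw [Un_succ_last]
    have h1 := ih (fun i hi' => hi i (by omega))
    obtain ⟨-, h2, h3⟩ := conj_fwd h hm h1
    refine ⟨h1, h3, ?_⟩
    rw [mem_preimage, h2]; exact hi n (Nat.lt_succ_self n)

lemma conj_rep {P : Set ℂ} {φ' ψ' : ℂ → ℂ} (hUo : IsOpen U) (h : Riem U φ ψ) (hm : MapsTo g U' U)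
    (M : Mdl (cg g φ ψ) (cU U' φ) P φ' ψ') {z : ℂ} (hz : z ∈ repellingPts (cg g φ ψ) (cU U' φ)) :
    φ z ∈ repellingPts g U' := by
  obtain ⟨p, hp, ho, hper, hd⟩ := hz
  have hzb : z ∈ ball (0:ℂ) 1 := (ho 0).1
  have hUn : ∀ n, z ∈ Un (cg g φ ψ) (cU U' φ) n := fun n => ⟨hzb, fun i _ => ho i⟩
  obtain ⟨h1, h2, h3⟩ := conj_fwd h hm (hUn p)
  refine ⟨p, hp, fun n => (conj_fwd h hm (hUn (n+1))).1 n (Nat.lt_succ_self n), ?_, ?_⟩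
  · rw [← h2, hper]
  · set G := (cg g φ ψ)^[p] with hG
    set a := φ z with ha
    have haU : a ∈ U := h.mφ hzb
    have hψa : ψ a = z := h.l z hzb
    have e1 : DifferentiableAt ℂ φ z := h.dφ.differentiableAt (isOpen_ball.mem_nhds hzb)
    have e2 : DifferentiableAt ℂ ψ a := h.dψ.differentiableAt (hUo.mem_nhds haU)
    have e3 : DifferentiableAt ℂ G z := (M.iter_diff p).differentiableAt ((M.Un_open p).mem_nhds (hUn p))
    have c1 : deriv φ z * deriv ψ a = 1 := by
      have : (φ ∘ ψ) =ᶠ[𝓝 a] id := by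
        filter_upwards [hUo.mem_nhds haU] with w hw
        exact h.r w hw
      have h4 := this.deriv_eq
      rw [deriv_comp a (by rw [hψa]; exact e1) e2, hψa] at h4
      simpa using h4
    have c2 : g^[p] =ᶠ[𝓝 a] (φ ∘ (G ∘ ψ)) := by
      have hop : IsOpen (U ∩ ψ ⁻¹' Un (cg g φ ψ) (cU U' φ) p) :=
        h.dψ.continuousOn.isOpen_inter_preimage hUo (M.Un_open p)
      filter_upwards [hop.mem_nhds ⟨haU, by rw [mem_preimage, hψa]; exact hUn p⟩] with w hw
      have := (conj_fwd h hm hw.2).2.1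
      simp only [comp_apply]
      rw [hG, this, h.r w hw.1]
    have e4 : DifferentiableAt ℂ (G ∘ ψ) a := DifferentiableAt.comp a (by rw [hψa]; exact e3) e2
    have c3 : (G ∘ ψ) a = z := by simp [hψa, hper]
    rw [c2.deriv_eq, deriv_comp a (by rw [c3]; exact e1) e4, c3, deriv_comp a (by rw [hψa]; exact e3) e2, hψa]
    have : deriv φ z * (deriv G z * deriv ψ a) = deriv G z := by
      calc _ = deriv G z * (deriv φ z * deriv ψ a) := by ring
        _ = _ := by rw [c1, mul_one]
    rw [this]; exact hd

theorem mk_model {P : Set ℂ} (hU'o : IsOpen U') (hU'c : IsSimplyConnected U') (hUo : IsOpen U)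
    (hUc : IsSimplyConnected U) (hsub : U' ⊆ U) (hne : U' ≠ U) (hg : DifferentiableOn ℂ g U')
    (hm : MapsTo g U' U) (hp : ProperOn g U' U) (hPc : IsCompact P) (hPf : IsConnected Pᶜ)
    (hPU : P ⊆ U') (hPn : P.Nonempty) (hcrit : critPts g U' ⊆ P) (hinv : ∀ x ∈ P, g x ∈ P) :
    ∃ φ ψ φ' ψ' : ℂ → ℂ, Riem U φ ψ ∧ Mdl (cg g φ ψ) (cU U' φ) (ψ '' P) φ' ψ' := by
  obtain ⟨p, hpP⟩ := hPn
  have hUne := ne_univ_of_proper hU'o hU'c hne hsub ⟨p, hPU hpP⟩ hg hp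
  have hU'ne : U' ≠ univ := fun h => hUne (univ_subset_iff.1 (h ▸ hsub))
  obtain ⟨φ, ψ, h, h0⟩ := riemann hUo hUc hUne (hsub (hPU hpP))
  obtain ⟨φ₁, ψ₁, h₁, h₁0⟩ := riemann hU'o hU'c hU'ne (hPU hpP)
  have ho : IsOpen (cU U' φ) := h.dφ.continuousOn.isOpen_inter_preimage isOpen_ball hU'o
  have hmem : ∀ z ∈ U', ψ z ∈ cU U' φ := fun z hz =>
    ⟨h.mψ (hsub hz), by rw [mem_preimage, h.r z (hsub hz)]; exact hz⟩
  have hdg : DifferentiableOn ℂ (cg g φ ψ) (cU U' φ) := by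
    refine h.dψ.comp (hg.comp (h.dφ.mono inter_subset_left) (fun z hz => hz.2)) ?_
    exact fun z hz => hm hz.2
  refine ⟨φ, ψ, fun z => ψ (φ₁ z), fun z => ψ₁ (φ z), h, ⟨ho, inter_subset_left, ?_, ?_, ?_, hdg, ?_, ?_,
    hPc.image_of_continuousOn (h.dψ.continuousOn.mono (hPU.trans hsub)), ?_, ⟨_, p, hpP, rfl⟩, ?_, ?_,
    diff_full_conn h hUo hPc hPf (hPU.trans hsub)⟩⟩
  · obtain ⟨a, haU, haU'⟩ : ∃ a ∈ U, a ∉ U' := by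
      by_contra hcon
      push Not at hcon
      exact hne (hsub.antisymm hcon)
    exact ⟨ψ a, h.mψ haU, fun h1 => haU' (by have := h1.2; rwa [mem_preimage, h.r a haU] at this)⟩
  · refine ⟨h.dψ.comp h₁.dφ (fun z hz => hsub (h₁.mφ hz)),
      h₁.dψ.comp (h.dφ.mono inter_subset_left) (fun z hz => hz.2), fun z hz => hmem _ (h₁.mφ hz),
      fun z hz => h₁.mψ hz.2, fun z hz => ?_, fun z hz => ?_⟩
    · rw [h.r _ (hsub (h₁.mφ hz)), h₁.l z hz]
    · rw [h₁.r _ hz.2, h.l z hz.1]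
  · have : φ₁ 0 = p := by rw [← h₁0, h₁.r p (hPU hpP)]
    simp only [this, h0]
  · exact fun z hz => h.mψ (hm hz.2)
  · intro K hK hKc
    have h1 : cU U' φ ∩ cg g φ ψ ⁻¹' K = ψ '' (U' ∩ g ⁻¹' (φ '' K)) := by
      ext z; constructor
      · rintro ⟨hz, hz2⟩
        refine ⟨φ z, ⟨hz.2, ?_⟩, h.l z hz.1⟩
        exact ⟨_, hz2, h.r _ (hm hz.2)⟩
      · rintro ⟨w, ⟨hw, k, hk, hkw⟩, rfl⟩
        refine ⟨hmem w hw, ?_⟩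
        simp only [mem_preimage, cg]
        rw [h.r w (hsub hw), ← hkw, h.l k (hK hk)]; exact hk
    rw [h1]
    refine (hp _ ?_ (hKc.image_of_continuousOn (h.dφ.continuousOn.mono hK))).image_of_continuousOn
      (h.dψ.continuousOn.mono (inter_subset_left.trans hsub))
    rintro _ ⟨k, hk, rfl⟩
    exact h.mφ (hK hk)
  · rintro _ ⟨q, hq, rfl⟩
    exact hmem q (hPU hq)
  · rintro z ⟨hz, hz0⟩
    refine ⟨φ z, hcrit ⟨hz.2, ?_⟩, h.l z hz.1⟩
    have hzU : φ z ∈ U := hsub hz.2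
    have hψz : ψ (φ z) = z := h.l z hz.1
    have e1 : DifferentiableAt ℂ φ (cg g φ ψ z) :=
      h.dφ.differentiableAt (isOpen_ball.mem_nhds (h.mψ (hm hz.2)))
    have e2 : DifferentiableAt ℂ ψ (φ z) := h.dψ.differentiableAt (hUo.mem_nhds hzU)
    have e3 : DifferentiableAt ℂ (cg g φ ψ) z := hdg.differentiableAt (ho.mem_nhds hz)
    have e4 : DifferentiableAt ℂ (cg g φ ψ ∘ ψ) (φ z) :=
      DifferentiableAt.comp _ (by rw [hψz]; exact e3) e2
    have c2 : g =ᶠ[𝓝 (φ z)] (φ ∘ (cg g φ ψ ∘ ψ)) := by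
      filter_upwards [hU'o.mem_nhds hz.2] with w hw
      simp only [comp_apply, cg]
      rw [h.r w (hsub hw), h.r _ (hm hw)]
    rw [c2.deriv_eq, deriv_comp _ (by simp only [comp_apply, hψz]; exact e1) e4,
      deriv_comp _ (by rw [hψz]; exact e3) e2, hψz, hz0]
    simp
  · rintro _ ⟨q, hq, rfl⟩
    refine ⟨g q, hinv q hq, ?_⟩
    simp only [cg]
    rw [h.r q (hsub (hPU hq))]

end conj

section hullinv
variable {g : ℂ → ℂ} {U' U : Set ℂ}

/-- holomorphic proper maps are open -/
lemma open_of_proper (hU'o : IsOpen U') (hU'p : IsPreconnected U') (hne : U' ≠ univ)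
    (hn : U'.Nonempty) (hg : DifferentiableOn ℂ g U') (hm : MapsTo g U' U) (hp : ProperOn g U' U) :
    ∀ s ⊆ U', IsOpen s → IsOpen (g '' s) := by
  rcases (hg.analyticOnNhd hU'o).is_constant_or_isOpen hU'p with ⟨w, hw⟩ | h
  · exfalso
    obtain ⟨x, hx⟩ := hn
    have h1 := hp {w} (singleton_subset_iff.2 (hw x hx ▸ hm hx)) isCompact_singleton
    have h2 : U' ∩ g ⁻¹' {w} = U' := inter_eq_left.2 fun y hy => hw y hy
    rw [h2] at h1
    exact hne (IsClopen.eq_univ ⟨h1.isClosed, hU'o⟩ ⟨x, hx⟩)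
  · exact h

lemma hull_fwd (hU'o : IsOpen U') (hU'c : IsSimplyConnected U') (hg : DifferentiableOn ℂ g U')
    (hop : ∀ s ⊆ U', IsOpen s → IsOpen (g '' s)) {K : Set ℂ} (hK : K ⊆ U')
    (hinv : ∀ x ∈ K, g x ∈ K) : ∀ x ∈ hull K, g x ∈ hull K := by
  rintro z (hz | ⟨N, hN, hNb, hzN, hfr⟩)
  · exact Or.inl (hinv z hz)
  · have hcl : closure N ⊆ U' := (hull_closure_sub hN hNb hfr).trans (hull_subset hU'o hU'c hK)
    have ho := hop N (subset_closure.trans hcl) hN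
    obtain ⟨h1, h2⟩ := frontier_image_sub hNb (hg.continuousOn.mono hcl) ho
    refine Or.inr ⟨_, ho, h1, ⟨z, hzN, rfl⟩, fun w hw => ?_⟩
    obtain ⟨v, hv, rfl⟩ := h2 hw
    exact hinv v (hfr hv)

lemma hull_bwd (hU'o : IsOpen U') (hUo : IsOpen U) (hUc : IsSimplyConnected U) 
    (hg : DifferentiableOn ℂ g U') (hp : ProperOn g U' U) {K : Set ℂ} (hK : K ⊆ U) (hKc : IsCompact K)
    (hinv : U' ∩ g ⁻¹' K ⊆ K) : U' ∩ g ⁻¹' hull K ⊆ hull K := by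
  rintro z ⟨hzU, hz | ⟨N, hN, hNb, hzN, hfr⟩⟩
  · exact Or.inl (hinv ⟨hzU, hz⟩)
  · have hcl : closure N ⊆ U := (hull_closure_sub hN hNb hfr).trans (hull_subset hUo hUc hK)
    have hc := hp _ hcl hNb.isCompact_closure
    have ho : IsOpen (U' ∩ g ⁻¹' N) := hg.continuousOn.isOpen_inter_preimage hU'o hN
    have hsub : U' ∩ g ⁻¹' N ⊆ U' ∩ g ⁻¹' closure N :=
      inter_subset_inter_right _ (preimage_mono subset_closure)
    refine Or.inr ⟨_, ho, hc.isBounded.subset hsub, ⟨hzU, hzN⟩, fun w hw => ?_⟩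
    rw [ho.frontier_eq] at hw
    have h1 := closure_minimal hsub hc.isClosed hw.1
    refine hinv ⟨h1.1, hfr ?_⟩
    rw [hN.frontier_eq]
    exact ⟨h1.2, fun h => hw.2 ⟨h1.1, h⟩⟩

end hullinv

section
variable {g : ℂ → ℂ} {U P : Set ℂ} {φ ψ : ℂ → ℂ} (M : Mdl g U P φ ψ)
include M

lemma Mdl.U_eq : Un g U 1 = U := by
  ext x; simp [Un]; intro h; simpa using M.sub h

lemma Mdl.U_conn : IsPreconnected U := by rw [← M.U_eq]; exact M.Un_conn 1

lemma Mdl.U_ne : U ≠ univ := by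
  obtain ⟨a, -, ha⟩ := M.a
  rintro rfl; exact ha (mem_univ a)

lemma Mdl.isOpenMap : ∀ s ⊆ U, IsOpen s → IsOpen (g '' s) :=
  open_of_proper M.o M.U_conn M.U_ne (M.Pne.mono M.PU) M.holo M.maps M.prop

lemma Mdl.esc {r : ℝ} (hP : P ⊆ φ '' ball 0 r) {N : Set ℂ} (hN : IsCompact N) (hNb : N ⊆ ball 0 1)
    {m : ℕ} (hm : ∀ n ≥ m, BB g U φ r n ⊆ N) :
    ∃ E, IsCompact E ∧ P ⊆ E ∧ E ⊆ U ∧ U ∩ g ⁻¹' E = E := by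
  set T : Set ℂ := {x | ∃ n, x ∈ Un g U n ∧ g^[n] x ∈ P} with hT
  have hTN : T ⊆ N := by
    rintro x ⟨n, hx, hxP⟩
    have h1 : x ∈ Un g U (n + m) := by rw [M.Un_add]; exact ⟨hx, M.P_Un hxP⟩
    refine hm (n + m) (by omega) ⟨h1, ?_⟩
    rw [mem_preimage, add_comm, iterate_add_apply]
    exact image_mono ball_subset_closedBall (hP (M.iter_P hxP))
  have hTg : ∀ x ∈ T, x ∈ U ∧ g x ∈ T := by
    rintro x ⟨n, hx, hxP⟩
    have h1 : x ∈ Un g U (n + 1) := Un_succ_last.2 ⟨hx, M.PU hxP⟩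
    rw [M.Un_succ] at h1
    refine ⟨h1.1, n, h1.2, ?_⟩
    rw [← iterate_succ_apply, iterate_succ_apply']; exact M.inv _ hxP
  have hTb : ∀ x ∈ U, g x ∈ T → x ∈ T := by
    rintro x hx ⟨n, h1, h2⟩
    exact ⟨n + 1, M.Un_succ.2 ⟨hx, h1⟩, h2⟩
  have hcN : closure T ⊆ N := closure_minimal hTN hN.isClosed
  have hpre : IsCompact (U ∩ g ⁻¹' closure T) :=
    M.prop _ (hcN.trans hNb) (hN.of_isClosed_subset isClosed_closure hcN)
  have hsub : closure T ⊆ U ∩ g ⁻¹' closure T := closure_minimal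
    (fun x hx => ⟨(hTg x hx).1, subset_closure (hTg x hx).2⟩) hpre.isClosed
  refine ⟨closure T, hN.of_isClosed_subset isClosed_closure hcN,
    fun x hx => subset_closure ⟨0, M.P_Un hx, hx⟩, fun x hx => (hsub hx).1, Subset.antisymm ?_ hsub⟩
  rintro x ⟨hxU, hx⟩
  rw [_root_.mem_closure_iff]
  intro O hO hxO
  have h1 := M.isOpenMap (O ∩ U) inter_subset_right (hO.inter M.o)
  obtain ⟨y, ⟨v, hv, rfl⟩, hyT⟩ := _root_.mem_closure_iff.1 hx _ h1 ⟨x, ⟨hxO, hxU⟩, rfl⟩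
  exact ⟨v, hv.1, hTb v hv.2 hyT⟩

end
end RC

namespace RC

lemma clopen_sep {X : Type*} [TopologicalSpace X] [CompactSpace X] [T2Space X] {V L : Set X}
    (hV : IsOpen V) (hL : IsCompact L) (h : ∀ x ∈ L, connectedComponent x ⊆ V) :
    ∃ Z : Set X, IsClopen Z ∧ L ⊆ Z ∧ Z ⊆ V := by
  refine hL.induction_on (p := fun s => ∃ Z : Set X, IsClopen Z ∧ s ⊆ Z ∧ Z ⊆ V) ?_ ?_ ?_ ?_
  · exact ⟨∅, isClopen_empty, subset_rfl, empty_subset _⟩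
  · rintro s t hst ⟨Z, h1, h2, h3⟩
    exact ⟨Z, h1, hst.trans h2, h3⟩
  · rintro s t ⟨Z, h1, h2, h3⟩ ⟨Z', h1', h2', h3'⟩
    exact ⟨Z ∪ Z', h1.union h1', union_subset_union h2 h2', union_subset h3 h3'⟩
  · intro x hx
    have hc := h x hx
    rw [connectedComponent_eq_iInter_isClopen] at hc
    have : Nonempty { s : Set X // IsClopen s ∧ x ∈ s } := ⟨⟨univ, isClopen_univ, mem_univ x⟩⟩
    obtain ⟨⟨Z, hZ, hxZ⟩, hZV⟩ := exists_subset_nhds_of_isCompact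
      (V := fun s : { s : Set X // IsClopen s ∧ x ∈ s } => (s : Set X)) (by
        rintro ⟨s, hs, hxs⟩ ⟨t, ht, hxt⟩
        exact ⟨⟨s ∩ t, hs.inter ht, ⟨hxs, hxt⟩⟩, inter_subset_left, inter_subset_right⟩)
      (fun s => s.2.1.1.isCompact) (fun y hy => hV.mem_nhds (hc hy))
    exact ⟨Z, mem_nhdsWithin_of_mem_nhds (hZ.2.mem_nhds hxZ), Z, hZ, subset_rfl, hZV⟩

lemma comp_alt {X : Type*} [TopologicalSpace X] [CompactSpace X] [T2Space X] {R V L : Set X}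
    (hR : IsClosed R) (hV : IsOpen V) (hL : IsCompact L) :
    (∃ C ⊆ R, IsCompact C ∧ IsPreconnected C ∧ (C ∩ L).Nonempty ∧ ¬ C ⊆ V) ∨
    ∃ S O : Set X, IsCompact S ∧ S ⊆ V ∧ IsOpen O ∧ S = R ∩ O ∧ R ∩ L ⊆ S := by
  have : CompactSpace R := isCompact_iff_compactSpace.1 hR.isCompact
  by_cases h : ∀ x ∈ (Subtype.val ⁻¹' L : Set R), connectedComponent x ⊆ (Subtype.val ⁻¹' V : Set R)
  · right
    obtain ⟨Z, hZ, h1, h2⟩ := clopen_sep (hV.preimage continuous_subtype_val)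
      (hL.isClosed.preimage continuous_subtype_val).isCompact h
    obtain ⟨O, hO, hOZ⟩ := isOpen_induced_iff.1 hZ.2
    refine ⟨Subtype.val '' Z, O, hZ.1.isCompact.image continuous_subtype_val, ?_, hO, ?_, ?_⟩
    · rintro _ ⟨x, hx, rfl⟩; exact h2 hx
    · rw [← hOZ, Subtype.image_preimage_coe]
    · rintro x ⟨hx, hxL⟩; exact ⟨⟨x, hx⟩, h1 hxL, rfl⟩
  · left
    push Not at h
    obtain ⟨x, hx, hn⟩ := h
    refine ⟨Subtype.val '' connectedComponent x, ?_,
      isClosed_connectedComponent.isCompact.image continuous_subtype_val,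
      isPreconnected_connectedComponent.image _ continuous_subtype_val.continuousOn,
      ⟨x, ⟨x, mem_connectedComponent, rfl⟩, hx⟩, ?_⟩
    · rintro _ ⟨y, -, rfl⟩; exact y.2
    · rwa [image_subset_iff]

lemma meets_frontier {X : Type*} [TopologicalSpace X] {C V : Set X} (hC : IsPreconnected C)
    (hV : IsOpen V) (h1 : (C ∩ V).Nonempty) (h2 : ¬ C ⊆ V) : (C ∩ frontier V).Nonempty := by
  by_contra hn
  have hn' : ∀ x ∈ C, x ∉ frontier V := fun x hx hf => hn ⟨x, hx, hf⟩
  obtain ⟨y, hy, hyV⟩ := not_subset.1 h2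
  have hcov : C ⊆ V ∪ (closure V)ᶜ := by
    intro x hx
    by_cases hxV : x ∈ V
    · exact Or.inl hxV
    · right
      intro hcl
      exact hn' x hx (by rw [hV.frontier_eq]; exact ⟨hcl, hxV⟩)
  obtain ⟨z, -, hz, hz'⟩ := hC V _ hV isClosed_closure.isOpen_compl hcov h1
    ⟨y, hy, (hcov hy).resolve_left hyV⟩
  exact hz' (subset_closure hz)

lemma postCrit_inv {g : ℂ → ℂ} {U' U : Set ℂ} {d : ℕ} (H : PLSetting g U' U d) :
    ∀ x ∈ postCrit g U', g x ∈ postCrit g U' := by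
  intro x hx
  have hc : ContinuousAt g x :=
    (H.holo.differentiableAt (H.disk'.1.mem_nhds (H.postCrit_subset hx))).continuousAt
  have := hc.continuousWithinAt.mem_closure (s := ⋃ n : ℕ, g^[n] '' critPts g U')
    (t := ⋃ n : ℕ, g^[n] '' critPts g U') hx (by
    intro y hy
    obtain ⟨n, c, hc, rfl⟩ := mem_iUnion.1 hy
    exact mem_iUnion.2 ⟨n+1, ⟨c, hc, iterate_succ_apply' g n c⟩⟩)
  exact this

lemma crit_postCrit {g : ℂ → ℂ} {U' : Set ℂ} : critPts g U' ⊆ postCrit g U' :=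
  fun c hc => subset_closure (mem_iUnion.2 ⟨0, c, hc, rfl⟩)

theorem case2_final {g : ℂ → ℂ} {U' U : Set ℂ} {d : ℕ} (H : PLSetting g U' U d) {Kstar : Set ℂ}
    (hKmax : ∀ K : Set ℂ, K ⊆ U → IsCompact K → IsConnected Kᶜ → U' ∩ g ⁻¹' K = K → K ⊆ Kstar)
    (hcr : (critPts g U' \ Kstar).Nonempty) :
    ∃ C ⊆ sphereRepClosure g U', IsCompact C ∧ IsConnected C ∧ C.Nontrivial ∧
      (C ∩ (fun z : ℂ => (z : OnePoint ℂ)) '' U).Nonempty ∧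
      (C ∩ frontier ((fun z : ℂ => (z : OnePoint ℂ)) '' U)).Nonempty := by
  have hU'o := H.disk'.1
  have hUo := H.disk.1
  have hU'c : IsSimplyConnected U' := H.disk'.2.2
  have hUc : IsSimplyConnected U := H.disk.2.2
  obtain ⟨c, hc, hcK⟩ := hcr
  have hUne := ne_univ_of_proper hU'o hU'c H.ne H.subset H.disk'.2.1.nonempty H.holo H.proper
  have hU'ne : U' ≠ univ := fun h => hUne (univ_subset_iff.1 (h ▸ H.subset))
  have hop := open_of_proper hU'o H.disk'.2.1.isPreconnected hU'ne H.disk'.2.1.nonempty H.holo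
    H.mapsTo H.proper
  have hPU := hull_subset hU'o hU'c H.postCrit_subset
  obtain ⟨φ, ψ, φ', ψ', h, M⟩ := mk_model hU'o hU'c hUo hUc H.subset H.ne H.holo H.mapsTo H.proper
    (hull_isCompact H.postCrit_compact) (hull_compl_connected H.postCrit_compact)
    hPU ⟨c, subset_hull _ (crit_postCrit hc)⟩ (crit_postCrit.trans (subset_hull _))
    (hull_fwd hU'o hU'c H.holo hop H.postCrit_subset (postCrit_inv H))
  obtain ⟨r, hr, hr1, hP⟩ := M.exists_r
  have hesc : ∀ N : Set ℂ, IsCompact N → N ⊆ ball 0 1 → ∀ m : ℕ, ∃ n ≥ m,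
      ¬ BB (cg g φ ψ) (cU U' φ) φ' r n ⊆ N := by
    intro N hN hNb m
    by_contra hcon
    push Not at hcon
    obtain ⟨E, hE, hPE, hEU, hEinv⟩ := M.esc hP hN hNb hcon
    have hEb : E ⊆ ball 0 1 := hEU.trans M.sub
    have hE' : IsCompact (φ '' E) := hE.image_of_continuousOn (h.dφ.continuousOn.mono hEb)
    have hE'U' : φ '' E ⊆ U' := by rintro _ ⟨x, hx, rfl⟩; exact (hEU hx).2
    have hinv : U' ∩ g ⁻¹' (φ '' E) = φ '' E := by
      ext y; constructor
      · rintro ⟨hy, x, hx, hxy⟩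
        have hyU := H.subset hy
        refine ⟨ψ y, ?_, h.r y hyU⟩
        rw [← hEinv]
        refine ⟨⟨h.mψ hyU, by rwa [mem_preimage, h.r y hyU]⟩, ?_⟩
        show ψ (g (φ (ψ y))) ∈ E
        rw [h.r y hyU, ← hxy, h.l x (hEb hx)]; exact hx
      · rintro ⟨x, hx, rfl⟩
        have hx' := hx
        rw [← hEinv] at hx'
        refine ⟨hE'U' ⟨x, hx, rfl⟩, ψ (g (φ x)), hx'.2, h.r _ (H.mapsTo hx'.1.2)⟩
    have hh1 : hull (φ '' E) ⊆ U' := hull_subset hU'o hU'c hE'U'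
    have hsub := hKmax (hull (φ '' E)) (hh1.trans H.subset) (hull_isCompact hE')
      (hull_compl_connected hE') (Subset.antisymm
        (hull_bwd hU'o hUo hUc H.holo H.proper (hE'U'.trans H.subset) hE' hinv.subset)
        (fun x hx => ⟨hh1 hx, hull_fwd hU'o hU'c H.holo hop hE'U'
          (fun x hx => (hinv.symm.subset hx).2) x hx⟩))
    apply hcK
    apply hsub
    apply subset_hull _
    have hcU : c ∈ U := H.subset hc.1
    exact ⟨ψ c, hPE ⟨c, subset_hull _ (crit_postCrit hc), rfl⟩, h.r c hcU⟩
  obtain ⟨t, ht, ht1, hF⟩ := M.case2 hr hr1 hP hesc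
  set e : ℂ → OnePoint ℂ := fun z => (z : OnePoint ℂ) with he
  have hee : IsOpenEmbedding e := OnePoint.isOpenEmbedding_coe
  have htb : closedBall (0:ℂ) t ⊆ ball 0 1 := closedBall_subset_ball ht1
  have hL : IsCompact (e '' (φ '' closedBall 0 t)) :=
    ((isCompact_closedBall 0 t).image_of_continuousOn (h.dφ.continuousOn.mono htb)).image hee.continuous
  have hVo : IsOpen (e '' U) := hee.isOpenMap U hUo
  have hLV : e '' (φ '' closedBall 0 t) ⊆ e '' U := by
    rintro _ ⟨_, ⟨x, hx, rfl⟩, rfl⟩; exact ⟨_, h.mφ (htb hx), rfl⟩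
  have hRcl : IsClosed (sphereRepClosure g U') := isClosed_closure
  rcases comp_alt hRcl hVo hL with
    ⟨C, hCR, hCc, hCp, ⟨x, hxC, hxL⟩, hCV⟩ | ⟨S, O, hS, hSV, hO, hSO, hRL⟩
  · have hxV := hLV hxL
    obtain ⟨y, hyC, hyf⟩ := meets_frontier hCp hVo ⟨x, hxC, hxV⟩ hCV
    refine ⟨C, hCR, hCc, ⟨⟨x, hxC⟩, hCp⟩, ⟨x, hxC, y, hyC, ?_⟩, ⟨x, hxC, hxV⟩, ⟨y, hyC, hyf⟩⟩
    rintro rfl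
    rw [hVo.frontier_eq] at hyf
    exact hyf.2 hxV
  · exfalso
    have hmodel : ∀ x ∈ closure (repellingPts (cg g φ ψ) (cU U' φ)), x ∈ ball (0:ℂ) 1 →
        e (φ x) ∈ sphereRepClosure g U' := by
      intro x hx hxb
      have hcont : ContinuousAt (fun x => e (φ x)) x :=
        hee.continuous.continuousAt.comp (h.dφ.continuousOn.continuousAt (isOpen_ball.mem_nhds hxb))
      exact hcont.continuousWithinAt.mem_closure hx (fun z hz => ⟨φ z, conj_rep hUo h H.mapsTo M hz, rfl⟩)
    have hS2 : IsCompact (e ⁻¹' S) := hee.isInducing.isCompact_preimage_iff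
      (hSV.trans (image_subset_range _ _)) |>.2 hS
    have hS2U : e ⁻¹' S ⊆ U := by
      intro z hz
      obtain ⟨u, hu, huz⟩ := hSV hz
      rwa [← hee.injective huz]
    refine hF (ψ '' (e ⁻¹' S)) (ball 0 1 ∩ φ ⁻¹' (e ⁻¹' O))
      (hS2.image_of_continuousOn (h.dψ.continuousOn.mono hS2U)) ?_
      (h.dφ.continuousOn.isOpen_inter_preimage isOpen_ball (hO.preimage hee.continuous)) ?_ ?_ ?_
    · rintro _ ⟨z, hz, rfl⟩; exact h.mψ (hS2U hz)
    · rintro _ ⟨z, hz, rfl⟩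
      refine ⟨h.mψ (hS2U hz), ?_⟩
      rw [mem_preimage, h.r z (hS2U hz)]
      have : e z ∈ sphereRepClosure g U' ∩ O := hSO ▸ hz
      exact this.2
    · rintro x ⟨⟨hxb, hxO⟩, hx⟩
      refine ⟨φ x, ?_, h.l x hxb⟩
      show e (φ x) ∈ S
      rw [hSO]
      exact ⟨hmodel x hx hxb, hxO⟩
    · rintro x ⟨hx, hxt⟩
      exact ⟨φ x, hRL ⟨hmodel x hx (htb hxt), φ x, ⟨x, hxt, rfl⟩, rfl⟩, h.l x (htb hxt)⟩

end RC

namespace RC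

open MeasureTheory in
lemma mv_lint0 {f : ℂ → ℂ} {R : ℝ} (hf : DifferentiableOn ℂ f (ball 0 R)) :
    ‖f 0‖ₑ * volume (ball (0:ℂ) R) ≤ ∫⁻ z in ball (0:ℂ) R, ‖f z‖ₑ := by
  set F : ℂ → ENNReal := (ball (0:ℂ) R).indicator (fun z => ‖f z‖ₑ) with hF
  have hFm : Measurable F := by
    have h1 : ContinuousOn (fun z => ‖f z‖ₑ) (ball (0:ℂ) R) := hf.continuousOn.enorm
    classical
    rw [hF, ← piecewise_eq_indicator]
    exact h1.measurable_piecewise continuousOn_const measurableSet_ball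
  have hI : ∫⁻ z in ball (0:ℂ) R, ‖f z‖ₑ = ∫⁻ z, F z := by
    rw [hF, lintegral_indicator measurableSet_ball]
  rw [hI]
  have hrot : ∀ θ : ℝ, ∫⁻ z, F (circleMap 0 1 θ * z) = ∫⁻ z, F z := by
    intro θ
    have := (rotation (Circle.exp θ)).measurePreserving.lintegral_comp hFm
    rw [← this]
    refine lintegral_congr fun z => ?_
    congr 1
    simp [circleMap, rotation_apply, Circle.coe_exp]
  have hm2 : Measurable (fun p : ℝ × ℂ => F (circleMap 0 1 p.1 * p.2)) :=
    hFm.comp (((continuous_circleMap 0 1).comp continuous_fst).mul continuous_snd).measurable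
  have h2 : ∫⁻ θ in Ioc 0 (2 * Real.pi), ∫⁻ z, F (circleMap 0 1 θ * z)
      = ENNReal.ofReal (2 * Real.pi) * ∫⁻ z, F z := by
    simp only [hrot, lintegral_const, Measure.restrict_apply MeasurableSet.univ, univ_inter,
      Real.volume_Ioc, sub_zero]
    rw [mul_comm]
  rw [lintegral_lintegral_swap hm2.aemeasurable] at h2
  have hpi : ENNReal.ofReal (2 * Real.pi) ≠ 0 := by
    simp [Real.pi_pos]
  have h3 : ENNReal.ofReal (2 * Real.pi) * (‖f 0‖ₑ * volume (ball (0:ℂ) R))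
      ≤ ENNReal.ofReal (2 * Real.pi) * ∫⁻ z, F z := by
    rw [← h2]
    calc ENNReal.ofReal (2 * Real.pi) * (‖f 0‖ₑ * volume (ball (0:ℂ) R))
        = ∫⁻ z in ball (0:ℂ) R, (ENNReal.ofReal (2 * Real.pi) * ‖f 0‖ₑ) := by
          rw [lintegral_const, Measure.restrict_apply MeasurableSet.univ, univ_inter, mul_assoc]
      _ ≤ ∫⁻ z in ball (0:ℂ) R, ∫⁻ θ in Ioc 0 (2 * Real.pi), F (circleMap 0 1 θ * z) := by
          refine setLIntegral_mono' measurableSet_ball fun z hz => ?_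
          have hmem : ∀ ζ : ℂ, ‖ζ‖ ≤ 1 → ζ * z ∈ ball (0:ℂ) R := by
            intro ζ hζ
            rw [mem_ball_zero_iff] at hz ⊢
            rw [norm_mul]
            nlinarith [norm_nonneg z]
          have hdiff : DiffContOnCl ℂ (fun ζ => f (ζ * z)) (ball 0 |1|) := by
            apply DifferentiableOn.diffContOnCl
            rw [abs_one, closure_ball _ one_ne_zero]
            refine hf.comp (by fun_prop) fun ζ hζ => hmem ζ (by simpa using hζ)
          have hav := hdiff.circleAverage
          rw [zero_mul, Real.circleAverage_def] at hav
          have hcont : Continuous (fun θ : ℝ => f (circleMap 0 1 θ * z)) := by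
            rw [← continuousOn_univ]
            refine hf.continuousOn.comp (by fun_prop) fun θ _ => hmem _ (by simp)
          have e1 : ∫⁻ θ in Ioc 0 (2 * Real.pi), F (circleMap 0 1 θ * z)
              = ∫⁻ θ in Ioc 0 (2 * Real.pi), ‖f (circleMap 0 1 θ * z)‖ₑ := by
            refine lintegral_congr fun θ => ?_
            rw [hF, indicator_of_mem (hmem _ (by simp))]
          rw [e1]
          refine le_trans ?_ (enorm_integral_le_lintegral_enorm _)
          rw [← intervalIntegral.integral_of_le (by positivity), ← hav, enorm_smul, ← mul_assoc]
          have : ENNReal.ofReal (2 * Real.pi) * ‖(2 * Real.pi)⁻¹‖ₑ = 1 := by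
            rw [← Real.enorm_of_nonneg (by positivity), ← enorm_mul, mul_inv_cancel₀ (by positivity)]
            simp
          rw [this, one_mul]
      _ ≤ _ := setLIntegral_le_lintegral _ _
  exact (ENNReal.mul_le_mul_iff_right hpi ENNReal.ofReal_ne_top).1 h3

open MeasureTheory in
lemma mv_lint {f : ℂ → ℂ} {c : ℂ} {R : ℝ} (hf : DifferentiableOn ℂ f (ball c R)) :
    ‖f c‖ₑ * volume (ball c R) ≤ ∫⁻ z in ball c R, ‖f z‖ₑ := by
  have h1 := mv_lint0 (f := fun z => f (c + z)) (R := R)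
    (hf.comp (by fun_prop) fun z hz => by simpa using hz)
  rw [add_zero] at h1
  rw [← lintegral_indicator measurableSet_ball] at h1 ⊢
  rw [← lintegral_add_left_eq_self _ c, Complex.volume_ball] 
  rw [Complex.volume_ball] at h1
  refine h1.trans (le_of_eq (lintegral_congr fun z => ?_))
  simp [indicator]

open MeasureTheory in
lemma area_lemma {k : ℂ → ℂ} {c : ℂ} {r : ℝ} (hr : 0 < r) (hk : DifferentiableOn ℂ k (ball c (2*r)))
    (hi : InjOn k (ball c (2*r))) {p q : ℂ} (hp : p ∈ ball c r) (hq : q ∈ ball c r) :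
    ENNReal.ofReal (‖k q - k p‖^2) ≤ 4 * volume (k '' ball c (2*r)) := by
  set B := ball c (2*r) with hB
  have hBo : IsOpen B := isOpen_ball
  have harea : ∫⁻ z in B, ‖(deriv k z)^2‖ₑ = volume (k '' B) := by
    rw [← lintegral_abs_det_fderiv_eq_addHaar_image volume measurableSet_ball
      (f' := fun z => (fderiv ℂ k z).restrictScalars ℝ)
      (fun z hz => ((hk.differentiableAt (hBo.mem_nhds hz)).hasFDerivAt.restrictScalars ℝ).hasFDerivWithinAt) hi]
    refine lintegral_congr fun z => ?_
    have : ((fderiv ℂ k z).restrictScalars ℝ).det = ‖deriv k z‖^2 := by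
      simp [ContinuousLinearMap.det, LinearMap.det_restrictScalars,
      Algebra.norm_complex_eq, Complex.normSq_eq_norm_sq]
    rw [this, abs_of_nonneg (by positivity), enorm_pow, ENNReal.ofReal_pow (norm_nonneg _), ofReal_norm]
  by_cases htop : volume (k '' B) = ⊤
  · rw [htop]; simp
  set a := (volume (k '' B)).toReal with ha
  have hder : ∀ z ∈ ball c r, ‖deriv k z‖^2 * (Real.pi * r^2) ≤ a := by
    intro z hz
    have hsub : ball z r ⊆ B := ball_subset_ball' (by rw [mem_ball] at hz; linarith)
    have h1 := mv_lint (f := fun z => (deriv k z)^2) (c := z) (R := r)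
      (((hk.deriv hBo).mono hsub).pow 2)
    have h2 := h1.trans (lintegral_mono_set hsub) |>.trans_eq harea
    rw [Complex.volume_ball] at h2
    have h3 := ENNReal.toReal_mono htop h2
    rw [ENNReal.toReal_mul] at h3
    simp only [ENNReal.toReal_mul, ENNReal.toReal_pow, toReal_enorm, norm_pow,
      ENNReal.toReal_ofReal hr.le, ENNReal.coe_toReal, NNReal.coe_real_pi] at h3
    rw [ha]
    linarith [mul_comm (r^2) Real.pi]
  have ha0 : 0 ≤ a := ENNReal.toReal_nonneg
  set C := Real.sqrt (a / (Real.pi * r^2)) with hC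
  have hpr : 0 < Real.pi * r^2 := by positivity
  have hder2 : ∀ z ∈ ball c r, ‖deriv k z‖ ≤ C := by
    intro z hz
    apply Real.le_sqrt_of_sq_le
    rw [le_div_iff₀ hpr]; exact hder z hz
  have hlip := (convex_ball c r).norm_image_sub_le_of_norm_deriv_le (f := k) (C := C)
    (fun z hz => hk.differentiableAt (hBo.mem_nhds (ball_subset_ball (by linarith) hz))) hder2 hp hq
  have hdist : ‖q - p‖ ≤ 2 * r := by
    rw [← dist_eq_norm]
    rw [mem_ball] at hp hq
    linarith [dist_triangle_right q p c]
  have hC0 : 0 ≤ C := Real.sqrt_nonneg _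
  have h5 : ‖k q - k p‖^2 ≤ 4 * a := by
    have h6 : ‖k q - k p‖ ≤ C * (2*r) := hlip.trans (by gcongr)
    have h7 : ‖k q - k p‖^2 ≤ (C * (2*r))^2 := by gcongr
    have h8 : C^2 = a / (Real.pi * r^2) := Real.sq_sqrt (by positivity)
    have h9 : (C * (2*r))^2 = 4 * a / Real.pi := by
      rw [mul_pow, h8]; field_simp; ring
    rw [h9] at h7
    refine h7.trans (div_le_self (by positivity) (by linarith [Real.pi_gt_three]))
  have : 4 * volume (k '' B) = ENNReal.ofReal (4 * a) := by
    rw [ENNReal.ofReal_mul (by norm_num), ha, ENNReal.ofReal_toReal htop]; simp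
  rw [this]
  exact ENNReal.ofReal_le_ofReal h5

end RC

namespace RC

/-- A polynomial-like model. -/
structure PM (g : ℂ → ℂ) (U P : Set ℂ) (φ ψ : ℂ → ℂ) (d : ℕ) : Prop where
  M : Mdl g U P φ ψ
  deg : HasDeg g U (ball 0 1) d
  two : 2 ≤ d
  fill : ∀ x, (∀ n, g^[n] x ∈ U) → x ∈ P

/-- Number of points of the `n`-th fibre over `w` in `S`. -/
def Nf (g : ℂ → ℂ) (U : Set ℂ) (n : ℕ) (w : ℂ) (S : Set ℂ) : ℕ := (Fib g U n w ∩ S).ncard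

/-- Comparison of fibres. -/
def Lk (g : ℂ → ℂ) (U : Set ℂ) (p q : ℂ) : Prop :=
  ∃ α : ℕ → ℝ, Tendsto α atTop (𝓝 0) ∧ ∀ n S η, 0 < η →
    (Nf g U n p S : ℝ) ≤ Nf g U n q (thickening η S) + α n / η ^ 2

section pm
variable {g : ℂ → ℂ} {U P : Set ℂ} {φ ψ : ℂ → ℂ} {d : ℕ} (H : PM g U P φ ψ d)
include H

lemma PM.back {x : ℂ} (hx : x ∈ U) (hg : g x ∈ P) : x ∈ P := by
  refine H.fill x fun n => ?_
  rcases n with _ | n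
  · exact hx
  · rw [iterate_succ_apply]; exact H.M.PU (H.M.iter_P hg)

lemma PM.F1 {w : ℂ} (hw : w ∈ ball 0 1 \ P) : (U ∩ g ⁻¹' {w}).ncard = d := by
  refine H.deg.2 w hw.1 ?_
  rintro ⟨c, hc, rfl⟩
  exact hw.2 (H.M.inv c (H.M.crit hc))

lemma PM.F1_fin {w : ℂ} (hw : w ∈ ball 0 1 \ P) : (U ∩ g ⁻¹' {w}).Finite :=
  finite_of_ncard_ne_zero (by rw [H.F1 hw]; have := H.two; omega)

lemma PM.F1_W {w x : ℂ} (hw : w ∈ ball 0 1 \ P) (hx : x ∈ U ∩ g ⁻¹' {w}) : x ∈ ball 0 1 \ P :=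
  ⟨H.M.sub hx.1, fun h => hw.2 (by have := H.M.inv x h; rwa [hx.2] at this)⟩

lemma PM.Fib_W {w x : ℂ} {n : ℕ} (hw : w ∈ ball 0 1 \ P) (hx : x ∈ Fib g U n w) :
    x ∈ ball 0 1 \ P :=
  H.M.Un_W hx.1 (by rw [hx.2]; exact hw.2)

lemma Fib_zero {w : ℂ} (hw : w ∈ ball (0:ℂ) 1) : Fib g U 0 w = {w} := by
  ext x; simp only [Fib, Un_zero, mem_ofPred_eq, iterate_zero, id, mem_singleton_iff]
  constructor
  · exact fun h => h.2
  · rintro rfl; exact ⟨hw, rfl⟩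

omit H in
lemma Fib_succ {w x : ℂ} {n : ℕ} : x ∈ Fib g U (n + 1) w ↔
    ∃ w' ∈ U ∩ g ⁻¹' {w}, x ∈ Fib g U n w' := by
  constructor
  · rintro ⟨h1, h2⟩
    rw [Un_succ_last] at h1
    rw [iterate_succ_apply'] at h2
    exact ⟨g^[n] x, ⟨h1.2, h2⟩, h1.1, rfl⟩
  · rintro ⟨w', ⟨h1, h2⟩, h3, rfl⟩
    exact ⟨Un_succ_last.2 ⟨h3, h1⟩, by rw [iterate_succ_apply']; exact h2⟩

lemma PM.Fib_fin {w : ℂ} (hw : w ∈ ball 0 1 \ P) (n : ℕ) : (Fib g U n w).Finite := by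
  induction n generalizing w with
  | zero => rw [Fib_zero H hw.1]; exact finite_singleton _
  | succ n ih =>
    have : Fib g U (n + 1) w = ⋃ w' ∈ U ∩ g ⁻¹' {w}, Fib g U n w' := by
      ext x; rw [Fib_succ]; simp only [mem_iUnion, exists_prop]
    rw [this]
    exact (H.F1_fin hw).biUnion fun w' h => ih (H.F1_W hw h)

lemma PM.Nf_succ {w : ℂ} (hw : w ∈ ball 0 1 \ P) (n : ℕ) (S : Set ℂ) :
    Nf g U (n + 1) w S = ∑ w' ∈ (H.F1_fin hw).toFinset, Nf g U n w' S := by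
  classical
  have hf := (H.Fib_fin hw (n + 1)).inter_of_left S
  rw [Nf, ncard_eq_toFinset_card _ hf, Finset.card_eq_sum_card_fiberwise (f := g^[n])
    (t := (H.F1_fin hw).toFinset)]
  · refine Finset.sum_congr rfl fun w' h => ?_
    rw [Finite.mem_toFinset] at h
    rw [Nf, ← ncard_coe_finset]
    congr 1
    ext x
    simp only [Finset.coe_filter, Finite.mem_toFinset, mem_ofPred_eq, mem_inter_iff, Fib_succ]
    constructor
    · rintro ⟨⟨⟨w'', h1, h2⟩, h3⟩, rfl⟩
      have := h2.2
      exact ⟨by rwa [this], h3⟩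
    · rintro ⟨h1, h2⟩
      exact ⟨⟨⟨w', h, h1⟩, h2⟩, h1.2⟩
  · intro x hx
    rw [Finset.mem_coe, Finite.mem_toFinset] at hx ⊢
    obtain ⟨w', h1, h2⟩ := Fib_succ.1 hx.1
    rwa [h2.2]

lemma PM.F1_card {w : ℂ} (hw : w ∈ ball 0 1 \ P) : (H.F1_fin hw).toFinset.card = d := by
  rw [← ncard_eq_toFinset_card _ (H.F1_fin hw), H.F1 hw]

lemma PM.Nf_univ {w : ℂ} (hw : w ∈ ball 0 1 \ P) (n : ℕ) : Nf g U n w univ = d ^ n := by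
  induction n generalizing w with
  | zero => simp [Nf, Fib_zero H hw.1]
  | succ n ih =>
    rw [H.Nf_succ hw, Finset.sum_congr rfl (fun w' h => ih (H.F1_W hw
      ((H.F1_fin hw).mem_toFinset.1 h))), Finset.sum_const,
      H.F1_card, smul_eq_mul, pow_succ, mul_comm]
    exact hw

lemma PM.Nf_mono {w : ℂ} (hw : w ∈ ball 0 1 \ P) (n : ℕ) {S T : Set ℂ} (h : S ⊆ T) :
    Nf g U n w S ≤ Nf g U n w T :=
  ncard_le_ncard (inter_subset_inter_right _ h) ((H.Fib_fin hw n).inter_of_left T)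

lemma PM.vol_tendsto : Tendsto (fun n => MeasureTheory.volume (Un g U n \ P)) atTop (𝓝 0) := by
  have h := MeasureTheory.tendsto_measure_iInter_atTop (μ := MeasureTheory.volume)
    (s := fun n => Un g U n \ P)
    (fun n => ((H.M.Un_open n).sdiff H.M.Pc.isClosed).measurableSet.nullMeasurableSet)
    (fun m n h => sdiff_subset_sdiff_left (Un_mono h))
    ⟨0, ((MeasureTheory.measure_mono (sdiff_subset.trans Un_sub_ball)).trans_lt
      MeasureTheory.measure_ball_lt_top).ne⟩
  have : ⋂ n, (Un g U n \ P) = ∅ := by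
    rw [eq_empty_iff_forall_notMem]
    intro x hx
    rw [mem_iInter] at hx
    exact (hx 0).2 (H.fill x fun n => (hx (n + 1)).1.2 n (Nat.lt_succ_self n))
  rwa [this, MeasureTheory.measure_empty] at h

omit H in
lemma Lk.trans {p q r : ℂ} (h1 : Lk g U p q) (h2 : Lk g U q r)
    (hm : ∀ n S T, S ⊆ T → Nf g U n r S ≤ Nf g U n r T) : Lk g U p r := by
  obtain ⟨α, hα, h1⟩ := h1
  obtain ⟨β, hβ, h2⟩ := h2
  refine ⟨fun n => 4 * (α n + β n), by simpa using (hα.add hβ).const_mul 4, fun n S η hη => ?_⟩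
  have e1 := h1 n S (η / 2) (half_pos hη)
  have e2 := h2 n (thickening (η / 2) S) (η / 2) (half_pos hη)
  have e3 := hm n _ _ (thickening_thickening_subset (η / 2) (η / 2) S)
  rw [add_halves] at e3
  have e3' : (Nf g U n r (thickening (η / 2) (thickening (η / 2) S)) : ℝ) ≤
    Nf g U n r (thickening η S) := by exact_mod_cast e3
  have e4 : 4 * (α n + β n) / η ^ 2 = α n / (η / 2) ^ 2 + β n / (η / 2) ^ 2 := by
    field_simp; ring
  show _ ≤ _ + 4 * (α n + β n) / η ^ 2
  linarith

end pm
end RC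

namespace RC

section br
variable {g : ℂ → ℂ} {U P : Set ℂ} {φ ψ : ℂ → ℂ} (M : Mdl g U P φ ψ)
include M

lemma Mdl.Br_deriv {n : ℕ} {D : Set ℂ} (hD : IsOpen D) {k : ℂ → ℂ} (hk : Br g U n D k) {z : ℂ}
    (hz : z ∈ D) : deriv g^[n] (k z) ≠ 0 := by
  have h1 : HasDerivAt g^[n] (deriv g^[n] (k z)) (k z) :=
    ((M.iter_diff n).differentiableAt ((M.Un_open n).mem_nhds (hk.2 z hz).1)).hasDerivAt
  have h2 := (hk.1.differentiableAt (hD.mem_nhds hz)).hasDerivAt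
  have h3 := h1.comp z h2
  have h4 : g^[n] ∘ k =ᶠ[𝓝 z] id := by
    filter_upwards [hD.mem_nhds hz] with w hw using (hk.2 w hw).2
  have h5 := h3.unique ((hasDerivAt_id z).congr_of_eventuallyEq h4)
  intro h; rw [h] at h5; simp at h5

lemma Mdl.br_unique {n : ℕ} {D : Set ℂ} (hDo : IsOpen D) (hDp : IsPreconnected D)
    {k₁ k₂ : ℂ → ℂ} (h₁ : Br g U n D k₁) (h₂ : Br g U n D k₂) {c : ℂ} (hc : c ∈ D)
    (h : k₁ c = k₂ c) : EqOn k₁ k₂ D := by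
  refine lift_unique hDp (M.Un_open n) (M.iter_diff n) h₁.1.continuousOn h₂.1.continuousOn
    (fun z hz => (h₁.2 z hz).1) (fun z hz => M.Br_deriv hDo h₁ hz) (fun z hz => ?_) hc h
  rw [(h₁.2 z hz).2, (h₂.2 z hz).2]

lemma Mdl.br_disj {n : ℕ} {D : Set ℂ} (hDo : IsOpen D) (hDp : IsPreconnected D)
    {k₁ k₂ : ℂ → ℂ} (h₁ : Br g U n D k₁) (h₂ : Br g U n D k₂) {c : ℂ} (hc : c ∈ D)
    (h : k₁ c ≠ k₂ c) : Disjoint (k₁ '' D) (k₂ '' D) := by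
  rw [Set.disjoint_left]
  rintro _ ⟨z, hz, rfl⟩ ⟨w, hw, e⟩
  have h3 := (h₁.2 z hz).2
  rw [← e, (h₂.2 w hw).2] at h3
  subst h3
  exact h (M.br_unique hDo hDp h₁ h₂ hz e.symm hc)

omit M in
lemma Br.injOn {n : ℕ} {D : Set ℂ} {k : ℂ → ℂ} (h : Br g U n D k) : InjOn k D := by
  intro z hz w hw e
  rw [← (h.2 z hz).2, e, (h.2 w hw).2]

end br

section pm
variable {g : ℂ → ℂ} {U P : Set ℂ} {φ ψ : ℂ → ℂ} {d : ℕ} (H : PM g U P φ ψ d)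
include H

lemma PM.Lk_loc {c : ℂ} {r : ℝ} (hr : 0 < r) (hB : ball c (2 * r) ⊆ ball 0 1 \ P) {p q : ℂ}
    (hp : p ∈ ball c r) (hq : q ∈ ball c r) : Lk g U p q := by
  classical
  have hsub : ball c r ⊆ ball c (2 * r) := ball_subset_ball (by linarith)
  have hfin : ∀ n, MeasureTheory.volume (Un g U n \ P) ≠ ⊤ := fun n =>
    ((MeasureTheory.measure_mono (sdiff_subset.trans Un_sub_ball)).trans_lt
      MeasureTheory.measure_ball_lt_top).ne
  refine ⟨fun n => 4 * (MeasureTheory.volume (Un g U n \ P)).toReal, ?_, fun n S η hη => ?_⟩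
  · have := (ENNReal.tendsto_toReal ENNReal.zero_ne_top).comp H.vol_tendsto
    simpa using this.const_mul 4
  have hW : ∀ z ∈ ball c r, z ∈ ball 0 1 \ P := fun z hz => hB (hsub hz)
  have hex : ∀ x ∈ Fib g U n p, ∃ k, Br g U n (ball c (2 * r)) k ∧ k p = x := fun x hx =>
    H.M.branch_exists isOpen_ball (convex_ball _ _) hB (hsub hp) hx
  choose! k hk hkp using hex
  have hpre : IsPreconnected (ball c (2 * r)) := (convex_ball _ _).isPreconnected
  set F : Finset ℂ := ((H.Fib_fin (hW p hp) n).inter_of_left S).toFinset with hF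
  have hFm : ∀ x, x ∈ F ↔ x ∈ Fib g U n p ∧ x ∈ S := fun x => by
    rw [hF, Finite.mem_toFinset]; rfl
  have hcard : Nf g U n p S = F.card := ncard_eq_toFinset_card _ _
  have hinj : InjOn (fun x => k x q) (Fib g U n p) := by
    intro x hx y hy e
    have := H.M.br_unique isOpen_ball hpre (hk x hx) (hk y hy) (hsub hq) e (hsub hp)
    rwa [hkp x hx, hkp y hy] at this
  set G := F.filter fun x => dist (k x q) x < η with hG
  set B := F.filter fun x => ¬ dist (k x q) x < η with hBd
  have hsum : G.card + B.card = F.card := Finset.card_filter_add_card_filter_not _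
  have hGc : G.card ≤ Nf g U n q (thickening η S) := by
    rw [← ncard_coe_finset]
    refine ncard_le_ncard_of_injOn (fun x => k x q) ?_ ?_
      ((H.Fib_fin (hW q hq) n).inter_of_left _)
    · intro x hx
      rw [Finset.mem_coe, hG, Finset.mem_filter, hFm] at hx
      refine ⟨(hk x hx.1.1).2 q (hsub hq), ?_⟩
      rw [mem_thickening_iff]
      exact ⟨x, hx.1.2, hx.2⟩
    · refine hinj.mono fun x hx => ?_
      rw [Finset.mem_coe, hG, Finset.mem_filter, hFm] at hx
      exact hx.1.1
  have hBm : ∀ x ∈ B, x ∈ Fib g U n p ∧ η ≤ dist (k x q) x := fun x hx => by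
    rw [hBd, Finset.mem_filter, hFm] at hx
    exact ⟨hx.1.1, not_lt.1 hx.2⟩
  have hBc : (B.card : ENNReal) * ENNReal.ofReal (η ^ 2) ≤
      4 * MeasureTheory.volume (Un g U n \ P) := by
    calc (B.card : ENNReal) * ENNReal.ofReal (η ^ 2) = ∑ x ∈ B, ENNReal.ofReal (η ^ 2) := by
          rw [Finset.sum_const, nsmul_eq_mul]
      _ ≤ ∑ x ∈ B, 4 * MeasureTheory.volume (k x '' ball c (2 * r)) := by
          refine Finset.sum_le_sum fun x hx => ?_
          obtain ⟨h1, h2⟩ := hBm x hx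
          refine le_trans (ENNReal.ofReal_le_ofReal ?_)
            (area_lemma hr (hk x h1).1 (hk x h1).injOn hp hq)
          rw [hkp x h1, ← dist_eq_norm]
          gcongr
      _ = 4 * MeasureTheory.volume (⋃ x ∈ B, k x '' ball c (2 * r)) := by
          rw [← Finset.mul_sum, MeasureTheory.measure_biUnion_finset]
          · intro x hx y hy hxy
            refine H.M.br_disj isOpen_ball hpre (hk x (hBm x hx).1) (hk y (hBm y hy).1) (hsub hp) ?_
            rw [hkp x (hBm x hx).1, hkp y (hBm y hy).1]; exact hxy
          · intro x hx
            exact isOpen_ball.measurableSet.image_of_continuousOn_injOn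
              (hk x (hBm x hx).1).1.continuousOn (hk x (hBm x hx).1).injOn
      _ ≤ _ := by
          gcongr
          refine iUnion₂_subset fun x hx => ?_
          rintro _ ⟨z, hz, rfl⟩
          have h := (hk x (hBm x hx).1).2 z hz
          exact ⟨h.1, (H.M.Un_W h.1 (by rw [h.2]; exact (hB hz).2)).2⟩
  have hBr : (B.card : ℝ) * η ^ 2 ≤ 4 * (MeasureTheory.volume (Un g U n \ P)).toReal := by
    have := ENNReal.toReal_mono (ENNReal.mul_ne_top (by simp) (hfin n)) hBc
    rwa [ENNReal.toReal_mul, ENNReal.toReal_mul, ENNReal.toReal_ofReal (by positivity),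
      ENNReal.toReal_natCast, ENNReal.toReal_ofNat] at this
  have hfinal : (B.card : ℝ) ≤ 4 * (MeasureTheory.volume (Un g U n \ P)).toReal / η ^ 2 := by
    rwa [le_div_iff₀ (by positivity)]
  have : (G.card : ℝ) ≤ Nf g U n q (thickening η S) := by exact_mod_cast hGc
  have h2 : (G.card : ℝ) + B.card = F.card := by exact_mod_cast hsum
  rw [hcard]
  linarith

lemma PM.Lk_all {p q : ℂ} (hp : p ∈ ball 0 1 \ P) (hq : q ∈ ball 0 1 \ P) : Lk g U p q := by
  have := H.M.Wc.induction₂' (fun x y => Lk g U x y) ?_ ?_ hp hq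
  · exact this
  · intro x hx
    obtain ⟨ε, hε, hb⟩ := Metric.isOpen_iff.1 H.M.Wo x hx
    have h2 : ball x (2 * (ε / 2)) ⊆ ball 0 1 \ P := by rwa [mul_div_cancel₀ _ two_ne_zero]
    filter_upwards [mem_nhdsWithin_of_mem_nhds (ball_mem_nhds x (half_pos hε))] with y hy
    exact ⟨H.Lk_loc (half_pos hε) h2 (mem_ball_self (half_pos hε)) hy,
      H.Lk_loc (half_pos hε) h2 hy (mem_ball_self (half_pos hε))⟩
  · intro x y z hx hy hz h1 h2
    exact h1.trans h2 fun n S T h => H.Nf_mono hz n h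
end pm
end RC

namespace RC

section pm
variable {g : ℂ → ℂ} {U P : Set ℂ} {φ ψ : ℂ → ℂ} {d : ℕ} (H : PM g U P φ ψ d)
include H

lemma PM.J_acc {y w₀ : ℂ} (hy : y ∈ frontier P) (hw₀ : w₀ ∈ ball 0 1 \ P) : y ∈ Acc g U w₀ := by
  have hyP : y ∈ P := H.M.Pc.isClosed.frontier_subset hy
  have hyb : y ∈ ball (0:ℂ) 1 := H.M.sub (H.M.PU hyP)
  by_contra hcon
  have h1 : y ∉ closure (Acc g U w₀) := fun h => hcon (H.M.acc_closed h hyb)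
  have h2 : (closure (Acc g U w₀))ᶜ ∩ ball 0 1 ∈ 𝓝 y :=
    inter_mem (isClosed_closure.isOpen_compl.mem_nhds h1) (isOpen_ball.mem_nhds hyb)
  obtain ⟨ε, hε, hεs⟩ := Metric.nhds_basis_closedBall.mem_iff.1 h2
  obtain ⟨O, hOo, hPO, hOU, hOc⟩ := exists_open_between_and_isCompact_closure H.M.Pc H.M.o H.M.PU
  have hopen : IsOpen (U ∩ g ⁻¹' O) := H.M.holo.continuousOn.isOpen_inter_preimage H.M.o hOo
  obtain ⟨N, hN⟩ := H.M.compact_avoid hw₀ (X := closure O \ (U ∩ g ⁻¹' O)) (hOc.diff hopen)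
    (fun x hx => ⟨H.M.sub (hOU hx.1), fun hxP => hx.2 ⟨H.M.PU hxP, hPO (H.M.inv x hxP)⟩⟩)
    (isCompact_closedBall y ε) (fun x hx => (hεs hx).2)
    (Set.disjoint_left.2 fun x hx hA => (hεs hx).1 (subset_closure hA))
  have hev : ∀ᶠ x in 𝓝 y, ∀ i ∈ Finset.range (N + 1), g^[i] x ∈ O := by
    rw [Filter.eventually_all_finset]
    intro i _
    have ho : IsOpen (Un g U i ∩ g^[i] ⁻¹' O) :=
      (H.M.iter_diff i).continuousOn.isOpen_inter_preimage (H.M.Un_open i) hOo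
    filter_upwards [ho.mem_nhds ⟨H.M.P_Un hyP, hPO (H.M.iter_P hyP)⟩] with x hx using hx.2
  have hcl : y ∈ closure Pᶜ := by
    rw [frontier_eq_closure_inter_closure] at hy; exact hy.2
  obtain ⟨x, ⟨hx1, hx2⟩, hxP⟩ := mem_closure_iff_nhds.1 hcl _
    (inter_mem hev (closedBall_mem_nhds y hε))
  have hex : ∃ n, g^[n] x ∉ O := by
    by_contra hc
    push Not at hc
    exact hxP (H.fill x fun n => hOU (subset_closure (hc n)))
  classical
  have hlt := Nat.find_spec hex
  have hmin : ∀ i < Nat.find hex, g^[i] x ∈ O := fun i hi => not_not.1 (Nat.find_min hex hi)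
  have hgt : N < Nat.find hex := by
    by_contra hc
    exact hlt (hx1 _ (Finset.mem_range.2 (by omega)))
  obtain ⟨n, hn⟩ : ∃ n, Nat.find hex = n + 1 := ⟨Nat.find hex - 1, by omega⟩
  rw [hn] at hlt hmin hgt
  refine hN n (by omega) x hx2 ⟨(hεs hx2).2, fun i hi => hOU (subset_closure (hmin i (by omega)))⟩
    ⟨subset_closure (hmin n (by omega)), fun hc => hlt ?_⟩
  rw [iterate_succ_apply']; exact hc.2

/-- Positive mass near points of the Julia set. -/
lemma PM.mass {y w : ℂ} (hy : y ∈ frontier P) (hw : w ∈ ball 0 1 \ P) {ε : ℝ} (hε : 0 < ε) :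
    ∃ p > 0, ∃ n₀, ∀ n ≥ n₀, p * (d : ℝ) ^ n ≤ Nf g U n w (ball y ε) := by
  classical
  set F := (H.F1_fin hw).toFinset with hF
  have hFW : ∀ w' ∈ F, w' ∈ ball 0 1 \ P := fun w' h =>
    H.F1_W hw ((H.F1_fin hw).mem_toFinset.1 h)
  have hL : ∀ w' ∈ F, Lk g U w w' := fun w' h => H.Lk_all hw (hFW w' h)
  choose! α hα hLk using hL
  set η := ε / 2 with hη
  have hη0 : 0 < η := half_pos hε
  have hev : ∀ᶠ n in atTop, ∀ w' ∈ F, α w' n < η ^ 2 / 288 := by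
    rw [Filter.eventually_all_finset]
    intro w' h
    exact (hα w' h).eventually (gt_mem_nhds (by positivity))
  obtain ⟨N, hN⟩ := eventually_atTop.1 hev
  obtain ⟨m, hm, x, hx, hxy⟩ := (H.J_acc hy hw).2 η hη0 N
  have hd2 : (2:ℝ) ≤ d := by exact_mod_cast H.two
  have key : ∀ k : ℕ, (d:ℝ) ^ k * (1 / 2 + 1 / 2 * (8 / 9) ^ k) ≤
      Nf g U (m + k) w (thickening (η * (1 - (3 / 4) ^ k)) (ball y η) ∪ ball y η) := by
    intro k
    induction k with
    | zero =>
      have h0 : 0 < Nf g U (m + 0) w (thickening (η * (1 - (3 / 4) ^ 0)) (ball y η) ∪ ball y η) := by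
        refine (Set.ncard_pos ((H.Fib_fin hw m).inter_of_left _)).2 ⟨x, hx, Or.inr hxy⟩
      have : (1:ℝ) ≤ Nf g U (m + 0) w (thickening (η * (1 - (3 / 4) ^ 0)) (ball y η) ∪ ball y η) := by
        exact_mod_cast h0
      norm_num at this ⊢
      exact this
    | succ k ih =>
      set S := thickening (η * (1 - (3 / 4) ^ k)) (ball y η) ∪ ball y η with hS
      set T := thickening (η * (1 - (3 / 4) ^ (k + 1))) (ball y η) ∪ ball y η with hT
      set e := η * (1 / 4 * (3 / 4) ^ k) with he
      have he0 : 0 < e := by positivity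
      have hST : thickening e S ⊆ T := by
        rw [hS, thickening_union]
        have h34 : (3/4:ℝ) ^ k ≤ 1 := pow_le_one₀ (by norm_num) (by norm_num)
        refine subset_trans (union_subset ?_ ?_) subset_union_left
        · refine (thickening_thickening_subset _ _ _).trans (thickening_mono (le_of_eq ?_) _)
          rw [he, pow_succ]; ring
        · refine thickening_mono ?_ _
          rw [he, pow_succ]; nlinarith
      rw [show m + (k + 1) = (m + k) + 1 by ring, H.Nf_succ hw]
      push_cast
      have hterm : ∀ w' ∈ F, (d:ℝ) ^ k * (1 / 2 + 1 / 2 * (8 / 9) ^ (k + 1)) ≤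
          Nf g U (m + k) w' T := by
        intro w' h
        have h1 := hLk w' h (m + k) S e he0
        have h2 : (Nf g U (m + k) w' (thickening e S) : ℝ) ≤ Nf g U (m + k) w' T := by
          exact_mod_cast H.Nf_mono (hFW w' h) _ hST
        have h3 := hN (m + k) (by omega) w' h
        have h4 : α w' (m + k) / e ^ 2 ≤ 1 / 18 * (16 / 9) ^ k := by
          rw [div_le_iff₀ (by positivity)]
          have : (1 / 18 * (16 / 9 : ℝ) ^ k) * e ^ 2 = η ^ 2 / 288 * ((16/9) * (3/4) ^ 2) ^ k := by
            rw [he, mul_pow, mul_pow, mul_pow, ← pow_mul, ← pow_mul, mul_comm 2 k]; ring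
          rw [this]; norm_num; exact h3.le
        have h5 : (16 / 9 : ℝ) ^ k ≤ d ^ k * (8 / 9) ^ k := by
          rw [← mul_pow]
          exact pow_le_pow_left₀ (by norm_num) (by linarith) k
        rw [pow_succ (8/9:ℝ)]
        nlinarith
      calc (d:ℝ) ^ (k + 1) * (1 / 2 + 1 / 2 * (8 / 9) ^ (k + 1))
          = ∑ w' ∈ F, (d:ℝ) ^ k * (1 / 2 + 1 / 2 * (8 / 9) ^ (k + 1)) := by
            rw [Finset.sum_const, hF, H.F1_card hw, nsmul_eq_mul, pow_succ]; ring
        _ ≤ _ := Finset.sum_le_sum hterm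
  have hd0 : (0:ℝ) < d := by linarith
  refine ⟨1 / 2 / (d:ℝ) ^ m, by positivity, m, fun n hn => ?_⟩
  obtain ⟨k, rfl⟩ := Nat.exists_eq_add_of_le hn
  have h1 : 1 / 2 / (d:ℝ) ^ m * d ^ (m + k) = d ^ k * (1 / 2) := by
    rw [pow_add]; field_simp
  have h2 : thickening (η * (1 - (3 / 4) ^ k)) (ball y η) ∪ ball y η ⊆ ball y ε := by
    refine union_subset ?_ (ball_subset_ball (by linarith))
    refine (thickening_mono (δ₂ := η) ?_ _).trans ?_
    · have : (0:ℝ) < (3/4) ^ k := by positivity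
      nlinarith
    · rw [thickening_ball hη0 hη0, hη, add_halves]
  have h3 : (Nf g U (m + k) w (thickening (η * (1 - (3 / 4) ^ k)) (ball y η) ∪ ball y η) : ℝ) ≤
    Nf g U (m + k) w (ball y ε) := by exact_mod_cast H.Nf_mono hw _ h2
  rw [h1]
  refine le_trans ?_ ((key k).trans h3)
  gcongr
  have : (0:ℝ) < (8/9) ^ k := by positivity
  linarith

end pm
end RC

namespace RC

/-- Asymptotic mass near `e` is at most `t`. -/
def At (g : ℂ → ℂ) (U : Set ℂ) (d : ℕ) (w e : ℂ) (t : ℝ) : Prop :=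
  ∃ η > 0, ∀ᶠ n in atTop, (Nf g U n w (ball e η) : ℝ) ≤ t * (d : ℝ) ^ n

section pm
variable {g : ℂ → ℂ} {U P : Set ℂ} {φ ψ : ℂ → ℂ} {d : ℕ} (H : PM g U P φ ψ d)
include H

lemma PM.contr {c : ℂ} {r ε : ℝ} (hr : 0 < r) (hε : 0 < ε) 
    (hw : ∃ w ∈ ball c r, w ∉ P) : ∃ N, ∀ n ≥ N, ∀ k, Br g U n (ball c r) k →
      ∀ z ∈ ball c (r / 2), dist (k z) (k c) < ε := by
  by_contra hcon
  push Not at hcon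
  choose n hn k hk z hz hd using hcon
  obtain ⟨k', h1, h2, h3, h4⟩ := bad_limit hr hε (fun j => (hk j).1)
    (fun j z hz => (hk j).bdd hz) hz hd
  have hF : ∀ N, ∀ᶠ j in (hyperfilter ℕ : Filter ℕ), N < n j := fun N => by
    filter_upwards [Nat.hyperfilter_le_atTop (eventually_gt_atTop N)] with j hj
    exact hj.trans_le (hn j)
  have hbU : ∀ x ∈ ball c r, ∀ N ∈ 𝓝 x, ∀ᶠ j in (hyperfilter ℕ : Filter ℕ),
      k' x ∈ Un g U (n j) ∧ g^[n j] (k' x) ∈ N := by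
    intro x hx N hN
    filter_upwards [hurwitz isOpen_ball (fun j => (hk j).1) h1 hx (h4 x hx)
      (inter_mem hN (isOpen_ball.mem_nhds hx))] with j hj
    obtain ⟨w, ⟨hwN, hwB⟩, hw⟩ := hj
    rw [← hw, ((hk j).2 w hwB).2]
    exact ⟨((hk j).2 w hwB).1, hwN⟩
  have hUn : ∀ x ∈ ball c r, ∀ N, k' x ∈ Un g U N := by
    intro x hx N
    obtain ⟨j, hj1, hj2⟩ := ((hF N).and (hbU x hx univ univ_mem)).exists
    exact Un_mono hj1.le hj2.1
  obtain ⟨w, hwb, hwP⟩ := hw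
  have h5 : k' w ∈ P := H.fill _ fun n => (hUn w hwb (n + 1)).2 n (Nat.lt_succ_self n)
  obtain ⟨j, hj⟩ := (hbU w hwb Pᶜ (H.M.Pc.isClosed.isOpen_compl.mem_nhds hwP)).exists
  exact hj.2 (H.M.iter_P h5)

lemma PM.crit_fin : (critPts g U).Finite := by
  by_contra hinf
  obtain ⟨z, hz, hacc⟩ := Set.Infinite.exists_accPt_of_subset_isCompact hinf H.M.Pc H.M.crit
  have han : AnalyticOnNhd ℂ (deriv g) U := (H.M.holo.analyticOnNhd H.M.o).deriv
  have hfr : ∃ᶠ w in 𝓝[≠] z, deriv g w = 0 := by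
    rw [accPt_iff_frequently_nhdsNE] at hacc
    exact hacc.mono fun w hw => hw.2
  have heq := han.eqOn_zero_of_preconnected_of_frequently_eq_zero H.M.U_conn (H.M.PU hz) hfr
  have hUP : U = P := subset_antisymm (fun x hx => H.M.crit ⟨hx, heq hx⟩) H.M.PU
  have hcl : IsClopen U := ⟨by rw [hUP]; exact H.M.Pc.isClosed, H.M.o⟩
  exact H.M.U_ne (hcl.eq_univ (H.M.Pne.mono H.M.PU))

lemma PM.At_gen {e w : ℂ} {t : ℝ} {b : ℕ} (hw : w ∈ ball 0 1 \ P) (he : e ∈ P)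
    (hb : ∃ η₁ > 0, ∃ η₂ > 0, ∀ v ∈ ball 0 1 \ P, v ∈ ball (g e) η₂ →
      ((U ∩ g ⁻¹' {v}) ∩ ball e η₁).ncard ≤ b)
    (hA : At g U d w (g e) t) : At g U d w e (b / d * t) := by
  classical
  obtain ⟨η₁, hη₁, η₂, hη₂, hb⟩ := hb
  obtain ⟨η, hη, hev⟩ := hA
  have hcont : g ⁻¹' ball (g e) (min η η₂) ∩ U ∈ 𝓝 e :=
    inter_mem ((H.M.holo.continuousOn.continuousAt (H.M.o.mem_nhds (H.M.PU he))).preimage_mem_nhds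
      (ball_mem_nhds _ (by positivity))) (H.M.o.mem_nhds (H.M.PU he))
  obtain ⟨δ, hδ, hδs⟩ := Metric.mem_nhds_iff.1 hcont
  refine ⟨min δ η₁, by positivity, ?_⟩
  have hd0 : (d:ℝ) ≠ 0 := by have := H.two; positivity
  suffices h : ∀ᶠ n in atTop, (Nf g U (n + 1) w (ball e (min δ η₁)) : ℝ) ≤
      b / d * t * (d:ℝ) ^ (n + 1) by
    obtain ⟨N, hN⟩ := eventually_atTop.1 h
    refine eventually_atTop.2 ⟨N + 1, fun n hn => ?_⟩
    obtain ⟨m, rfl⟩ : ∃ m, n = m + 1 := ⟨n - 1, by omega⟩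
    exact hN m (by omega)
  filter_upwards [hev] with n hn
  have key : Nf g U (n + 1) w (ball e (min δ η₁)) ≤ b * Nf g U n w (ball (g e) η) := by
    have f1 := (H.Fib_fin hw (n + 1)).inter_of_left (ball e (min δ η₁))
    have f2 := (H.Fib_fin hw n).inter_of_left (ball (g e) η)
    rw [Nf, Nf, ncard_eq_toFinset_card _ f1, ncard_eq_toFinset_card _ f2]
    have hmem : ∀ x ∈ Fib g U (n + 1) w ∩ ball e (min δ η₁),
        x ∈ U ∧ g x ∈ Fib g U n w ∧ g x ∈ ball (g e) (min η η₂) ∧ x ∈ ball e η₁ := by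
      rintro x ⟨⟨hx1, hx2⟩, hx3⟩
      rw [H.M.Un_succ] at hx1
      rw [iterate_succ_apply] at hx2
      exact ⟨hx1.1, ⟨hx1.2, hx2⟩, (hδs (ball_subset_ball (min_le_left _ _) hx3)).1,
        ball_subset_ball (min_le_right _ _) hx3⟩
    refine Finset.card_le_mul_card_image_of_maps_to (f := g) ?_ b ?_
    · intro x hx
      rw [Finite.mem_toFinset] at hx ⊢
      obtain ⟨h1, h2, h3, h4⟩ := hmem x hx
      exact ⟨h2, ball_subset_ball (min_le_left _ _) h3⟩
    · intro v hv
      rw [Finite.mem_toFinset] at hv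
      have hvW := H.Fib_W hw hv.1
      rw [← ncard_coe_finset]
      by_cases hv2 : v ∈ ball (g e) η₂
      · refine le_trans (ncard_le_ncard ?_ ((H.F1_fin hvW).inter_of_left _)) (hb v hvW hv2)
        intro x hx
        rw [Finset.mem_coe, Finset.mem_filter, Finite.mem_toFinset] at hx
        obtain ⟨h1, h2, h3, h4⟩ := hmem x hx.1
        exact ⟨⟨h1, hx.2⟩, h4⟩
      · refine le_of_eq_of_le ?_ (Nat.zero_le b)
        rw [ncard_coe_finset, Finset.card_eq_zero, Finset.filter_eq_empty_iff]
        rintro x hx rfl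
        rw [Finite.mem_toFinset] at hx
        exact hv2 (ball_subset_ball (min_le_right _ _) (hmem x hx).2.2.1)
  have key' : (Nf g U (n + 1) w (ball e (min δ η₁)) : ℝ) ≤ b * Nf g U n w (ball (g e) η) := by
    exact_mod_cast key
  calc (Nf g U (n + 1) w (ball e (min δ η₁)) : ℝ) ≤ b * Nf g U n w (ball (g e) η) := key'
    _ ≤ b * (t * (d:ℝ) ^ n) := by gcongr
    _ = b / d * t * (d:ℝ) ^ (n + 1) := by rw [pow_succ]; field_simp

lemma PM.At_one {e w : ℂ} (hw : w ∈ ball 0 1 \ P) : At g U d w e 1 := by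
  refine ⟨1, one_pos, Eventually.of_forall fun n => ?_⟩
  have := H.Nf_mono hw n (subset_univ (ball e 1))
  rw [H.Nf_univ hw] at this
  rw [one_mul]; exact_mod_cast this

lemma PM.At_b {e w : ℂ} {t : ℝ} (hw : w ∈ ball 0 1 \ P) (he : e ∈ P)
    (hA : At g U d w (g e) t) : At g U d w e t := by
  have hd0 : (d:ℝ) ≠ 0 := by have := H.two; positivity
  have := H.At_gen (b := d) hw he ⟨1, one_pos, 1, one_pos, fun v hv _ => ?_⟩ hA
  · rwa [div_self hd0, one_mul] at this
  · rw [← H.F1 hv]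
    exact ncard_le_ncard inter_subset_left (H.F1_fin hv)

lemma PM.At_c {e w : ℂ} {t : ℝ} (hw : w ∈ ball 0 1 \ P) (he : e ∈ P)
    (hT : ∃ e' ∈ U, g e' = g e ∧ e' ≠ e)
    (hA : At g U d w (g e) t) : At g U d w e (((d - 1 : ℕ) : ℝ) / d * t) := by
  obtain ⟨e', he', hge, hne⟩ := hT
  have hdist : 0 < dist e' e := dist_pos.2 hne
  have ho : IsOpen (g '' (U ∩ ball e' (dist e' e / 2))) :=
    H.M.isOpenMap _ inter_subset_left (H.M.o.inter isOpen_ball)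
  obtain ⟨η₂, hη₂, hs⟩ := Metric.isOpen_iff.1 ho (g e)
    ⟨e', ⟨he', mem_ball_self (half_pos hdist)⟩, hge⟩
  refine H.At_gen (b := d - 1) hw he ⟨dist e' e / 2, half_pos hdist, η₂, hη₂, fun v hv hv2 => ?_⟩ hA
  obtain ⟨x, ⟨hxU, hxb⟩, hxv⟩ := hs hv2
  have hlt : ((U ∩ g ⁻¹' {v}) ∩ ball e (dist e' e / 2)).ncard < (U ∩ g ⁻¹' {v}).ncard := by
    refine ncard_lt_ncard ⟨inter_subset_left, fun h => ?_⟩ (H.F1_fin hv)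
    have := (h ⟨hxU, hxv⟩).2
    rw [mem_ball] at this hxb
    rw [dist_comm] at hxb
    linarith [dist_triangle e' x e]
  rw [H.F1 hv] at hlt
  omega

lemma PM.tot_crit {e : ℂ} (he : e ∈ P) (hT : ¬ ∃ e' ∈ U, g e' = g e ∧ e' ≠ e) :
    e ∈ critPts g U := by
  by_contra hc
  push Not at hT
  have heU := H.M.PU he
  have h1 : g e ∉ g '' critPts g U := by
    rintro ⟨c, hcc, hce⟩
    exact hc (hT c hcc.1 hce ▸ hcc)
  have h2 := H.deg.2 (g e) (H.M.maps heU) h1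
  have h3 : U ∩ g ⁻¹' {g e} = {e} := by
    ext x; constructor
    · rintro ⟨hx, hxe⟩; exact hT x hx hxe
    · rintro rfl; exact ⟨heU, rfl⟩
  rw [h3, ncard_singleton] at h2
  have := H.two; omega

lemma PM.super {z : ℂ} (hz : z ∈ P) {p : ℕ} (hp : 1 ≤ p) (hper : g^[p] z = z) (hc : deriv g z = 0) :
    z ∈ interior P := by
  have hzU := H.M.P_Un (n := p) hz
  have hd : HasDerivAt g^[p] 0 z := by
    obtain ⟨q, rfl⟩ : ∃ q, p = q + 1 := ⟨p - 1, by omega⟩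
    have h1 : HasDerivAt g 0 z := hc ▸ (H.M.holo.differentiableAt
      (H.M.o.mem_nhds (H.M.PU hz))).hasDerivAt
    have h2 := ((H.M.iter_diff q).differentiableAt
      ((H.M.Un_open q).mem_nhds (H.M.P_Un (H.M.inv z hz)))).hasDerivAt
    have := h2.comp z h1
    rwa [mul_zero, ← iterate_succ] at this
  have hlo : ∀ᶠ x in 𝓝 z, ‖g^[p] x - z‖ ≤ 1 * ‖x - z‖ := by
    have := (hasDerivAt_iff_isLittleO.1 hd).def one_pos
    filter_upwards [this] with x hx
    simpa [hper] using hx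
  obtain ⟨r, hr, hrs⟩ := Metric.mem_nhds_iff.1 (inter_mem hlo ((H.M.Un_open p).mem_nhds hzU))
  rw [mem_interior]
  refine ⟨ball z r, fun x hx => H.fill x fun n => ?_, isOpen_ball, mem_ball_self hr⟩
  have hst : ∀ j, g^[p * j] x ∈ ball z r := by
    intro j
    induction j with
    | zero => exact hx
    | succ j ih =>
      rw [Nat.mul_succ, add_comm, iterate_add_apply]
      have := (hrs ih).1
      simp only [mem_ofPred_eq, one_mul] at this
      rw [mem_ball, dist_eq_norm] at ih ⊢
      exact this.trans_lt ih
  rw [← Nat.mod_add_div n p, iterate_add_apply]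
  exact (hrs (hst (n / p))).2.2 _ (Nat.mod_lt _ (by omega))

lemma PM.int_back {e : ℂ} {n : ℕ} (he : e ∈ P) (h : g^[n] e ∈ interior P) : e ∈ interior P := by
  rw [mem_interior]
  refine ⟨Un g U n ∩ g^[n] ⁻¹' interior P, ?_,
    (H.M.iter_diff n).continuousOn.isOpen_inter_preimage (H.M.Un_open n) isOpen_interior,
    H.M.P_Un he, h⟩
  rintro x ⟨hx, hxi⟩
  refine H.fill x fun i => ?_
  rcases lt_or_ge i n with hi | hi
  · exact hx.2 i hi
  · obtain ⟨j, rfl⟩ := Nat.exists_eq_add_of_le hi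
    rw [add_comm, iterate_add_apply]
    exact H.M.PU (H.M.iter_P (interior_subset hxi))

lemma PM.ev_tot {e : ℂ} (he : e ∈ P) {i₀ : ℕ}
    (h : ∀ i ≥ i₀, ¬ ∃ e' ∈ U, g e' = g (g^[i] e) ∧ e' ≠ g^[i] e) : e ∈ interior P := by
  have hm : ∀ i : ℕ, g^[i₀ + i] e ∈ critPts g U := fun i =>
    H.tot_crit (H.M.iter_P he) (h _ (by omega))
  obtain ⟨a, b, hab, heq⟩ : ∃ a b : ℕ, a < b ∧ g^[i₀ + a] e = g^[i₀ + b] e := by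
    obtain ⟨a, -, b, -, hne, heq⟩ := Set.infinite_univ.exists_ne_map_eq_of_mapsTo
      (f := fun i : ℕ => g^[i₀ + i] e) (fun i _ => hm i) H.crit_fin
    rcases lt_or_gt_of_ne hne with h | h
    · exact ⟨a, b, h, heq⟩
    · exact ⟨b, a, h, heq.symm⟩
  refine H.int_back (n := i₀ + a) he (H.super (p := b - a) (H.M.iter_P he) (by omega) ?_ (hm a).2)
  rw [← iterate_add_apply, show b - a + (i₀ + a) = i₀ + b by omega, heq]

lemma PM.At_iter {e w : ℂ} {t : ℝ} (hw : w ∈ ball 0 1 \ P) (he : e ∈ P) {n : ℕ}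
    (hA : At g U d w (g^[n] e) t) : At g U d w e t := by
  induction n generalizing e with
  | zero => exact hA
  | succ n ih => exact H.At_b hw he (ih (H.M.inv e he) hA)

lemma PM.At_pow {e w : ℂ} (hw : w ∈ ball 0 1 \ P) (he : e ∈ P)
    (h : ∀ i₀, ∃ i ≥ i₀, ∃ e' ∈ U, g e' = g (g^[i] e) ∧ e' ≠ g^[i] e) (m : ℕ) :
    At g U d w e ((((d - 1 : ℕ) : ℝ) / d) ^ m) := by
  induction m generalizing e with
  | zero => simpa using H.At_one hw
  | succ m ih =>
    obtain ⟨i, -, hi⟩ := h 0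
    refine H.At_iter hw he (n := i) ?_
    rw [pow_succ, mul_comm]
    refine H.At_c hw (H.M.iter_P he) hi (ih (H.M.inv _ (H.M.iter_P he)) fun i₀ => ?_)
    obtain ⟨j, hj, hj2⟩ := h (i₀ + i + 1)
    obtain ⟨l, rfl⟩ := Nat.exists_eq_add_of_le hj
    refine ⟨i₀ + l, by omega, ?_⟩
    have e1 : g^[i₀ + l] (g (g^[i] e)) = g^[i₀ + i + 1 + l] e := by
      rw [← iterate_succ_apply' g i, ← iterate_add_apply]
      rw [show i₀ + l + i.succ = i₀ + i + 1 + l by omega]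
    rwa [e1]

/-- There are no atoms. -/
lemma PM.atom {e w : ℂ} (hw : w ∈ ball 0 1 \ P) (he : e ∈ P) {δ : ℝ} (hδ : 0 < δ) :
    At g U d w e δ := by
  by_cases hinner : e ∈ interior P
  · obtain ⟨η, hη, hs⟩ := Metric.isOpen_iff.1 isOpen_interior e hinner
    refine ⟨η, hη, Eventually.of_forall fun n => ?_⟩
    have : Fib g U n w ∩ ball e η = ∅ := by
      rw [eq_empty_iff_forall_notMem]
      rintro x ⟨h1, h2⟩
      exact (H.Fib_W hw h1).2 (interior_subset (hs h2))
    rw [Nf, this]; simp; positivity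
  · have h : ∀ i₀, ∃ i ≥ i₀, ∃ e' ∈ U, g e' = g (g^[i] e) ∧ e' ≠ g^[i] e := by
      intro i₀
      by_contra hc
      refine hinner (H.ev_tot he (i₀ := i₀) fun i hi hx => hc ⟨i, hi, hx⟩)
    have hd := H.two
    have hlt : ((d - 1 : ℕ) : ℝ) / d < 1 := by
      rw [div_lt_one (by positivity)]
      exact_mod_cast (by omega : d - 1 < d)
    obtain ⟨m, hm⟩ := exists_pow_lt_of_lt_one hδ hlt
    obtain ⟨η, hη, hev⟩ := H.At_pow hw he h m
    refine ⟨η, hη, hev.mono fun n hn => hn.trans ?_⟩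
    gcongr

end pm
end RC

namespace RC

/-- Points of the fibre through which a branch on `D` passes. -/
def Tn (g : ℂ → ℂ) (U : Set ℂ) (n : ℕ) (w : ℂ) (D : Set ℂ) : Set ℂ :=
  {x | x ∈ Fib g U n w ∧ ∃ k, Br g U n D k ∧ k w = x}

section pm
variable {g : ℂ → ℂ} {U P : Set ℂ} {φ ψ : ℂ → ℂ} {d : ℕ} (H : PM g U P φ ψ d)
include H

lemma PM.Tn_step {c w : ℂ} {r : ℝ} (hb : ball c r ⊆ ball 0 1) (hw : w ∈ ball 0 1 \ P)
    (hwb : w ∈ ball c r) (n : ℕ) {B : ℕ}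
    (hB : B = 0 → ∀ v ∈ g '' critPts g U, g^[n] v ∉ ball c r)
    (hB' : B ≠ 0 → (g '' critPts g U).ncard ≤ B) :
    d * (Tn g U n w (ball c r)).ncard ≤ (Tn g U (n + 1) w (ball c r)).ncard + d * B := by
  classical
  set D := ball c r with hD
  have hpre : IsPreconnected D := (convex_ball _ _).isPreconnected
  have fT : ∀ m, (Tn g U m w D).Finite := fun m => (H.Fib_fin hw m).subset fun x hx => hx.1
  have hex : ∀ x ∈ Tn g U n w D, ∃ k, Br g U n D k ∧ k w = x := fun x hx => hx.2
  choose! k hk hkw using hex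
  set CV := g '' critPts g U with hCV
  have hCf : CV.Finite := H.crit_fin.image g
  set T := (fT n).toFinset with hT
  have hTm : ∀ x, x ∈ T ↔ x ∈ Tn g U n w D := fun x => (fT n).mem_toFinset
  set Gd := T.filter fun x => ∀ v ∈ CV, v ∉ k x '' D with hGd
  set Bd := T.filter fun x => ¬ ∀ v ∈ CV, v ∉ k x '' D with hBd
  have hsum : Gd.card + Bd.card = T.card := Finset.card_filter_add_card_filter_not _
  have hBc : Bd.card ≤ B := by
    have hv : ∀ x ∈ Bd, ∃ v ∈ CV, v ∈ k x '' D := by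
      intro x hx
      have := (Finset.mem_filter.1 hx).2
      push Not at this
      exact this
    have hBT : ∀ x ∈ Bd, x ∈ Tn g U n w D := fun x hx => (hTm x).1 (Finset.mem_filter.1 hx).1
    by_cases h0 : B = 0
    · rw [h0, Nat.le_zero, Finset.card_eq_zero, Finset.eq_empty_iff_forall_notMem]
      intro x hx
      obtain ⟨v, hv1, z, hz, rfl⟩ := hv x hx
      refine hB h0 _ hv1 ?_
      rw [((hk x (hBT x hx)).2 z hz).2]; exact hz
    · refine le_trans ?_ (hB' h0)
      choose! v hv1 hv2 using hv
      rw [← ncard_coe_finset]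
      refine ncard_le_ncard_of_injOn v (fun x hx => hv1 x hx) ?_ hCf
      intro x hx y hy e
      by_contra hne
      have hx' := hBT x hx
      have hy' := hBT y hy
      refine Set.disjoint_left.1 (H.M.br_disj isOpen_ball hpre (hk x hx') (hk y hy') hwb ?_)
        (hv2 x hx) (e ▸ hv2 y hy)
      rw [hkw x hx', hkw y hy']; exact hne
  have hGc : d * Gd.card ≤ (fT (n + 1)).toFinset.card := by
    refine le_trans (Finset.mul_card_image_le_card_of_maps_to (f := g)
      (s := (fT (n + 1)).toFinset.filter fun x => g x ∈ Gd) (t := Gd)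
      (fun x hx => (Finset.mem_filter.1 hx).2) d ?_) (Finset.card_filter_le _ _)
    intro x hx
    have hxT : x ∈ Tn g U n w D := (hTm x).1 (Finset.mem_filter.1 hx).1
    have hxW := H.Fib_W hw hxT.1
    rw [← H.F1_card hxW]
    refine Finset.card_le_card fun x' hx' => ?_
    rw [Finite.mem_toFinset] at hx'
    have hgx : g x' = x := hx'.2
    rw [Finset.mem_filter, Finset.mem_filter, Finite.mem_toFinset]
    refine ⟨⟨?_, by rw [hgx]; exact hx⟩, hgx⟩
    have hno := (Finset.mem_filter.1 hx).2
    have hkx := hk x hxT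
    have hS : MapsTo (k x) D (ball 0 1 \ CV) := fun z hz =>
      ⟨(hkx.2 z hz).1.1, fun h => hno _ h ⟨z, hz, rfl⟩⟩
    have hdv : ∀ u ∈ U, g u ∈ ball 0 1 \ CV → deriv g u ≠ 0 := fun u hu hgu h0 =>
      hgu.2 ⟨u, ⟨hu, h0⟩, rfl⟩
    obtain ⟨q, hq1, hq2, hq3⟩ := lift_exists H.M.o isOpen_ball H.M.holo H.M.maps H.M.prop
      (sdiff_subset (t := CV)) hdv isOpen_ball (convex_ball c r) hkx.1.continuousOn hS hwb hx'.1
      (hgx.trans (hkw x hxT).symm)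
    have hqd := lift_holo H.M.o H.M.holo isOpen_ball hkx.1 hq1 hq3
      (fun z hz => hdv _ (hq3 z hz).1 (by rw [(hq3 z hz).2]; exact hS hz))
    have hBr : Br g U (n + 1) D q := by
      refine ⟨hqd, fun z hz => ?_⟩
      obtain ⟨h1, h2⟩ := hq3 z hz
      refine ⟨H.M.Un_succ.2 ⟨h1, by rw [h2]; exact (hkx.2 z hz).1⟩, ?_⟩
      rw [iterate_succ_apply, h2]; exact (hkx.2 z hz).2
    exact ⟨by rw [← hq2]; exact hBr.2 w hwb, q, hBr, hq2⟩
  rw [ncard_eq_toFinset_card _ (fT n), ncard_eq_toFinset_card _ (fT (n + 1))]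
  calc d * T.card = d * Gd.card + d * Bd.card := by rw [← hsum, mul_add]
    _ ≤ _ := add_le_add hGc (Nat.mul_le_mul_left d hBc)

lemma PM.Tn_count {c w : ℂ} {r : ℝ} (hb : ball c r ⊆ ball 0 1) (hw : w ∈ ball 0 1 \ P)
    (hwb : w ∈ ball c r) (l : ℕ)
    (hE : ∀ i < l, ∀ v ∈ g '' critPts g U, g^[i] v ∉ ball c r) (j : ℕ) :
    d ^ (l + j) ≤ (Tn g U (l + j) w (ball c r)).ncard + 2 * (g '' critPts g U).ncard * d ^ j := by
  set κ := (g '' critPts g U).ncard with hκ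
  have hCf : (g '' critPts g U).Finite := H.crit_fin.image g
  have hA : ∀ n ≤ l, d ^ n ≤ (Tn g U n w (ball c r)).ncard := by
    intro n hn
    induction n with
    | zero =>
      have : Tn g U 0 w (ball c r) = {w} := by
        ext x; simp only [Tn, Fib_zero H hw.1, mem_ofPred_eq, mem_singleton_iff]
        constructor
        · exact fun h => h.1
        · rintro rfl
          exact ⟨rfl, id, ⟨differentiableOn_id, fun z hz => ⟨by rw [Un_zero]; exact hb hz, rfl⟩⟩, rfl⟩
      rw [this]; simp
    | succ n ih =>
      have := H.Tn_step hb hw hwb n (B := 0) (fun _ => hE n (by omega)) (fun h => absurd rfl h)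
      have h2 := Nat.mul_le_mul_left d (ih (by omega))
      rw [pow_succ']
      omega
  suffices h : d ^ (l + j) + 2 * κ ≤ (Tn g U (l + j) w (ball c r)).ncard + 2 * κ * d ^ j by omega
  induction j with
  | zero => have := hA l le_rfl; simp only [add_zero, pow_zero, mul_one]; omega
  | succ j ih =>
    have hst : d * (Tn g U (l + j) w (ball c r)).ncard ≤
        (Tn g U (l + j + 1) w (ball c r)).ncard + d * κ := by
      refine H.Tn_step hb hw hwb (l + j) (fun h0 v hv => ?_) (fun _ => le_rfl)
      rw [hκ, ncard_eq_zero hCf] at h0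
      rw [h0] at hv; exact absurd hv (notMem_empty v)
    have h2 := Nat.mul_le_mul_left d ih
    have h3 : 2 * κ ≤ d * κ := Nat.mul_le_mul_right κ H.two
    rw [← add_assoc, pow_succ', pow_succ']
    have e1 : d * (d ^ (l + j) + 2 * κ) = d * d ^ (l + j) + 2 * (d * κ) := by ring
    have e2 : d * ((Tn g U (l + j) w (ball c r)).ncard + 2 * κ * d ^ j) =
      d * (Tn g U (l + j) w (ball c r)).ncard + 2 * κ * (d * d ^ j) := by ring
    rw [e1, e2] at h2
    omega

lemma PM.branch_in {c w : ℂ} {r : ℝ} (hb : ball c r ⊆ ball 0 1) (hw : w ∈ ball 0 1 \ P)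
    (hwb : w ∈ ball c r) (l : ℕ)
    (hE : ∀ i < l, ∀ v ∈ g '' critPts g U, g^[i] v ∉ ball c r) (j : ℕ) {S : Set ℂ}
    (hS : 2 * (g '' critPts g U).ncard * d ^ j < Nf g U (l + j) w S) :
    ∃ k, Br g U (l + j) (ball c r) k ∧ k w ∈ S := by
  have h1 := H.Tn_count hb hw hwb l hE j
  have hF := H.Fib_fin hw (l + j)
  by_contra hcon
  push Not at hcon
  have hdisj : Disjoint (Tn g U (l + j) w (ball c r)) (Fib g U (l + j) w ∩ S) := by
    rw [Set.disjoint_left]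
    rintro x ⟨-, k, hk, rfl⟩ ⟨-, hx⟩
    exact hcon k hk hx
  have h2 := ncard_union_eq hdisj (hF.subset fun x hx => hx.1) (hF.inter_of_left _)
  have h3 : (Tn g U (l + j) w (ball c r) ∪ (Fib g U (l + j) w ∩ S)).ncard ≤
      (Fib g U (l + j) w ∩ univ).ncard := by
    rw [inter_univ]
    exact ncard_le_ncard (union_subset (fun x hx => hx.1) inter_subset_left) hF
  have h4 := H.Nf_univ hw (l + j)
  rw [Nf] at h4 hS
  omega

lemma PM.atomS {w : ℂ} (hw : w ∈ ball 0 1 \ P) {E : Set ℂ} (hE : E.Finite) (hEP : E ⊆ P) :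
    ∀ δ > 0, ∃ η > 0, ∀ᶠ n in atTop, (Nf g U n w (thickening η E) : ℝ) ≤ δ * (d:ℝ) ^ n := by
  induction E, hE using Set.Finite.induction_on with
  | empty =>
    intro δ hδ
    refine ⟨1, one_pos, Eventually.of_forall fun n => ?_⟩
    simp [Nf]; positivity
  | @insert e E _ _ ih =>
    intro δ hδ
    obtain ⟨η₁, hη₁, h1⟩ := ih (fun x hx => hEP (mem_insert_of_mem _ hx)) (δ / 2) (half_pos hδ)
    obtain ⟨η₂, hη₂, h2⟩ := H.atom hw (hEP (mem_insert e E)) (half_pos hδ)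
    refine ⟨min η₁ η₂, lt_min hη₁ hη₂, ?_⟩
    filter_upwards [h1, h2] with n h1 h2
    have hsub : Fib g U n w ∩ thickening (min η₁ η₂) (insert e E) ⊆
        (Fib g U n w ∩ thickening η₁ E) ∪ (Fib g U n w ∩ ball e η₂) := by
      rintro x ⟨hx, hx2⟩
      obtain ⟨z, hz, hxz⟩ := mem_thickening_iff.1 hx2
      rcases hz with rfl | hz
      · exact Or.inr ⟨hx, hxz.trans_le (min_le_right _ _)⟩
      · exact Or.inl ⟨hx, mem_thickening_iff.2 ⟨z, hz, hxz.trans_le (min_le_left _ _)⟩⟩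
    have hF := H.Fib_fin hw n
    have h3 : Nf g U n w (thickening (min η₁ η₂) (insert e E)) ≤
        Nf g U n w (thickening η₁ E) + Nf g U n w (ball e η₂) :=
      (ncard_le_ncard hsub ((hF.inter_of_left _).union (hF.inter_of_left _))).trans
        (ncard_union_le _ _)
    have h4 : (Nf g U n w (thickening (min η₁ η₂) (insert e E)) : ℝ) ≤
        Nf g U n w (thickening η₁ E) + Nf g U n w (ball e η₂) := by exact_mod_cast h3
    linarith

lemma PM.br_J {c : ℂ} {D : Set ℂ} (hD : IsOpen D) (hc : c ∈ D) (hcJ : c ∈ frontier P) {n : ℕ}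
    {k : ℂ → ℂ} (hk : Br g U n D k) : k c ∈ frontier P := by
  have hcP := H.M.Pc.isClosed.frontier_subset hcJ
  have hkP : k c ∈ P := by
    refine H.fill _ fun i => ?_
    rcases lt_or_ge i n with hi | hi
    · exact (hk.2 c hc).1.2 i hi
    · obtain ⟨j, rfl⟩ := Nat.exists_eq_add_of_le hi
      rw [add_comm, iterate_add_apply, (hk.2 c hc).2]
      exact H.M.PU (H.M.iter_P hcP)
  refine ⟨subset_closure hkP, fun hinner => hcJ.2 ?_⟩
  rw [mem_interior]
  refine ⟨D ∩ k ⁻¹' interior P, ?_,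
    hk.1.continuousOn.isOpen_inter_preimage hD isOpen_interior, hc, hinner⟩
  rintro z ⟨hz, hzi⟩
  rw [← (hk.2 z hz).2]
  exact H.M.iter_P (interior_subset hzi)

end pm
end RC

namespace RC

section pm
variable {g : ℂ → ℂ} {U P : Set ℂ} {φ ψ : ℂ → ℂ} {d : ℕ} (H : PM g U P φ ψ d)
include H

lemma PM.rep_P : repellingPts g U ⊆ P := by
  rintro x ⟨p, -, h, -⟩
  exact H.fill x h

lemma PM.acc_P {w y : ℂ} (hw : w ∈ ball 0 1 \ P) (hy : y ∈ Acc g U w) : y ∈ P := by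
  by_contra hc
  exact hc (closure_minimal H.rep_P H.M.Pc.isClosed (H.M.acc_rep_W hw hy hc))

lemma PM.comp {n m : ℕ} {D D' : Set ℂ} {k k' : ℂ → ℂ} (h : Br g U n D k) (h' : Br g U m D' k')
    (hm : MapsTo k D D') : Br g U (m + n) D (fun z => k' (k z)) := by
  refine ⟨h'.1.comp h.1 hm, fun z hz => ?_⟩
  have e := h'.2 _ (hm hz)
  refine ⟨H.M.Un_add.2 ⟨e.1, by rw [e.2]; exact (h.2 z hz).1⟩, ?_⟩
  rw [add_comm, iterate_add_apply, e.2]; exact (h.2 z hz).2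

/-- The closing argument from a finite family of discs. -/
lemma PM.cycle {t : Set ℂ} (ht : t.Finite) (htn : t.Nonempty) {r : ℝ} (hr : 0 < r)
    (h : ∀ z ∈ t, ∃ z' ∈ t, ∃ n ≥ 1, ∃ k, Br g U n (ball z (r / 2)) k ∧
      ∀ x ∈ ball z (r / 2), k x ∈ ball z' (r / 8)) :
    ∃ z ∈ t, ∃ x ∈ closedBall z (r / 4), x ∈ repellingPts g U := by
  choose! F hFt N hN k hk hkm using h
  have hit : ∀ z ∈ t, ∀ i : ℕ, F^[i] z ∈ t := by
    intro z hz i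
    induction i with
    | zero => exact hz
    | succ i ih => rw [iterate_succ_apply']; exact hFt _ ih
  have hcomp : ∀ z ∈ t, ∀ m : ℕ, ∃ n ≥ 1, ∃ q, Br g U n (ball z (r / 2)) q ∧
      ∀ x ∈ ball z (r / 2), q x ∈ ball (F^[m + 1] z) (r / 8) := by
    intro z hz m
    induction m with
    | zero => exact ⟨N z, hN z hz, k z, hk z hz, hkm z hz⟩
    | succ m ih =>
      obtain ⟨n, hn, q, hq, hqm⟩ := ih
      set z' := F^[m + 1] z with hz'
      have hz't : z' ∈ t := hit z hz _
      have hm : MapsTo q (ball z (r / 2)) (ball z' (r / 2)) := fun x hx =>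
        ball_subset_ball (by linarith) (hqm x hx)
      refine ⟨N z' + n, by omega, _, H.comp hq (hk z' hz't) hm, fun x hx => ?_⟩
      rw [iterate_succ_apply', ← hz']
      exact hkm z' hz't _ (hm hx)
  obtain ⟨z₀, hz₀⟩ := htn
  obtain ⟨a, b, hab, heq⟩ : ∃ a b : ℕ, a < b ∧ F^[a] z₀ = F^[b] z₀ := by
    obtain ⟨a, -, b, -, hne, heq⟩ := Set.infinite_univ.exists_ne_map_eq_of_mapsTo
      (f := fun i : ℕ => F^[i] z₀) (fun i _ => hit z₀ hz₀ i) ht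
    rcases lt_or_gt_of_ne hne with h | h
    · exact ⟨a, b, h, heq⟩
    · exact ⟨b, a, h, heq.symm⟩
  have hper : F^[b - a - 1 + 1] (F^[a] z₀) = F^[a] z₀ := by
    rw [← iterate_add_apply, show b - a - 1 + 1 + a = b by omega, heq]
  obtain ⟨n, hn, q, hq, hqm⟩ := hcomp (F^[a] z₀) (hit z₀ hz₀ a) (b - a - 1)
  rw [hper] at hqm
  have e : 2 * (r / 4) = r / 2 := by ring
  obtain ⟨x, hx, hxR⟩ := H.M.rep_of_branch hn (c := F^[a] z₀) (ρ := r / 4) (by positivity)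
    (by rw [e]; exact hq) (fun x hx => by
      rw [e] at hx
      have := hqm x hx
      rw [mem_ball] at this; linarith)
  exact ⟨_, hit z₀ hz₀ a, x, hx, hxR⟩

theorem PM.J_rep {y : ℂ} (hy : y ∈ frontier P) : y ∈ closure (repellingPts g U) := by
  have hyP : y ∈ P := H.M.Pc.isClosed.frontier_subset hy
  have hyb : y ∈ ball (0:ℂ) 1 := H.M.sub (H.M.PU hyP)
  obtain ⟨w₀, hw₀b, hw₀U⟩ := H.M.a
  have hw₀ : w₀ ∈ ball 0 1 \ P := ⟨hw₀b, fun h => hw₀U (H.M.PU h)⟩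
  rw [Metric.mem_closure_iff]
  intro ε' hε'
  obtain ⟨ε₁, hε₁, hε₁b⟩ := Metric.isOpen_iff.1 isOpen_ball y hyb
  set ε := min ε' ε₁ with hεd
  have hε : 0 < ε := lt_min hε' hε₁
  have hεb : ball y ε ⊆ ball 0 1 := (ball_subset_ball (min_le_right _ _)).trans hε₁b
  suffices hmain : ∃ x ∈ repellingPts g U, dist y x < ε by
    obtain ⟨x, hx, hxd⟩ := hmain
    exact ⟨x, hx, hxd.trans_le (min_le_left _ _)⟩
  obtain ⟨p, hp, n₀, hmass⟩ := H.mass hy hw₀ (ε := ε / 4) (by positivity)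
  set κ := (g '' critPts g U).ncard with hκ
  have hd2 : (2:ℝ) ≤ d := by exact_mod_cast H.two
  have hd0 : (0:ℝ) < d := by linarith
  have hd1 : (1:ℝ) ≤ d := by linarith
  obtain ⟨l, hl⟩ := pow_unbounded_of_one_lt (8 * κ / p) (by linarith : (1:ℝ) < d)
  rw [div_lt_iff₀ hp] at hl
  set E : Set ℂ := ⋃ i ∈ Finset.range l, g^[i] '' (g '' critPts g U) with hE
  have hEf : E.Finite := by
    refine Set.Finite.biUnion (Finset.finite_toSet _) fun i _ => (H.crit_fin.image g).image _
  have hEP : E ⊆ P := by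
    refine iUnion₂_subset fun i _ => ?_
    rintro _ ⟨_, ⟨c, hc, rfl⟩, rfl⟩
    exact H.M.iter_P (H.M.inv c (H.M.crit hc))
  have hEm : ∀ i < l, ∀ v ∈ g '' critPts g U, g^[i] v ∈ E := fun i hi v hv =>
    mem_biUnion (Finset.mem_coe.2 (Finset.mem_range.2 hi)) ⟨v, hv, rfl⟩
  obtain ⟨η, hη, hatom⟩ := H.atomS hw₀ hEf hEP (p / 2) (half_pos hp)
  set G := ball y (ε / 4) \ thickening η E with hG
  have hGmass : ∀ᶠ n in atTop, p / 2 * (d:ℝ) ^ n ≤ Nf g U n w₀ G := by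
    filter_upwards [hatom, eventually_ge_atTop n₀] with n h1 h2
    have h3 := hmass n h2
    have hF := H.Fib_fin hw₀ n
    have hsub : Fib g U n w₀ ∩ ball y (ε / 4) ⊆
        (Fib g U n w₀ ∩ G) ∪ (Fib g U n w₀ ∩ thickening η E) := by
      rintro x ⟨hx, hx2⟩
      by_cases hxE : x ∈ thickening η E
      · exact Or.inr ⟨hx, hxE⟩
      · exact Or.inl ⟨hx, hx2, hxE⟩
    have h4 : Nf g U n w₀ (ball y (ε / 4)) ≤ Nf g U n w₀ G + Nf g U n w₀ (thickening η E) :=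
      (ncard_le_ncard hsub ((hF.inter_of_left _).union (hF.inter_of_left _))).trans
        (ncard_union_le _ _)
    have h5 : (Nf g U n w₀ (ball y (ε / 4)) : ℝ) ≤
      Nf g U n w₀ G + Nf g U n w₀ (thickening η E) := by exact_mod_cast h4
    linarith
  set r := min (ε / 4) (η / 4) with hr
  have hr0 : 0 < r := by positivity
  have hrε : r ≤ ε / 4 := min_le_left _ _
  have hrη : r ≤ η / 4 := min_le_right _ _
  -- mass for all other base points
  have hGw : ∀ w ∈ ball 0 1 \ P, ∀ᶠ n in atTop, p / 4 * (d:ℝ) ^ n ≤ Nf g U n w (thickening r G) := by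
    intro w hw
    obtain ⟨α, hα, hL⟩ := H.Lk_all hw₀ hw
    filter_upwards [hGmass, hα.eventually (gt_mem_nhds (show 0 < p / 4 * r ^ 2 by positivity))]
      with n h1 h2
    have h3 := hL n G r hr0
    have h4 : α n / r ^ 2 ≤ p / 4 := by rw [div_le_iff₀ (by positivity)]; exact h2.le
    have h5 : (1:ℝ) ≤ (d:ℝ) ^ n := one_le_pow₀ hd1
    nlinarith
  set Q := (frontier P ∩ closedBall y (3 * ε / 4)) \ thickening (η / 2) E with hQ
  have hQc : IsCompact Q :=
    ((isCompact_closedBall _ _).inter_left isClosed_frontier).diff isOpen_thickening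
  have hQb : ∀ z ∈ Q, ball z r ⊆ ball y ε := fun z hz x hx => by
    have h1 := hz.1.2
    rw [mem_closedBall] at h1
    rw [mem_ball] at hx ⊢
    linarith [dist_triangle x z y]
  have hnear : ∀ x, (∃ u ∈ G, dist x u < 2 * r) → x ∈ frontier P → x ∈ Q := by
    rintro x ⟨u, hu, hxu⟩ hxJ
    refine ⟨⟨hxJ, ?_⟩, fun hxE => hu.2 ?_⟩
    · have := hu.1
      rw [mem_ball] at this
      rw [mem_closedBall]
      linarith [dist_triangle x u y]
    · obtain ⟨e, he, hxe⟩ := mem_thickening_iff.1 hxE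
      refine mem_thickening_iff.2 ⟨e, he, ?_⟩
      rw [dist_comm] at hxu
      linarith [dist_triangle u x e]
  -- nonemptiness
  have hQn : Q.Nonempty := by
    obtain ⟨N, hN⟩ := eventually_atTop.1 hGmass
    have hx : ∀ n : ℕ, ∃ x, x ∈ Fib g U (N + n) w₀ ∩ G := by
      intro n
      have h1 := hN (N + n) (by omega)
      have h2 : (0:ℝ) < Nf g U (N + n) w₀ G := lt_of_lt_of_le (by positivity) h1
      exact nonempty_of_ncard_ne_zero (by exact_mod_cast h2.ne')
    choose x hx using hx
    obtain ⟨u, hu, s, hs, hlim⟩ := (isCompact_closedBall y (ε / 4)).tendsto_subseq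
      (fun n => ball_subset_closedBall (hx n).2.1)
    have huA : u ∈ Acc g U w₀ := by
      refine ⟨hεb ?_, fun e he M => ?_⟩
      · rw [mem_closedBall] at hu; rw [mem_ball]; linarith
      · obtain ⟨j, hj1, hj2⟩ := ((hlim.eventually (ball_mem_nhds u he)).and
          (hs.tendsto_atTop.eventually (eventually_ge_atTop M))).exists
        exact ⟨N + s j, by omega, x (s j), (hx (s j)).1, hj1⟩
    have huP := H.acc_P hw₀ huA
    refine ⟨u, hnear u ?_ ⟨subset_closure huP, fun hinner => ?_⟩⟩
    · obtain ⟨j, hj⟩ := (hlim.eventually (ball_mem_nhds u hr0)).exists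
      refine ⟨x (s j), (hx (s j)).2, ?_⟩
      have : dist u (x (s j)) < r := by rw [dist_comm]; exact hj
      linarith
    · obtain ⟨j, hj⟩ := (hlim.eventually (isOpen_interior.mem_nhds hinner)).exists
      exact (H.Fib_W hw₀ (hx (s j)).1).2 (interior_subset hj)
  obtain ⟨t, htQ, htf, htc⟩ := hQc.finite_cover_balls (e := r / 16) (by positivity)
  have htn : t.Nonempty := by
    obtain ⟨u, hu⟩ := hQn
    obtain ⟨z, hz, -⟩ := mem_iUnion₂.1 (htc hu)
    exact ⟨z, hz⟩
  obtain ⟨z, hz, x, hx, hxR⟩ := H.cycle htf htn hr0 fun z hz => by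
    have hzQ := htQ hz
    have hzb : ball z r ⊆ ball 0 1 := (hQb z hzQ).trans hεb
    have hzJ : z ∈ frontier P := hzQ.1.1
    have hcl : z ∈ closure Pᶜ := by
      have := hzJ; rw [frontier_eq_closure_inter_closure] at this; exact this.2
    obtain ⟨w, hwP, hwz⟩ := Metric.mem_closure_iff.1 hcl (r / 2) (half_pos hr0)
    rw [dist_comm] at hwz
    have hwr : w ∈ ball z r := by rw [mem_ball]; linarith
    have hwW : w ∈ ball 0 1 \ P := ⟨hzb hwr, hwP⟩
    obtain ⟨N₁, hN₁⟩ := H.contr hr0 (show 0 < r / 16 by positivity) ⟨w, hwr, hwP⟩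
    obtain ⟨N₂, hN₂⟩ := eventually_atTop.1 (hGw w hwW)
    set j := N₁ + N₂ + 1 with hj
    obtain ⟨k, hk, hkw⟩ := H.branch_in hzb hwW hwr l (fun i hi v hv hm => by
      refine hzQ.2 (mem_thickening_iff.2 ⟨_, hEm i hi v hv, ?_⟩)
      rw [mem_ball, dist_comm] at hm
      linarith) j (S := thickening r G) (by
      have h1 := hN₂ (l + j) (by omega)
      have h2 : (2 * κ * d ^ j : ℝ) < Nf g U (l + j) w (thickening r G) := by
        refine lt_of_lt_of_le ?_ h1
        rw [pow_add (d:ℝ) l j]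
        have h3 : (0:ℝ) < (d:ℝ) ^ j := by positivity
        have h4 := mul_lt_mul_of_pos_right hl h3
        linarith
      exact_mod_cast h2)
    have hctr := hN₁ (l + j) (by omega) k hk
    have hkz : k z ∈ Q := by
      obtain ⟨u, hu, huk⟩ := mem_thickening_iff.1 hkw
      refine hnear _ ⟨u, hu, ?_⟩ (H.br_J isOpen_ball (mem_ball_self hr0) hzJ hk)
      have := hctr w hwz
      rw [dist_comm] at this
      linarith [dist_triangle (k z) (k w) u]
    obtain ⟨z', hz', hzz'⟩ := mem_iUnion₂.1 (htc hkz)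
    refine ⟨z', hz', l + j, by omega, k, hk.mono (ball_subset_ball (by linarith)), fun x hx => ?_⟩
    have := hctr x hx
    rw [mem_ball] at hzz' ⊢
    linarith [dist_triangle (k x) (k z) z']
  refine ⟨x, hxR, ?_⟩
  have h1 := hQb z (htQ hz) (show x ∈ ball z r by
    rw [mem_closedBall] at hx; rw [mem_ball]; linarith)
  rwa [mem_ball, dist_comm] at h1

end pm
end RC

namespace RC

lemma conj_deg {g : ℂ → ℂ} {U' U : Set ℂ} {φ ψ : ℂ → ℂ} {d : ℕ} (hU'o : IsOpen U') (hUo : IsOpen U)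
    (h : Riem U φ ψ) (hsub : U' ⊆ U) (hg : DifferentiableOn ℂ g U') (hm : MapsTo g U' U)
    (hd : HasDeg g U' U d) : HasDeg (cg g φ ψ) (cU U' φ) (ball 0 1) d := by
  have hmem : ∀ z ∈ U', ψ z ∈ cU U' φ := fun z hz =>
    ⟨h.mψ (hsub hz), by rw [mem_preimage, h.r z (hsub hz)]; exact hz⟩
  have hfib : ∀ w ∈ ball (0:ℂ) 1, cU U' φ ∩ cg g φ ψ ⁻¹' {w} = ψ '' (U' ∩ g ⁻¹' {φ w}) := by
    intro w hw
    ext z; constructor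
    · rintro ⟨hz, hz2⟩
      refine ⟨φ z, ⟨hz.2, ?_⟩, h.l z hz.1⟩
      have h2 : ψ (g (φ z)) = w := hz2
      rw [mem_preimage, mem_singleton_iff, ← h2, h.r _ (hm hz.2)]
    · rintro ⟨v, ⟨hv, hv2⟩, rfl⟩
      refine ⟨hmem v hv, ?_⟩
      have h2 : g v = φ w := hv2
      show ψ (g (φ (ψ v))) = w
      rw [h.r v (hsub hv), h2, h.l w hw]
  refine ⟨fun w hw => ?_, fun w hw hcv => ?_⟩
  · rw [hfib w hw]; exact (hd.1 _ (h.mφ hw)).image _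
  · rw [hfib w hw, ncard_image_of_injOn]
    · refine hd.2 _ (h.mφ hw) ?_
      rintro ⟨c, hc, hcw⟩
      refine hcv ⟨ψ c, ⟨hmem c hc.1, ?_⟩, ?_⟩
      · have hcU := hsub hc.1
        have hφc : φ (ψ c) = c := h.r c hcU
        have e1 : DifferentiableAt ℂ φ (ψ c) := h.dφ.differentiableAt (isOpen_ball.mem_nhds (h.mψ hcU))
        have e2 : DifferentiableAt ℂ g (φ (ψ c)) := by
          rw [hφc]; exact hg.differentiableAt (hU'o.mem_nhds hc.1)
        have e3 : DifferentiableAt ℂ ψ (g (φ (ψ c))) := by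
          rw [hφc]; exact h.dψ.differentiableAt (hUo.mem_nhds (hm hc.1))
        have e4 : HasDerivAt (cg g φ ψ)
            (deriv ψ (g (φ (ψ c))) * (deriv g (φ (ψ c)) * deriv φ (ψ c))) (ψ c) :=
          e3.hasDerivAt.comp (ψ c) (e2.hasDerivAt.comp (ψ c) e1.hasDerivAt)
        rw [e4.deriv, hφc, hc.2]; simp
      · show ψ (g (φ (ψ c))) = w
        rw [h.r c (hsub hc.1), hcw, h.l w hw]
    · intro x hx y hy hxy
      rw [← h.r x (hsub hx.1), hxy, h.r y (hsub hy.1)]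

lemma rep_not_int {g : ℂ → ℂ} {U' K : Set ℂ} (hK : IsCompact K) (hU'o : IsOpen U') (hKU : K ⊆ U')
    (hg : DifferentiableOn ℂ g U') (hinv : ∀ x ∈ K, g x ∈ K) {q : ℂ}
    (hq : q ∈ repellingPts g U') : q ∉ interior K := by
  intro hinner
  obtain ⟨p, hp, ho, hper, hd⟩ := hq
  obtain ⟨R, hR0, hR⟩ := Metric.isOpen_iff.1 isOpen_interior q hinner
  have hRK : ball q R ⊆ K := hR.trans interior_subset
  have hit : ∀ n, ∀ x ∈ K, g^[n] x ∈ K := by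
    intro n
    induction n with
    | zero => exact fun x hx => hx
    | succ n ih => intro x hx; rw [iterate_succ_apply]; exact ih _ (hinv x hx)
  have hdiff : ∀ n, ∀ x ∈ K, DifferentiableAt ℂ (g^[n]) x := by
    intro n
    induction n with
    | zero => exact fun x hx => differentiableAt_id
    | succ n ih =>
      intro x hx
      exact DifferentiableAt.comp x (ih _ (hinv x hx))
        (hg.differentiableAt (hU'o.mem_nhds (hKU hx)))
  have hqK : q ∈ K := interior_subset hinner
  obtain ⟨C, hC⟩ := hK.isBounded.exists_norm_le
  have hbound : ∀ n : ℕ, ‖deriv (g^[p]) q‖ ^ n ≤ C / (R / 2) := by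
    intro n
    have h1 : HasDerivAt ((g^[p])^[n]) (deriv (g^[p]) q ^ n) q :=
      HasDerivAt.iterate q (hdiff p q hqK).hasDerivAt hper n
    rw [← norm_pow, ← h1.deriv, ← iterate_mul]
    refine Complex.norm_deriv_le_of_forall_mem_sphere_norm_le (half_pos hR0) ?_ ?_
    · refine DifferentiableOn.diffContOnCl fun x hx => ?_
      refine (hdiff _ x (hRK ?_)).differentiableWithinAt
      have := closure_ball_subset_closedBall hx
      rw [mem_closedBall] at this; rw [mem_ball]; linarith
    · intro x hx
      refine hC _ (hit _ _ (hRK ?_))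
      rw [mem_sphere] at hx; rw [mem_ball]; linarith
  obtain ⟨n, hn⟩ := pow_unbounded_of_one_lt (C / (R / 2)) hd
  linarith [hbound n]

lemma frontier_compl_mem {K : Set ℂ} {V : Set ℂ} {φ ψ : ℂ → ℂ} (hVo : IsOpen V) (h : Riem V φ ψ)
    (hK : IsCompact K) (hKV : K ⊆ V) {z : ℂ} (hz : z ∈ frontier K) : ψ z ∈ frontier (ψ '' K) := by
  have hzK : z ∈ K := hK.isClosed.frontier_subset hz
  refine ⟨subset_closure ⟨z, hzK, rfl⟩, fun hinner => hz.2 ?_⟩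
  have hc : ContinuousAt ψ z := h.dψ.continuousOn.continuousAt (hVo.mem_nhds (hKV hzK))
  rw [mem_interior_iff_mem_nhds]
  filter_upwards [hVo.mem_nhds (hKV hzK), hc.preimage_mem_nhds (isOpen_interior.mem_nhds hinner)]
    with w hw hw2
  obtain ⟨v, hv, hvw⟩ := interior_subset hw2
  rw [← h.r w hw, ← hvw, h.r v (hKV hv)]; exact hv

theorem case1_final {g : ℂ → ℂ} {U' U : Set ℂ} {d : ℕ} (H : PLSetting g U' U d) {Kstar : Set ℂ}
    (hKcomp : IsCompact Kstar) (hKfull : IsConnected Kstarᶜ)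
    (hKinv : U' ∩ g ⁻¹' Kstar = Kstar) (hPK : postCrit g U' ⊆ Kstar)
    {V' V : Set ℂ} (hVU : V ⊆ U) (hV' : V' = U' ∩ g ⁻¹' V) (hPL : IsPolyLike g V' V d)
    (hKJ : Kstar = filledJulia g V') :
    sphereRepClosure g U' = (fun z : ℂ => (z : OnePoint ℂ)) '' frontier Kstar := by
  obtain ⟨hD', hD, hcl, hgV, hmV, hpV, hdV⟩ := hPL
  have hU'o := H.disk'.1
  have hUo := H.disk.1
  have hUne := ne_univ_of_proper hU'o H.disk'.2.2 H.ne H.subset H.disk'.2.1.nonempty H.holo H.proper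
  have hV'V : V' ⊆ V := subset_closure.trans hcl
  have hV'U' : V' ⊆ U' := by rw [hV']; exact inter_subset_left
  have hne : V' ≠ V := by
    intro he
    have h1 : IsClopen V := ⟨isClosed_of_closure_subset (he ▸ hcl), hD.1⟩
    rcases isClopen_iff.1 h1 with h2 | h2
    · exact hD.2.1.nonempty.ne_empty h2
    · exact hUne (univ_subset_iff.1 (h2 ▸ hVU))
  have hKV' : Kstar ⊆ V' := fun x hx => by rw [hKJ] at hx; exact hx 0
  have hKU' : Kstar ⊆ U' := hKV'.trans hV'U'
  have hinv : ∀ x ∈ Kstar, g x ∈ Kstar := fun x hx => (hKinv.symm.subset hx).2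
  have hcr : critPts g U' ⊆ Kstar := crit_postCrit.trans hPK
  have hcrV : critPts g V' ⊆ Kstar := fun c hc => hcr ⟨hV'U' hc.1, hc.2⟩
  obtain ⟨c₀, hc₀⟩ := crit_nonempty H
  have hKn : Kstar.Nonempty := ⟨c₀, hcr hc₀⟩
  -- repelling points lie in the frontier
  have hrep : repellingPts g U' ⊆ frontier Kstar := by
    intro q hq
    refine ⟨subset_closure ?_, rep_not_int hKcomp hU'o hKU' H.holo hinv hq⟩
    by_contra hqK
    obtain ⟨p, hp, ho, hper, -⟩ := hq
    obtain ⟨φ, ψ, φ', ψ', h, M⟩ := mk_model hU'o H.disk'.2.2 hUo H.disk.2.2 H.subset H.ne H.holo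
      H.mapsTo H.proper hKcomp hKfull hKU' hKn hcr hinv
    obtain ⟨w, hwV, hwV'⟩ : ∃ w ∈ V, w ∉ V' := by
      by_contra hcon
      push Not at hcon
      exact hne (hV'V.antisymm hcon)
    have hwK : w ∉ Kstar := fun hw => hwV' (hKV' hw)
    have hψK : ∀ x ∈ U, x ∉ Kstar → ψ x ∈ ball 0 1 \ ψ '' Kstar := by
      intro x hx hxK
      refine ⟨h.mψ hx, ?_⟩
      rintro ⟨y, hy, hyx⟩
      apply hxK
      rw [← h.r x hx, ← hyx, h.r y (H.subset (hKU' hy))]; exact hy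
    -- periodic points outside K lie in V
    have key : ∀ a, (∀ n, g^[n] a ∈ U') → g^[p] a = a → a ∉ Kstar → a ∈ V := by
      intro a ha hap haK
      have haU : a ∈ U := H.subset (ha 0)
      have hb : ψ a ∈ ball (0:ℂ) 1 := h.mψ haU
      have hUn : ∀ n, ψ a ∈ Un (cg g φ ψ) (cU U' φ) n := fun n =>
        conj_bwd h H.mapsTo hb (fun i _ => by rw [h.r a haU]; exact ha i)
      have hper' : (cg g φ ψ)^[p] (ψ a) = ψ a := by
        obtain ⟨-, h2, h3⟩ := conj_fwd h H.mapsTo (hUn p)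
        rw [h.r a haU, hap] at h2
        rw [← h.l _ h3, h2]
      have hacc := M.per_acc (hψK w (hVU hwV) hwK) (hψK a haU haK) hp
        (fun n => (hUn (n+1)).2 n (Nat.lt_succ_self n)) hper'
      apply hcl
      have hφc : ContinuousAt φ (ψ a) := h.dφ.continuousOn.continuousAt (isOpen_ball.mem_nhds hb)
      rw [← h.r a haU]
      refine hφc.continuousWithinAt.mem_closure
        (s := {x | ∃ n ≥ 1, x ∈ Fib (cg g φ ψ) (cU U' φ) n (ψ w)}) ?_ ?_
      · rw [Metric.mem_closure_iff]
        intro ε hε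
        obtain ⟨n, hn, x, hx, hxd⟩ := hacc.2 ε hε 1
        exact ⟨x, ⟨n, hn, hx⟩, by rw [dist_comm]; exact hxd⟩
      · rintro x ⟨n, hn, hx⟩
        obtain ⟨h1, h2, -⟩ := conj_fwd h H.mapsTo hx.1
        rw [hx.2, h.r w (hVU hwV)] at h2
        have hdesc : ∀ j < n, g^[n - 1 - j] (φ x) ∈ V' := by
          intro j
          induction j with
          | zero =>
            intro _
            rw [hV']
            refine ⟨h1 _ (by omega), ?_⟩
            rw [mem_preimage, ← iterate_succ_apply' g, show (n - 1 - 0).succ = n by omega, ← h2]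
            exact hwV
          | succ j ih =>
            intro hj
            have h3 := hV'V (ih (by omega))
            rw [hV']
            refine ⟨h1 _ (by omega), ?_⟩
            rw [mem_preimage, ← iterate_succ_apply' g, show (n - 1 - (j+1)).succ = n - 1 - j by omega]
            exact h3
        have h4 := hdesc (n - 1) (by omega)
        rwa [show n - 1 - (n - 1) = 0 by omega] at h4
    have hback : ∀ n, g^[n] q ∈ Kstar → q ∈ Kstar := by
      intro n
      induction n with
      | zero => exact fun hx => hx
      | succ n ih =>
        intro hx
        apply ih
        rw [← hKinv]
        exact ⟨ho n, by rw [mem_preimage, ← iterate_succ_apply' g]; exact hx⟩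
    have hall : ∀ n, g^[n] q ∈ V := fun n => key _
      (fun m => by rw [← iterate_add_apply]; exact ho _)
      (by rw [← iterate_add_apply, add_comm, iterate_add_apply, hper])
      (fun hx => hqK (hback n hx))
    apply hqK
    rw [hKJ]
    intro n
    rw [hV']
    exact ⟨ho n, by rw [mem_preimage, ← iterate_succ_apply' g]; exact hall _⟩
  -- the frontier lies in the closure
  have hfr : frontier Kstar ⊆ closure (repellingPts g U') := by
    intro z hz
    obtain ⟨φ, ψ, φ', ψ', h, M⟩ := mk_model hD'.1 hD'.2.2 hD.1 hD.2.2 hV'V hne hgV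
      hmV hpV hKcomp hKfull hKV' hKn hcrV hinv
    have hPM : PM (cg g φ ψ) (cU V' φ) (ψ '' Kstar) φ' ψ' d :=
      ⟨M, conj_deg hD'.1 hD.1 h hV'V hgV hmV hdV, H.two_le_d, fun x hx => by
        have hxb : x ∈ ball (0:ℂ) 1 := (hx 0).1
        refine ⟨φ x, ?_, h.l x hxb⟩
        rw [hKJ]
        intro n
        exact (conj_fwd h hmV (n := n+1) ⟨hxb, fun i _ => hx i⟩).1 n (Nat.lt_succ_self n)⟩
    have hKV := hKV'.trans hV'V
    have hzV : z ∈ V := hKV (hKcomp.isClosed.frontier_subset hz)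
    have h1 := hPM.J_rep (frontier_compl_mem hD.1 h hKcomp hKV hz)
    have hφc : ContinuousAt φ (ψ z) :=
      h.dφ.continuousOn.continuousAt (isOpen_ball.mem_nhds (h.mψ hzV))
    rw [← h.r z hzV]
    refine hφc.continuousWithinAt.mem_closure h1 fun x hx => ?_
    obtain ⟨p, hp, ho, hr⟩ := conj_rep hD.1 h hmV M hx
    exact ⟨p, hp, fun n => hV'U' (ho n), hr⟩
  have hec : Continuous (fun z : ℂ => (z : OnePoint ℂ)) := OnePoint.continuous_coe
  apply Subset.antisymm
  · refine closure_minimal (image_mono hrep) ?_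
    exact ((hKcomp.of_isClosed_subset isClosed_frontier hKcomp.isClosed.frontier_subset).image
      hec).isClosed
  · exact (image_mono hfr).trans (image_closure_subset_closure_image hec)

end RC

/-- **Theorem.** Let `K*` be the maximal full completely invariant compact and `R_g` the
closure in the Riemann sphere of the repelling periodic points. If `P_g ⊆ K*` and `K*` is
the filled Julia set of a polynomial-like restriction of `g`, then `R_g = ∂K*`. In the
remaining cases (`K* = ∅`, or `∂K* ⊆ P_g` with a critical point outside `K*`), `R_g`
contains a nontrivial continuum meeting both `U` and `∂U` (boundary taken in the sphere). -/
theorem repelling_closure_alternatives {g : ℂ → ℂ} {U' U : Set ℂ} {d : ℕ}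
    (H : PLSetting g U' U d) {Kstar : Set ℂ}
    (hKU : Kstar ⊆ U) (hKcomp : IsCompact Kstar) (hKfull : IsConnected Kstarᶜ)
    (hKinv : U' ∩ g ⁻¹' Kstar = Kstar)
    (hKmax : ∀ K : Set ℂ, K ⊆ U → IsCompact K → IsConnected Kᶜ →
      U' ∩ g ⁻¹' K = K → K ⊆ Kstar) :
    ((postCrit g U' ⊆ Kstar ∧
        ∃ V' V : Set ℂ, V ⊆ U ∧ V' = U' ∩ g ⁻¹' V ∧ IsPolyLike g V' V d ∧
          Kstar = filledJulia g V') →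
      sphereRepClosure g U' = (fun z : ℂ => (z : OnePoint ℂ)) '' frontier Kstar) ∧
    ((Kstar = ∅ ∨ (frontier Kstar ⊆ postCrit g U' ∧ (critPts g U' \ Kstar).Nonempty)) →
      ∃ C : Set (OnePoint ℂ), C ⊆ sphereRepClosure g U' ∧ IsCompact C ∧ IsConnected C ∧
        C.Nontrivial ∧
        (C ∩ (fun z : ℂ => (z : OnePoint ℂ)) '' U).Nonempty ∧
        (C ∩ frontier ((fun z : ℂ => (z : OnePoint ℂ)) '' U)).Nonempty) := by
  exact ⟨fun ⟨h1, V', V, h2, h3, h4, h5⟩ =>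
      RC.case1_final H hKcomp hKfull hKinv h1 h2 h3 h4 h5,
    fun h => RC.case2_final H hKmax (by
      rcases h with rfl | h
      · rw [Set.sdiff_empty]; exact RC.crit_nonempty H
      · exact h.2)⟩
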